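/- arXiv:1904.06267 — 11 statements merged into one kernel-verified Lean document; each statement's English description precedes it below -/
import Mathlib

section
/- Let G be a finite simple graph on n ≥ 3 vertices having an isolated vertex w and an edge e = uv. Let H be the graph obtained from G by deleting the edge e and adding the edge uw. Then D(H,x) ≥ D(G,x) for all x ≥ 0. Moreover, if v has degree at least 2 in G, then D(H,x) > D(G,x) for all x > 0. -/
open scoped Classical

/-- `S` is a dominating set of `G`: every vertex is in `S` or adjacent to a vertex of `S`. -/
def IsDomSet {V : Type*} (G : SimpleGraph V) (S : Finset V) : Prop :=
  ∀ v : V, v ∈ S ∨ ∃ u ∈ S, G.Adj u v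

/-- `d(G,i)`: the number of dominating sets of `G` of cardinality `i`. -/
noncomputable def domCount {V : Type*} [Fintype V] (G : SimpleGraph V) (i : ℕ) : ℕ :=
  (Finset.univ.filter (fun S : Finset V => IsDomSet G S ∧ S.card = i)).card

/-- The domination polynomial `D(G,x) = ∑_{i=1}^{n} d(G,i) x^i`. -/
noncomputable def domPoly {V : Type*} [Fintype V] (G : SimpleGraph V) (x : ℝ) : ℝ :=
  ∑ i ∈ Finset.Icc 1 (Fintype.card V), (domCount G i : ℝ) * x ^ i

/-- The edge `uv` of `G` is replaced by the edge `uw`. -/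
def moveEdge {V : Type*} (G : SimpleGraph V) (u v w : V) : SimpleGraph V :=
  G.deleteEdges {s(u, v)} ⊔ SimpleGraph.fromEdgeSet {s(u, w)}

lemma moveEdge_adj {V : Type*} {G : SimpleGraph V} {u v w a b : V} :
    (moveEdge G u v w).Adj a b ↔
      (G.Adj a b ∧ ¬ (a = u ∧ b = v ∨ a = v ∧ b = u)) ∨
        ((a = u ∧ b = w ∨ a = w ∧ b = u) ∧ a ≠ b) := by
  simp [moveEdge]

lemma IsDomSet.mem_of_isolated {V : Type*} {G : SimpleGraph V} {S : Finset V} {w : V}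
    (hS : IsDomSet G S) (hw : ∀ z, ¬ G.Adj z w) : w ∈ S :=
  (hS w).resolve_right fun ⟨z, _, hz⟩ => hw z hz

/-- A dominating set of `G` that does not dominate after moving the edge contains `u`, avoids `v`,
and `u` is its only neighbour of `v`. -/
lemma IsDomSet.of_not_moveEdge {V : Type*} {G : SimpleGraph V} {S : Finset V} {u v w : V}
    (hw : ∀ z, ¬ G.Adj z w) (he : G.Adj u v) (hS : IsDomSet G S)
    (hn : ¬ IsDomSet (moveEdge G u v w) S) :
    u ∈ S ∧ v ∉ S ∧ ∀ z ∈ S, G.Adj z v → z = u := by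
  have hwS := hS.mem_of_isolated hw
  have huw : w ≠ u := fun h => hw v (h ▸ he.symm)
  unfold IsDomSet at hn
  push Not at hn
  obtain ⟨y, hyS, hy⟩ := hn
  simp only [moveEdge_adj] at hy
  have hyu : y ≠ u := by
    rintro rfl
    exact hy w hwS (Or.inr ⟨Or.inr ⟨rfl, rfl⟩, huw⟩)
  have key : ∀ z ∈ S, G.Adj z y → z = u ∧ y = v := by
    intro z hz hzy
    by_contra hne
    exact hy z hz (Or.inl ⟨hzy, by tauto⟩)
  obtain ⟨z, hz, hzy⟩ := (hS y).resolve_left hyS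
  obtain ⟨rfl, rfl⟩ := key z hz hzy
  exact ⟨hz, hyS, fun a ha hay => (key a ha hay).1⟩

lemma IsDomSet.insert_erase_moveEdge {V : Type*} {G : SimpleGraph V} {S : Finset V} {u v w : V}
    (hw : ∀ z, ¬ G.Adj z w) (he : G.Adj u v) (hS : IsDomSet G S) (hu : u ∈ S) :
    IsDomSet (moveEdge G u v w) (insert v (S.erase w)) := by
  have huw : u ≠ w := fun h => hw v (h ▸ he.symm)
  intro y
  simp only [moveEdge_adj, Finset.mem_insert, Finset.mem_erase]
  by_cases hyw : y = w
  · exact Or.inr ⟨u, Or.inr ⟨huw, hu⟩, Or.inr ⟨Or.inl ⟨rfl, hyw⟩, hyw ▸ huw⟩⟩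
  by_cases hyv : y = v
  · exact Or.inl (Or.inl hyv)
  by_cases hyu : y = u
  · exact Or.inl (Or.inr ⟨hyw, hyu ▸ hu⟩)
  rcases hS y with h | ⟨z, hz, hzy⟩
  · exact Or.inl (Or.inr ⟨hyw, h⟩)
  · have hzw : z ≠ w := by
      rintro rfl
      exact hw y hzy.symm
    exact Or.inr ⟨z, Or.inr ⟨hzw, hz⟩, Or.inl ⟨hzy, by tauto⟩⟩

/-- The size-preserving injection from the dominating sets of `G` to those of `moveEdge G u v w`. -/
noncomputable def moveDomSet {V : Type*} (G : SimpleGraph V) (u v w : V) (S : Finset V) :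
    Finset V :=
  if IsDomSet (moveEdge G u v w) S then S else insert v (S.erase w)

section Injection

variable {V : Type*} {G : SimpleGraph V} {u v w : V}

lemma IsDomSet.moveDomSet {S : Finset V} (hw : ∀ z, ¬ G.Adj z w) (he : G.Adj u v)
    (hS : IsDomSet G S) : IsDomSet (moveEdge G u v w) (moveDomSet G u v w S) := by
  unfold _root_.moveDomSet
  split_ifs with h
  · exact h
  · exact hS.insert_erase_moveEdge hw he (hS.of_not_moveEdge hw he h).1

lemma card_moveDomSet {S : Finset V} (hw : ∀ z, ¬ G.Adj z w) (he : G.Adj u v)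
    (hS : IsDomSet G S) : (moveDomSet G u v w S).card = S.card := by
  unfold moveDomSet
  split_ifs with h
  · rfl
  · have hv := (hS.of_not_moveEdge hw he h).2.1
    rw [Finset.card_insert_of_notMem (fun h' => hv (Finset.mem_of_mem_erase h')),
      Finset.card_erase_add_one (hS.mem_of_isolated hw)]

lemma moveDomSet_injOn (hw : ∀ z, ¬ G.Adj z w) (he : G.Adj u v) :
    Set.InjOn (moveDomSet G u v w) {S | IsDomSet G S} := by
  intro S hS T hT hST
  have hvw : w ≠ v := fun h => hw u (h ▸ he)
  have hwS := IsDomSet.mem_of_isolated hS hw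
  have hwT := IsDomSet.mem_of_isolated hT hw
  unfold moveDomSet at hST
  split_ifs at hST with h1 h2 h2
  · exact hST
  · simp [hST, hvw] at hwS
  · simp [← hST, hvw] at hwT
  · have hvS := (IsDomSet.of_not_moveEdge hw he hS h1).2.1
    have hvT := (IsDomSet.of_not_moveEdge hw he hT h2).2.1
    ext a
    have := Finset.ext_iff.mp hST a
    simp only [Finset.mem_insert, Finset.mem_erase] at this
    by_cases haw : a = w
    · simp [haw, hwS, hwT]
    by_cases hav : a = v
    · simp [hav, hvS, hvT]
    · simpa [haw, hav] using this

variable [Fintype V]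

lemma domCount_le_domCount_moveEdge (hw : ∀ z, ¬ G.Adj z w) (he : G.Adj u v) (i : ℕ) :
    domCount G i ≤ domCount (moveEdge G u v w) i := by
  refine Finset.card_le_card_of_injOn (moveDomSet G u v w) ?_ ?_
  · intro S hS
    simp only [Finset.coe_filter, Finset.mem_univ, true_and, Set.mem_ofPred_eq] at hS ⊢
    exact ⟨hS.1.moveDomSet hw he, (card_moveDomSet hw he hS.1).trans hS.2⟩
  · exact (moveDomSet_injOn hw he).mono fun S hS => by simp at hS; exact hS.1

lemma moveDomSet_ne_erase_univ {S : Finset V} (hw : ∀ z, ¬ G.Adj z w) (he : G.Adj u v)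
    (hd : 2 ≤ G.degree v) (hS : IsDomSet G S) :
    moveDomSet G u v w S ≠ Finset.univ.erase w := by
  have hwS := hS.mem_of_isolated hw
  unfold moveDomSet
  split_ifs with h
  · rintro rfl
    simp at hwS
  · intro heq
    obtain ⟨z, hz, hzu⟩ := Finset.exists_mem_ne (Nat.one_lt_two.trans_le hd) u
    rw [SimpleGraph.mem_neighborFinset] at hz
    have hzw : z ≠ w := by
      rintro rfl
      exact hw v hz
    have hmem : z ∈ insert v (S.erase w) := by simp [heq, hzw]
    have hzS : z ∈ S := by simpa [hz.ne', hzw] using hmem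
    exact hzu ((hS.of_not_moveEdge hw he h).2.2 z hzS hz.symm)

lemma isDomSet_moveEdge_erase_univ (huw : u ≠ w) :
    IsDomSet (moveEdge G u v w) (Finset.univ.erase w) := by
  intro y
  by_cases hyw : y = w
  · exact Or.inr ⟨u, by simp [huw], moveEdge_adj.2 (Or.inr ⟨Or.inl ⟨rfl, hyw⟩, hyw ▸ huw⟩)⟩
  · exact Or.inl (by simp [hyw])

lemma domCount_lt_domCount_moveEdge (hw : ∀ z, ¬ G.Adj z w) (he : G.Adj u v)
    (hd : 2 ≤ G.degree v) :
    domCount G (Fintype.card V - 1) < domCount (moveEdge G u v w) (Fintype.card V - 1) := by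
  have huw : u ≠ w := fun h => hw v (h ▸ he.symm)
  have hT : Finset.univ.erase w ∈ Finset.univ.filter (fun S : Finset V =>
      IsDomSet (moveEdge G u v w) S ∧ S.card = Fintype.card V - 1) := by
    simp [isDomSet_moveEdge_erase_univ huw, Finset.card_erase_of_mem]
  refine lt_of_le_of_lt ?_ (Finset.card_erase_lt_of_mem hT)
  refine Finset.card_le_card_of_injOn (moveDomSet G u v w) ?_ ?_
  · intro S hS
    simp only [Finset.coe_filter, Finset.mem_univ, true_and, Set.mem_ofPred_eq] at hS
    rw [Finset.mem_coe, Finset.mem_erase, Finset.mem_filter]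
    exact ⟨moveDomSet_ne_erase_univ hw he hd hS.1, Finset.mem_univ _, hS.1.moveDomSet hw he,
      (card_moveDomSet hw he hS.1).trans hS.2⟩
  · exact (moveDomSet_injOn hw he).mono fun S hS => by simp at hS; exact hS.1

end Injection

theorem stmt_1 {V : Type*} [Fintype V] (hn : 3 ≤ Fintype.card V)
    (G : SimpleGraph V) (w u v : V)
    (hw : G.degree w = 0) (he : G.Adj u v)
    (H : SimpleGraph V)
    (hH : H = G.deleteEdges {s(u, v)} ⊔ SimpleGraph.fromEdgeSet {s(u, w)}) :
    (∀ x : ℝ, 0 ≤ x → domPoly G x ≤ domPoly H x) ∧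
    (2 ≤ G.degree v → ∀ x : ℝ, 0 < x → domPoly G x < domPoly H x) := by
  have hw' : ∀ z, ¬ G.Adj z w := fun z hz =>
    ((G.degree_pos_iff_exists_adj w).2 ⟨z, hz.symm⟩).ne' hw
  obtain rfl : H = moveEdge G u v w := hH
  have hle : ∀ x : ℝ, 0 ≤ x → ∀ i,
      (domCount G i : ℝ) * x ^ i ≤ domCount (moveEdge G u v w) i * x ^ i := fun x hx i =>
    mul_le_mul_of_nonneg_right (mod_cast domCount_le_domCount_moveEdge hw' he i) (pow_nonneg hx i)
  refine ⟨fun x hx => Finset.sum_le_sum fun i _ => hle x hx i, fun hd x hx => ?_⟩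
  refine Finset.sum_lt_sum (fun i _ => hle x hx.le i) ⟨Fintype.card V - 1, ?_, ?_⟩
  · rw [Finset.mem_Icc]
    omega
  · exact mul_lt_mul_of_pos_right (mod_cast domCount_lt_domCount_moveEdge hw' he hd)
      (pow_pos hx _)
end

section
/- Let n ≥ 2 be even and m = n/2. Then the perfect matching mK₂ (the disjoint union of m copies of K₂) is optimal among all graphs on n vertices and m edges, and every optimal graph on n vertices and m edges is isomorphic to mK₂. -/
open scoped Classical

/-- The graph `mK₂ ∪ rK₁` on `n` vertices: vertices `2k` and `2k+1` are matched for `k < m`,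
and the remaining `n - 2m` vertices are isolated. -/
def mK2rK1 (n m : ℕ) : SimpleGraph (Fin n) :=
  SimpleGraph.fromRel
    (fun i j => (i : ℕ) < 2 * m ∧ (j : ℕ) < 2 * m ∧ (i : ℕ) / 2 = (j : ℕ) / 2)

open Finset

lemma exists_adj_of_ncard_eq_succ {V : Type*} {G : SimpleGraph V} {m : ℕ}
    (hG : G.edgeSet.ncard = m + 1) : ∃ u w, G.Adj u w := by
  obtain ⟨e, he⟩ := Set.nonempty_of_ncard_ne_zero (s := G.edgeSet) (by omega)
  induction e with
  | _ u w => exact ⟨u, w, he⟩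

lemma ncard_edgeSet_deleteEdge {V : Type*} {G : SimpleGraph V} {u w : V}
    (h : G.Adj u w) {m : ℕ} (hG : G.edgeSet.ncard = m + 1) :
    (G.deleteEdges {s(u, w)}).edgeSet.ncard = m := by
  rw [SimpleGraph.edgeSet_deleteEdges, Set.ncard_sdiff_singleton_of_mem (G.mem_edgeSet.2 h), hG]
  rfl

lemma mem_of_isDomSet_of_isolated {V : Type*} {G : SimpleGraph V} {u : V} (hu : ∀ t, ¬G.Adj t u)
    {S : Finset V} (hS : IsDomSet G S) : u ∈ S := by
  rcases hS u with h | ⟨t, -, h⟩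
  exacts [h, absurd h (hu t)]

section WeightedDomination

variable {V : Type*} [Fintype V]

/-- The dominating sets of `G`. -/
noncomputable def domSets (G : SimpleGraph V) : Finset (Finset V) :=
  univ.filter (IsDomSet G)

lemma mem_domSets {G : SimpleGraph V} {S : Finset V} : S ∈ domSets G ↔ IsDomSet G S := by
  simp [domSets]

lemma domPoly_eq_sum_domSets [Nonempty V] (G : SimpleGraph V) (x : ℝ) :
    domPoly G x = ∑ S ∈ domSets G, x ^ S.card := by
  have hmaps : ∀ S ∈ domSets G, S.card ∈ Icc 1 (Fintype.card V) := by
    intro S hS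
    rw [mem_domSets] at hS
    refine mem_Icc.2 ⟨card_pos.2 ?_, card_le_univ S⟩
    obtain ⟨v⟩ := ‹Nonempty V›
    rcases hS v with h | ⟨u, h, -⟩
    exacts [⟨v, h⟩, ⟨u, h⟩]
  rw [← sum_fiberwise_of_maps_to hmaps, domPoly]
  refine sum_congr rfl fun i _ => ?_
  rw [sum_congr rfl (g := fun _ => x ^ i) fun S hS => by rw [(mem_filter.1 hS).2],
    sum_const, nsmul_eq_mul, domCount, domSets, filter_filter]

/-- The sets avoiding `u` which become dominating once `u` is added. -/
noncomputable def almostDomSets (G : SimpleGraph V) (u : V) : Finset (Finset V) :=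
  univ.filter fun S => u ∉ S ∧ IsDomSet G (insert u S)

lemma mem_almostDomSets {G : SimpleGraph V} {u : V} {S : Finset V} :
    S ∈ almostDomSets G u ↔ u ∉ S ∧ IsDomSet G (insert u S) := by
  simp [almostDomSets]

lemma mul_sum_almostDomSets (G : SimpleGraph V) (u : V) (x : ℝ) :
    x * ∑ S ∈ almostDomSets G u, x ^ S.card =
      ∑ S ∈ (domSets G).filter (u ∈ ·), x ^ S.card := by
  rw [mul_sum]
  refine sum_bij' (fun S _ => insert u S) (fun S _ => S.erase u) ?_ ?_ ?_ ?_ ?_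
  · intro S hS
    simp [mem_domSets, (mem_almostDomSets.1 hS).2]
  · intro S hS
    rw [mem_filter, mem_domSets] at hS
    simp [mem_almostDomSets, insert_erase hS.2, hS.1]
  · intro S hS
    exact erase_insert (mem_almostDomSets.1 hS).1
  · intro S hS
    exact insert_erase (mem_filter.1 hS).2
  · intro S hS
    rw [card_insert_of_notMem (mem_almostDomSets.1 hS).1, pow_succ']

lemma domSets_subset_of_deleteEdge (H : SimpleGraph V) (u w : V) :
    domSets H ⊆ domSets (H.deleteEdges {s(u, w)}) ∪
      (almostDomSets (H.deleteEdges {s(u, w)}) u ∪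
        almostDomSets (H.deleteEdges {s(u, w)}) w) := by
  intro S hS
  simp only [mem_union, mem_domSets, mem_almostDomSets, IsDomSet, mem_insert,
    SimpleGraph.deleteEdges_adj, Set.mem_singleton_iff, Sym2.eq_iff] at hS ⊢
  by_cases hu : u ∈ S <;> by_cases hw : w ∈ S
  · left; grind
  · right; right; grind
  · right; left; grind
  · left; grind

lemma mul_sum_domSets_le (H : SimpleGraph V) (u w : V) {x : ℝ} (hx : 0 ≤ x) :
    x * ∑ S ∈ domSets H, x ^ S.card ≤
      x * ∑ S ∈ domSets (H.deleteEdges {s(u, w)}), x ^ S.card +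
      (∑ S ∈ (domSets (H.deleteEdges {s(u, w)})).filter (u ∈ ·), x ^ S.card +
        ∑ S ∈ (domSets (H.deleteEdges {s(u, w)})).filter (w ∈ ·), x ^ S.card) := by
  have hunion : ∀ A B : Finset (Finset V),
      ∑ S ∈ A ∪ B, x ^ S.card ≤ ∑ S ∈ A, x ^ S.card + ∑ S ∈ B, x ^ S.card := by
    intro A B
    rw [← sum_union_inter]
    exact le_add_of_nonneg_right (sum_nonneg fun _ _ => by positivity)
  rw [← mul_sum_almostDomSets, ← mul_sum_almostDomSets, ← mul_add, ← mul_add]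
  refine mul_le_mul_of_nonneg_left ?_ hx
  calc _ ≤ _ := sum_le_sum_of_subset_of_nonneg (domSets_subset_of_deleteEdge H u w)
        fun _ _ _ => by positivity
    _ ≤ _ := hunion _ _
    _ ≤ _ := by gcongr; exact hunion _ _

lemma sum_domSets_filter_le (G : SimpleGraph V) (u : V) {x : ℝ} (hx : 0 ≤ x) :
    ∑ S ∈ (domSets G).filter (u ∈ ·), x ^ S.card ≤ ∑ S ∈ domSets G, x ^ S.card :=
  sum_le_sum_of_subset_of_nonneg (filter_subset _ _) fun _ _ _ => by positivity

lemma sum_domSets_filter_lt {G : SimpleGraph V} {u v : V} (h : G.Adj v u) {x : ℝ} (hx : 0 < x) :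
    ∑ S ∈ (domSets G).filter (u ∈ ·), x ^ S.card < ∑ S ∈ domSets G, x ^ S.card := by
  refine sum_lt_sum_of_subset (filter_subset _ _) (i := univ.erase u) ?_ (by simp)
    (by positivity) fun _ _ _ => by positivity
  rw [mem_domSets]
  intro t
  by_cases ht : t = u
  · subst ht
    exact Or.inr ⟨v, by simpa using h.ne, h⟩
  · exact Or.inl (by simpa using ht)

lemma sum_domSets_of_ncard_eq_zero {G : SimpleGraph V} (hG : G.edgeSet.ncard = 0) (x : ℝ) :
    ∑ S ∈ domSets G, x ^ S.card = x ^ Fintype.card V := by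
  rw [Set.ncard_eq_zero (Set.toFinite _), SimpleGraph.edgeSet_eq_empty] at hG
  subst hG
  have : domSets (⊥ : SimpleGraph V) = {univ} := by
    ext S
    simp [mem_domSets, IsDomSet, eq_univ_iff_forall]
  simp [this]

theorem pow_mul_sum_domSets_le {x : ℝ} (hx : 0 ≤ x) (m : ℕ) (G : SimpleGraph V)
    (hG : G.edgeSet.ncard = m) :
    x ^ m * ∑ S ∈ domSets G, x ^ S.card ≤ x ^ Fintype.card V * (x + 2) ^ m := by
  induction m generalizing G with
  | zero => simp [sum_domSets_of_ncard_eq_zero hG]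
  | succ m ih =>
    obtain ⟨u, w, h⟩ := exists_adj_of_ncard_eq_succ hG
    have hstep := mul_sum_domSets_le G u w hx
    have hu := sum_domSets_filter_le (G.deleteEdges {s(u, w)}) u hx
    have hw := sum_domSets_filter_le (G.deleteEdges {s(u, w)}) w hx
    calc x ^ (m + 1) * ∑ S ∈ domSets G, x ^ S.card
        = x ^ m * (x * ∑ S ∈ domSets G, x ^ S.card) := by ring
      _ ≤ x ^ m * ((x + 2) * ∑ S ∈ domSets (G.deleteEdges {s(u, w)}), x ^ S.card) := by
          refine mul_le_mul_of_nonneg_left ?_ (by positivity)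
          linarith
      _ = (x + 2) * (x ^ m * ∑ S ∈ domSets (G.deleteEdges {s(u, w)}), x ^ S.card) := by ring
      _ ≤ (x + 2) * (x ^ Fintype.card V * (x + 2) ^ m) :=
          mul_le_mul_of_nonneg_left (ih _ (ncard_edgeSet_deleteEdge h hG)) (by positivity)
      _ = _ := by ring

lemma pow_mul_sum_domSets_lt {x : ℝ} (hx : 0 < x) {m : ℕ} {G : SimpleGraph V}
    (hG : G.edgeSet.ncard = m) {u v w : V} (hu : G.Adj w u) (hv : G.Adj w v) (huv : u ≠ v) :
    x ^ m * ∑ S ∈ domSets G, x ^ S.card < x ^ Fintype.card V * (x + 2) ^ m := by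
  obtain _ | m := m
  · rw [Set.ncard_eq_zero (Set.toFinite _), SimpleGraph.edgeSet_eq_empty] at hG
    simp [hG] at hu
  have hstep := mul_sum_domSets_le G u w hx.le
  have hle := sum_domSets_filter_le (G.deleteEdges {s(u, w)}) u hx.le
  have hlt : ∑ S ∈ (domSets (G.deleteEdges {s(u, w)})).filter (w ∈ ·), x ^ S.card <
      ∑ S ∈ domSets (G.deleteEdges {s(u, w)}), x ^ S.card := by
    refine sum_domSets_filter_lt (v := v) ?_ hx
    simp [SimpleGraph.deleteEdges_adj, hv.symm, huv.symm, hv.ne']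
  have ih := pow_mul_sum_domSets_le hx.le m _ (ncard_edgeSet_deleteEdge hu.symm hG)
  calc x ^ (m + 1) * ∑ S ∈ domSets G, x ^ S.card
      = x ^ m * (x * ∑ S ∈ domSets G, x ^ S.card) := by ring
    _ < x ^ m * ((x + 2) * ∑ S ∈ domSets (G.deleteEdges {s(u, w)}), x ^ S.card) := by
        refine mul_lt_mul_of_pos_left ?_ (by positivity)
        linarith
    _ = (x + 2) * (x ^ m * ∑ S ∈ domSets (G.deleteEdges {s(u, w)}), x ^ S.card) := by ring
    _ ≤ (x + 2) * (x ^ Fintype.card V * (x + 2) ^ m) :=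
        mul_le_mul_of_nonneg_left ih (by positivity)
    _ = _ := by ring

lemma sum_domSets_filter_of_isolated {G : SimpleGraph V} {u : V} (hu : ∀ t, ¬G.Adj t u) (x : ℝ) :
    ∑ S ∈ (domSets G).filter (u ∈ ·), x ^ S.card = ∑ S ∈ domSets G, x ^ S.card := by
  rw [filter_true_of_mem fun S hS => mem_of_isDomSet_of_isolated hu (mem_domSets.1 hS)]

lemma almostDomSets_subset_of_isolated {H : SimpleGraph V} {u w : V} (h : H.Adj u w)
    (hu : ∀ t, ¬(H.deleteEdges {s(u, w)}).Adj t u)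
    (hw : ∀ t, ¬(H.deleteEdges {s(u, w)}).Adj t w) :
    almostDomSets (H.deleteEdges {s(u, w)}) u ⊆ domSets H := by
  intro S hS
  rw [mem_almostDomSets] at hS
  have hwS : w ∈ S := mem_of_mem_insert_of_ne (mem_of_isDomSet_of_isolated hw hS.2) h.ne'
  rw [mem_domSets]
  intro v
  by_cases hvu : v = u
  · exact Or.inr ⟨w, hwS, hvu ▸ h.symm⟩
  rcases hS.2 v with hv | ⟨t, ht, htv⟩
  · exact Or.inl (mem_of_mem_insert_of_ne hv hvu)
  · refine Or.inr ⟨t, mem_of_mem_insert_of_ne ht ?_, SimpleGraph.deleteEdges_le _ htv⟩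
    rintro rfl
    exact hu v htv.symm

lemma mul_sum_domSets_of_isolated {H : SimpleGraph V} {u w : V} (h : H.Adj u w)
    (hu : ∀ t, ¬(H.deleteEdges {s(u, w)}).Adj t u)
    (hw : ∀ t, ¬(H.deleteEdges {s(u, w)}).Adj t w) (x : ℝ) :
    x * ∑ S ∈ domSets H, x ^ S.card =
      (x + 2) * ∑ S ∈ domSets (H.deleteEdges {s(u, w)}), x ^ S.card := by
  have hcomm : H.deleteEdges {s(w, u)} = H.deleteEdges {s(u, w)} := by rw [Sym2.eq_swap]
  have hsub : domSets (H.deleteEdges {s(u, w)}) ∪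
      (almostDomSets (H.deleteEdges {s(u, w)}) u ∪
        almostDomSets (H.deleteEdges {s(u, w)}) w) ⊆ domSets H := by
    refine union_subset ?_ (union_subset (almostDomSets_subset_of_isolated h hu hw) ?_)
    · intro S hS
      rw [mem_domSets] at hS ⊢
      exact fun v => (hS v).imp_right fun ⟨t, ht, htv⟩ =>
        ⟨t, ht, SimpleGraph.deleteEdges_le _ htv⟩
    · rw [← hcomm] at hu hw ⊢
      exact almostDomSets_subset_of_isolated h.symm hw hu
  rw [(domSets_subset_of_deleteEdge H u w).antisymm hsub, sum_union, sum_union, mul_add, mul_add,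
    mul_sum_almostDomSets, mul_sum_almostDomSets, sum_domSets_filter_of_isolated hu,
    sum_domSets_filter_of_isolated hw]
  · ring
  · rw [disjoint_left]
    intro S hS hS'
    rw [mem_almostDomSets] at hS hS'
    exact hS.1 (mem_of_mem_insert_of_ne (mem_of_isDomSet_of_isolated hu hS'.2) h.ne)
  · rw [disjoint_left]
    intro S hS hS'
    rw [mem_domSets] at hS
    rw [mem_union, mem_almostDomSets, mem_almostDomSets] at hS'
    rcases hS' with hS' | hS'
    · exact hS'.1 (mem_of_isDomSet_of_isolated hu hS)
    · exact hS'.1 (mem_of_isDomSet_of_isolated hw hS)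

theorem pow_mul_sum_domSets_of_matching (x : ℝ) (m : ℕ) (G : SimpleGraph V)
    (hG : G.edgeSet.ncard = m) (hmatch : ∀ u v w, G.Adj w u → G.Adj w v → u = v) :
    x ^ m * ∑ S ∈ domSets G, x ^ S.card = x ^ Fintype.card V * (x + 2) ^ m := by
  induction m generalizing G with
  | zero => simp [sum_domSets_of_ncard_eq_zero hG]
  | succ m ih =>
    obtain ⟨u, w, h⟩ := exists_adj_of_ncard_eq_succ hG
    have hu : ∀ t, ¬(G.deleteEdges {s(u, w)}).Adj t u := by
      intro t ht
      rw [SimpleGraph.deleteEdges_adj] at ht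
      obtain rfl := hmatch _ _ _ ht.1.symm h
      exact ht.2 Sym2.eq_swap
    have hw : ∀ t, ¬(G.deleteEdges {s(u, w)}).Adj t w := by
      intro t ht
      rw [SimpleGraph.deleteEdges_adj] at ht
      obtain rfl := hmatch _ _ _ ht.1.symm h.symm
      exact ht.2 rfl
    have ih' := ih _ (ncard_edgeSet_deleteEdge h hG) fun a b c hca hcb =>
      hmatch a b c (SimpleGraph.deleteEdges_le _ hca) (SimpleGraph.deleteEdges_le _ hcb)
    calc x ^ (m + 1) * ∑ S ∈ domSets G, x ^ S.card
        = x ^ m * (x * ∑ S ∈ domSets G, x ^ S.card) := by ring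
      _ = (x + 2) * (x ^ m * ∑ S ∈ domSets (G.deleteEdges {s(u, w)}), x ^ S.card) := by
          rw [mul_sum_domSets_of_isolated h hu hw]; ring
      _ = _ := by rw [ih']; ring

end WeightedDomination

/-- The fixed-point-free involution swapping the ends of each edge of a `1`-regular graph. -/
lemma exists_perm_of_existsUnique_adj {V : Type*} {G : SimpleGraph V} (hG : ∀ v, ∃! w, G.Adj v w) :
    ∃ σ : Equiv.Perm V, ∀ v w, G.Adj v w ↔ σ v = w := by
  choose f hf hf' using hG
  have hinv : Function.Involutive f := fun v => (hf' (f v) v (hf v).symm).symm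
  refine ⟨hinv.toPerm, fun v w => ⟨fun h => (hf' v w h).symm, ?_⟩⟩
  rintro rfl
  exact hf v

section PerfectMatching

variable {V : Type*} [Fintype V]

lemma cycleType_of_adj_iff {G : SimpleGraph V} {σ : Equiv.Perm V}
    (hσ : ∀ v w, G.Adj v w ↔ σ v = w) :
    σ.cycleType = Multiset.replicate (Fintype.card V / 2) 2 := by
  have hsq : σ ^ 2 = 1 := by
    ext v
    rw [sq, Equiv.Perm.mul_apply, Equiv.Perm.one_apply, ← hσ]
    exact ((hσ v (σ v)).2 rfl).symm
  have hsupp : σ.support = univ := by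
    ext v
    simpa using ((hσ v (σ v)).2 rfl).ne'
  have htwo : ∀ k ∈ σ.cycleType, k = 2 := by
    intro k hk
    have hdvd := (Equiv.Perm.dvd_of_mem_cycleType hk).trans (orderOf_dvd_of_pow_eq_one hsq)
    exact le_antisymm (Nat.le_of_dvd two_pos hdvd) (Equiv.Perm.two_le_of_mem_cycleType hk)
  have hrep := Multiset.eq_replicate_card.2 htwo
  have hsum := σ.sum_cycleType
  rw [hrep, Multiset.sum_replicate, hsupp, card_univ, smul_eq_mul] at hsum
  rw [hrep, ← hsum, Nat.mul_div_cancel _ two_pos]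

theorem nonempty_iso_of_existsUnique_adj {G H : SimpleGraph V}
    (hG : ∀ v, ∃! w, G.Adj v w) (hH : ∀ v, ∃! w, H.Adj v w) : Nonempty (G ≃g H) := by
  obtain ⟨σ, hσ⟩ := exists_perm_of_existsUnique_adj hG
  obtain ⟨τ, hτ⟩ := exists_perm_of_existsUnique_adj hH
  have hconj : IsConj σ τ := by
    rw [Equiv.Perm.isConj_iff_cycleType_eq, cycleType_of_adj_iff hσ, cycleType_of_adj_iff hτ]
  obtain ⟨c, rfl⟩ := isConj_iff.1 hconj
  refine ⟨⟨c, fun {a b} => ?_⟩⟩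
  rw [hτ, hσ]
  simp

lemma two_mul_ncard_edgeSet (G : SimpleGraph V) : ∑ v, G.degree v = 2 * G.edgeSet.ncard := by
  rw [G.sum_degrees_eq_twice_card_edges, ← SimpleGraph.coe_edgeFinset, Set.ncard_coe_finset]

lemma two_mul_ncard_edgeSet_of_existsUnique_adj {G : SimpleGraph V}
    (hG : ∀ v, ∃! w, G.Adj v w) : 2 * G.edgeSet.ncard = Fintype.card V := by
  rw [← two_mul_ncard_edgeSet, sum_congr rfl fun v _ => SimpleGraph.degree_eq_one_iff_existsUnique_adj.2 (hG v)]
  simp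

lemma existsUnique_adj_of_matching {G : SimpleGraph V}
    (hmatch : ∀ u v w, G.Adj w u → G.Adj w v → u = v)
    (hcard : 2 * G.edgeSet.ncard = Fintype.card V) (v : V) : ∃! w, G.Adj v w := by
  have hle : ∀ v ∈ univ, G.degree v ≤ 1 := by
    intro v _
    rw [← SimpleGraph.card_neighborFinset_eq_degree, card_le_one]
    intro a ha b hb
    rw [SimpleGraph.mem_neighborFinset] at ha hb
    exact hmatch a b v ha hb
  have hsum : ∑ v, G.degree v = ∑ _v : V, 1 := by
    rw [two_mul_ncard_edgeSet, hcard]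
    simp
  exact SimpleGraph.degree_eq_one_iff_existsUnique_adj.1 ((sum_eq_sum_iff_of_le hle).1 hsum v (mem_univ v))

end PerfectMatching

lemma mK2rK1_existsUnique_adj {n m : ℕ} (hn : n = 2 * m) (v : Fin n) :
    ∃! w, (mK2rK1 n m).Adj v w := by
  have hv := v.isLt
  have hw : 4 * (v / 2 : ℕ) + 1 - v < n := by omega
  refine ⟨⟨4 * (v / 2 : ℕ) + 1 - v, hw⟩, ?_, ?_⟩
  · simp only [mK2rK1, SimpleGraph.fromRel_adj, ne_eq, Fin.ext_iff]
    omega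
  · intro w
    have hw := w.isLt
    simp only [mK2rK1, SimpleGraph.fromRel_adj, ne_eq, Fin.ext_iff]
    omega

theorem stmt_3 (n m : ℕ) (hn : 2 ≤ n) (heven : Even n) (hm : m = n / 2) :
    (mK2rK1 n m).edgeFinset.card = m ∧
    (∀ G : SimpleGraph (Fin n), G.edgeFinset.card = m →
      ∀ x : ℝ, 0 ≤ x → domPoly G x ≤ domPoly (mK2rK1 n m) x) ∧
    (∀ H : SimpleGraph (Fin n), H.edgeFinset.card = m →
      (∀ G : SimpleGraph (Fin n), G.edgeFinset.card = m →
        ∀ x : ℝ, 0 ≤ x → domPoly G x ≤ domPoly H x) →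
      Nonempty (H ≃g mK2rK1 n m)) := by
  have hn2 : n = 2 * m := by
    obtain ⟨k, rfl⟩ := heven
    omega
  have : Nonempty (Fin n) := ⟨⟨0, by omega⟩⟩
  have hcard : ∀ G : SimpleGraph (Fin n), G.edgeFinset.card = G.edgeSet.ncard := fun G => by
    rw [← SimpleGraph.coe_edgeFinset, Set.ncard_coe_finset]
  simp only [hcard]
  have hperf := mK2rK1_existsUnique_adj hn2
  have hK : (mK2rK1 n m).edgeSet.ncard = m := by
    have h := two_mul_ncard_edgeSet_of_existsUnique_adj hperf
    rw [Fintype.card_fin] at h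
    omega
  have hval (x : ℝ) := pow_mul_sum_domSets_of_matching x m _ hK
    fun u v w hu hv => (hperf w).unique hu hv
  refine ⟨hK, fun G hG x hx => ?_, fun H hH hopt => ?_⟩
  · rcases hx.eq_or_lt with rfl | hx
    · refine le_of_eq ?_
      have hzero : ∀ G : SimpleGraph (Fin n), domPoly G 0 = 0 := fun G =>
        sum_eq_zero fun i hi => by
          rw [zero_pow (by have := (mem_Icc.1 hi).1; omega), mul_zero]
      rw [hzero, hzero]
    · rw [domPoly_eq_sum_domSets, domPoly_eq_sum_domSets]
      refine le_of_mul_le_mul_left ?_ (pow_pos hx m)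
      rw [hval]
      exact pow_mul_sum_domSets_le hx.le m G hG
  · refine nonempty_iso_of_existsUnique_adj (existsUnique_adj_of_matching ?_ ?_) hperf
    · intro u v w hu hv
      by_contra huv
      have hlt := pow_mul_sum_domSets_lt one_pos hH hu hv huv
      have hle := hopt _ hK 1 zero_le_one
      rw [domPoly_eq_sum_domSets, domPoly_eq_sum_domSets] at hle
      have hval1 := hval 1
      rw [← hval1, one_pow, one_mul, one_mul] at hlt
      exact hlt.not_ge hle
    · rw [hH, Fintype.card_fin, hn2]
end

section
/- Let n ≥ 3 be odd and m = ⌈n/2⌉. Then the graph (m−2)K₂ ∪ K_{1,2} (the disjoint union of m−2 copies of K₂ with a path on 3 vertices) is optimal among all graphs on n vertices and m edges, and every optimal graph on n vertices and m edges is isomorphic to (m−2)K₂ ∪ K_{1,2}. -/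
open scoped Classical

/-- The graph `(m-2)K₂ ∪ K_{1,2}` on an odd number `n` of vertices
(where `m = ⌈n/2⌉`): vertices `2k` and `2k+1` are matched for `2k + 1 < n - 3`,
and the last three vertices `n-3, n-2, n-1` form a path with centre `n-2`. -/
def sparseOddOpt (n : ℕ) : SimpleGraph (Fin n) :=
  SimpleGraph.fromRel
    (fun i j =>
      ((i : ℕ) < n - 3 ∧ (j : ℕ) < n - 3 ∧ (i : ℕ) / 2 = (j : ℕ) / 2) ∨
      ((i : ℕ) = n - 2 ∧ ((j : ℕ) = n - 3 ∨ (j : ℕ) = n - 1)))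

/-- `u` is a leaf attached to `v`; when `u` and `v` span a component, only the smaller endpoint
counts as the support. -/
def IsPendantAt {V : Type*} [Fintype V] [LinearOrder V] (G : SimpleGraph V) (v u : V) : Prop :=
  G.Adj v u ∧ G.degree u = 1 ∧ (G.degree v = 1 → v < u)

theorem eq_of_adj_of_degree_eq_one {V : Type*} [Fintype V] {G : SimpleGraph V} {u v w : V}
    (hu : G.degree u = 1) (hv : G.Adj u v) (hw : G.Adj u w) : v = w :=
  Finset.card_le_one.1 hu.le v (by simpa using hv) w (by simpa using hw)

section Pendant

variable {V : Type*} [Fintype V] [LinearOrder V] {G : SimpleGraph V}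

theorem IsPendantAt.left_unique {v v' u : V} (h : IsPendantAt G v u) (h' : IsPendantAt G v' u) :
    v = v' :=
  eq_of_adj_of_degree_eq_one h.2.1 h.1.symm h'.1.symm

theorem IsPendantAt.not_isPendantAt {v u u' : V} (h : IsPendantAt G v u) :
    ¬ IsPendantAt G u u' := by
  intro h'
  obtain rfl : v = u' := eq_of_adj_of_degree_eq_one h.2.1 h.1.symm h'.1
  exact lt_asymm (h.2.2 h'.2.1) (h'.2.2 h.2.1)

/-- Vertices are at most supports plus isolated vertices plus edges. -/
theorem card_le_supports_add_isolated_add_edges (G : SimpleGraph V) :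
    Fintype.card V ≤ (Finset.univ.filter fun v => ∃ u, IsPendantAt G v u).card
      + (Finset.univ.filter fun v => G.degree v = 0).card + G.edgeFinset.card := by
  have pointwise : ∀ v : V, 2 + (Finset.univ.filter fun u => IsPendantAt G v u).card ≤
      2 * (if ∃ u, IsPendantAt G v u then 1 else 0) + 2 * (if G.degree v = 0 then 1 else 0)
        + G.degree v + (if G.degree v = 1 ∧ ¬ ∃ u, IsPendantAt G v u then 1 else 0) := by
    intro v
    have hle : (Finset.univ.filter fun u => IsPendantAt G v u).card ≤ G.degree v := by
      apply Finset.card_le_card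
      intro u hu
      simpa using (Finset.mem_filter.1 hu).2.1
    by_cases hP : ∃ u, IsPendantAt G v u
    · simp only [hP]
      simp
      omega
    · have h0 : (Finset.univ.filter fun u => IsPendantAt G v u).card = 0 := by
        rw [Finset.card_eq_zero, Finset.filter_eq_empty_iff]
        exact fun u _ hu => hP ⟨u, hu⟩
      simp only [hP, h0]
      split_ifs <;> simp_all; omega
  have double_count : (Finset.univ.filter fun v => G.degree v = 1 ∧ ¬ ∃ u, IsPendantAt G v u).card
      ≤ ∑ v : V, (Finset.univ.filter fun u => IsPendantAt G v u).card := by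
    simp_rw [Finset.card_filter]
    rw [Finset.sum_comm]
    apply Finset.sum_le_sum
    intro u _
    split_ifs with h
    · obtain ⟨hu, hP⟩ := h
      obtain ⟨v, hv⟩ := (G.degree_pos_iff_exists_adj u).1 (by omega)
      have huv : IsPendantAt G v u := by
        refine ⟨hv.symm, hu, fun hd => ?_⟩
        by_contra hlt
        exact hP ⟨v, hv, hd, fun _ => lt_of_le_of_ne (not_lt.1 hlt) hv.ne⟩
      rw [← Finset.card_filter]
      exact Finset.card_pos.2 ⟨v, by simpa using huv⟩
    · exact Nat.zero_le _
  have total := Finset.sum_le_sum fun v (_ : v ∈ Finset.univ) => pointwise v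
  simp only [Finset.sum_add_distrib, ← Finset.mul_sum, ← Finset.card_filter, Finset.sum_const,
    smul_eq_mul, Finset.card_univ] at total
  have handshake := G.sum_degrees_eq_twice_card_edges
  omega

/-- A graph on `2p + 1` vertices with `p + 1` edges admits `p` centres, each isolated or matched
with a leaf, whose partners exhaust all other vertices but one. -/
theorem exists_centers (p : ℕ) (hp : 1 ≤ p) (hV : Fintype.card V = 2 * p + 1)
    (hE : G.edgeFinset.card = p + 1) :
    ∃ (C : Finset V) (g : Option C ≃ (Cᶜ : Finset V)) (c₀ : C), C.card = p ∧
      (∀ c : C, G.degree (c : V) = 0 ∨ (G.Adj c (g (some c)) ∧ G.degree (g (some c) : V) = 1)) ∧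
      (G.degree (c₀ : V) = 0 ∨ ((∀ v, G.degree v ≠ 0) ∧ G.Adj c₀ (g none))) := by
  set P := Finset.univ.filter fun v => ∃ u, IsPendantAt G v u
  set I := Finset.univ.filter fun v => G.degree v = 0 with hIdef
  have hcount : Fintype.card V ≤ P.card + I.card + G.edgeFinset.card :=
    card_le_supports_add_isolated_add_edges G
  obtain ⟨U, hUI, hU⟩ := Finset.exists_subset_card_eq (s := I) (n := min I.card p)
    (min_le_left _ _)
  obtain ⟨Q, hQP, hQ⟩ := Finset.exists_subset_card_eq (s := P) (n := p - U.card) (by omega)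
  have hdeg : ∀ v ∈ U, G.degree v = 0 := fun v hv => (Finset.mem_filter.1 (hUI hv)).2
  have hsupp : ∀ v ∈ Q, ∃ u, IsPendantAt G v u := fun v hv => (Finset.mem_filter.1 (hQP hv)).2
  have hdisj : Disjoint U Q := by
    rw [Finset.disjoint_left]
    intro v hvU hvQ
    obtain ⟨u, hu⟩ := hsupp v hvQ
    exact ((G.degree_pos_iff_exists_adj v).2 ⟨u, hu.1⟩).ne' (hdeg v hvU)
  set C := U ∪ Q with hC
  have hCcard : C.card = p := by
    rw [hC, Finset.card_union_of_disjoint hdisj]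
    omega
  let leaf : Option C → V := fun o => o.elim (Classical.choice (Fintype.card_pos_iff.1 (by omega)))
    fun c => if h : ∃ u, IsPendantAt G (c : V) u then h.choose else c
  have leaf_spec : ∀ c : C, (c : V) ∈ Q → IsPendantAt G c (leaf (some c)) := by
    intro c hc
    have h := hsupp c hc
    simp only [leaf, Option.elim, dif_pos h]
    exact h.choose_spec
  obtain ⟨g, hg⟩ := Finset.exists_equiv_extend_of_card_eq (α := Option C) (t := Cᶜ)
    (s := Finset.univ.filter fun o => ∃ c : C, o = some c ∧ (c : V) ∈ Q) (f := leaf)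
    (by simp [Finset.card_compl, hV, hCcard]; omega)
    (by
      intro u hu
      obtain ⟨o, ho, rfl⟩ := Finset.mem_image.1 hu
      obtain ⟨c, rfl, hc⟩ := (Finset.mem_filter.1 ho).2
      have hl := leaf_spec c hc
      rw [Finset.mem_compl]
      intro hmem
      rcases Finset.mem_union.1 hmem with h | h
      · have := hdeg _ h
        have := hl.2.1
        omega
      · obtain ⟨u', hu'⟩ := hsupp _ h
        exact hl.not_isPendantAt hu')
    (by
      intro o ho o' ho' heq
      obtain ⟨c, rfl, hc⟩ := (Finset.mem_filter.1 ho).2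
      obtain ⟨c', rfl, hc'⟩ := (Finset.mem_filter.1 ho').2
      have h := leaf_spec c hc
      have h' := leaf_spec c' hc'
      rw [← heq] at h'
      rw [Subtype.ext (h.left_unique h')])
  have hgQ : ∀ c : C, (c : V) ∈ Q → G.Adj c (g (some c)) ∧ G.degree (g (some c) : V) = 1 := by
    intro c hc
    rw [hg (some c) (by simpa using hc)]
    exact ⟨(leaf_spec c hc).1, (leaf_spec c hc).2.1⟩
  have hmatch : ∀ c : C,
      G.degree (c : V) = 0 ∨ (G.Adj c (g (some c)) ∧ G.degree (g (some c) : V) = 1) := by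
    intro c
    rcases Finset.mem_union.1 c.2 with h | h
    · exact Or.inl (hdeg _ h)
    · exact Or.inr (hgQ c h)
  by_cases hI : I.Nonempty
  · obtain ⟨u, hu⟩ : U.Nonempty := by
      rw [← Finset.card_pos] at hI ⊢
      omega
    exact ⟨C, g, ⟨u, Finset.mem_union_left _ hu⟩, hCcard, hmatch, Or.inl (hdeg u hu)⟩
  · have hI0 : ∀ v, G.degree v ≠ 0 := fun v hv => hI ⟨v, by simpa [hIdef] using hv⟩
    obtain ⟨c, hc⟩ := (G.degree_pos_iff_exists_adj (g none : V)).1 (Nat.pos_of_ne_zero (hI0 _))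
    have hcC : c ∈ C := by
      by_contra hcC
      obtain ⟨o, ho⟩ := g.surjective ⟨c, Finset.mem_compl.2 hcC⟩
      have hoc : (g o : V) = c := by rw [ho]
      cases o with
      | none => exact hc.ne hoc
      | some d =>
        obtain h | ⟨hd, hd1⟩ := hmatch d
        · exact hI0 _ h
        · rw [hoc] at hd hd1
          have h := eq_of_adj_of_degree_eq_one hd1 hd.symm hc.symm
          exact Finset.mem_compl.1 (g none).2 (h ▸ d.2)
    exact ⟨C, g, ⟨c, hcC⟩, hCcard, hmatch, Or.inr ⟨hI0, hc.symm⟩⟩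

/-- The enumeration of the vertices listing each partner and its centre consecutively, with the
distinguished centre and the remaining vertex at the end. -/
theorem exists_enumeration (p : ℕ) (hp : 1 ≤ p) (hV : Fintype.card V = 2 * p + 1)
    (hE : G.edgeFinset.card = p + 1) :
    ∃ e : Fin (2 * p + 1) ≃ V,
      (∀ i j : Fin (2 * p + 1), (i : ℕ) % 2 = 1 → (j : ℕ) + 1 = i →
        G.degree (e i) = 0 ∨ (G.Adj (e i) (e j) ∧ G.degree (e j) = 1)) ∧
      (∀ i j : Fin (2 * p + 1), (i : ℕ) + 1 = 2 * p → (j : ℕ) = 2 * p →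
        G.degree (e i) = 0 ∨ ((∀ v, G.degree v ≠ 0) ∧ G.Adj (e i) (e j))) := by
  obtain ⟨C, g, c₀, hC, hmatch, hc₀⟩ := exists_centers p hp hV hE
  obtain ⟨φ, hφ⟩ : ∃ φ : Fin p ≃ C, φ ⟨p - 1, by omega⟩ = c₀ := by
    let φ := (C.equivFinOfCardEq hC).symm
    exact ⟨(Equiv.swap ⟨p - 1, by omega⟩ (φ.symm c₀)).trans φ, by simp⟩
  let f : Fin (2 * p + 1) → V := fun i =>
    if hi : (i : ℕ) % 2 = 1 then φ ⟨i / 2, by omega⟩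
    else if hi' : (i : ℕ) / 2 < p then g (some (φ ⟨i / 2, hi'⟩)) else g none
  have hodd : ∀ (i : Fin (2 * p + 1)) (hi : (i : ℕ) % 2 = 1), f i = φ ⟨i / 2, by omega⟩ :=
    fun i hi => dif_pos hi
  have heven : ∀ (i : Fin (2 * p + 1)) (_ : (i : ℕ) % 2 ≠ 1) (hi : (i : ℕ) / 2 < p),
      f i = g (some (φ ⟨i / 2, hi⟩)) := fun i h hi => by simp only [f, dif_neg h, dif_pos hi]
  have hlast : ∀ i : Fin (2 * p + 1), (i : ℕ) % 2 ≠ 1 → ¬ (i : ℕ) / 2 < p →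
      f i = g none := fun i h hi => by simp only [f, dif_neg h, dif_neg hi]
  have hmem : ∀ i : Fin (2 * p + 1), f i ∈ C ↔ (i : ℕ) % 2 = 1 := by
    intro i
    by_cases hi : (i : ℕ) % 2 = 1
    · simp [hodd i hi, hi]
    · by_cases hi' : (i : ℕ) / 2 < p
      · rw [heven i hi hi']
        exact iff_of_false (Finset.mem_compl.1 (g _).2) hi
      · rw [hlast i hi hi']
        exact iff_of_false (Finset.mem_compl.1 (g _).2) hi
  have hinj : Function.Injective f := by
    intro i j hij
    have hpar : (i : ℕ) % 2 = 1 ↔ (j : ℕ) % 2 = 1 := by rw [← hmem i, ← hmem j, hij]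
    have hhalf : (i : ℕ) / 2 = (j : ℕ) / 2 := by
      by_cases hi : (i : ℕ) % 2 = 1
      · rw [hodd i hi, hodd j (hpar.1 hi)] at hij
        simpa using φ.injective (Subtype.ext hij)
      · have hj : ¬ (j : ℕ) % 2 = 1 := fun h => hi (hpar.2 h)
        by_cases hi' : (i : ℕ) / 2 < p <;> by_cases hj' : (j : ℕ) / 2 < p
        · rw [heven i hi hi', heven j hj hj'] at hij
          simpa using g.injective (Subtype.ext hij)
        · rw [heven i hi hi', hlast j hj hj'] at hij
          simpa using g.injective (Subtype.ext hij)
        · rw [hlast i hi hi', heven j hj hj'] at hij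
          simpa using g.injective (Subtype.ext hij)
        · omega
    apply Fin.ext
    omega
  refine ⟨Equiv.ofBijective f
    ((Fintype.bijective_iff_injective_and_card f).2 ⟨hinj, by simp [hV]⟩), ?_, ?_⟩
  · intro i j hi hij
    have hji : (j : ℕ) / 2 = (i : ℕ) / 2 := by omega
    have hfj : f j = g (some (φ ⟨i / 2, by omega⟩)) := by
      rw [heven j (by omega) (by omega)]
      simp only [hji]
    change G.degree (f i) = 0 ∨ (G.Adj (f i) (f j) ∧ G.degree (f j) = 1)
    rw [hfj, hodd i hi]
    exact hmatch _
  · intro i j hi hj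
    change G.degree (f i) = 0 ∨ ((∀ v, G.degree v ≠ 0) ∧ G.Adj (f i) (f j))
    rw [hodd i (by omega), hlast j (by omega) (by omega)]
    have hip : (⟨(i : ℕ) / 2, by omega⟩ : Fin p) = ⟨p - 1, by omega⟩ := Fin.ext (by simp; omega)
    rw [hip, hφ]
    exact hc₀

end Pendant

theorem sparseOddOpt_adj (p : ℕ) (hp : 1 ≤ p) (i j : Fin (2 * p + 1)) :
    (sparseOddOpt (2 * p + 1)).Adj i j ↔ (i : ℕ) ≠ j ∧ ((i : ℕ) / 2 = j / 2 ∨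
      ((i : ℕ) + 1 = 2 * p ∧ (j : ℕ) = 2 * p) ∨ ((j : ℕ) + 1 = 2 * p ∧ (i : ℕ) = 2 * p)) := by
  rw [sparseOddOpt, SimpleGraph.fromRel_adj, ne_eq, Fin.ext_iff]
  omega

theorem card_edgeFinset_sparseOddOpt (p : ℕ) (hp : 1 ≤ p) :
    (sparseOddOpt (2 * p + 1)).edgeFinset.card = p + 1 := by
  let edge : Fin (p + 1) → Sym2 (Fin (2 * p + 1)) := fun k =>
    if hk : (k : ℕ) < p then s(⟨2 * k, by omega⟩, ⟨2 * k + 1, by omega⟩)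
    else s(⟨2 * p - 1, by omega⟩, ⟨2 * p, by omega⟩)
  have hinj : Function.Injective edge := by
    intro k l hkl
    apply Fin.ext
    simp only [edge] at hkl
    split_ifs at hkl <;> simp at hkl <;> omega
  have himage : (sparseOddOpt (2 * p + 1)).edgeFinset = Finset.univ.image edge := by
    ext s
    induction s using Sym2.ind with
    | _ i j =>
      rw [SimpleGraph.mem_edgeFinset, SimpleGraph.mem_edgeSet, sparseOddOpt_adj p hp]
      simp only [Finset.mem_image, Finset.mem_univ, true_and]
      constructor
      · rintro ⟨hne, h⟩
        by_cases hh : (i : ℕ) / 2 = j / 2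
        · refine ⟨⟨i / 2, by omega⟩, ?_⟩
          simp only [edge]
          rw [dif_pos (by omega)]
          simp only [Sym2.eq_iff, Fin.ext_iff]
          omega
        · refine ⟨⟨p, by omega⟩, ?_⟩
          simp only [edge]
          rw [dif_neg (by omega)]
          simp only [Sym2.eq_iff, Fin.ext_iff]
          omega
      · rintro ⟨k, hk⟩
        simp only [edge] at hk
        split_ifs at hk <;> simp only [Sym2.eq_iff, Fin.ext_iff] at hk <;> omega
  rw [himage, Finset.card_image_of_injective _ hinj, Finset.card_univ, Fintype.card_fin]

theorem nonempty_iso_sparseOddOpt (p : ℕ) (hp : 1 ≤ p) (G : SimpleGraph (Fin (2 * p + 1)))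
    (hE : G.edgeFinset.card = p + 1) (hI : ∀ v, G.degree v ≠ 0) :
    Nonempty (G ≃g sparseOddOpt (2 * p + 1)) := by
  obtain ⟨e, hpair, hend⟩ := exists_enumeration p hp (by simp) hE
  have hpair' : ∀ i j : Fin (2 * p + 1), (i : ℕ) % 2 = 1 → (j : ℕ) + 1 = i → G.Adj (e i) (e j) :=
    fun i j hi hij => ((hpair i j hi hij).resolve_left (hI _)).1
  have hend' : ∀ i j : Fin (2 * p + 1), (i : ℕ) + 1 = 2 * p → (j : ℕ) = 2 * p →
      G.Adj (e i) (e j) := fun i j hi hj => ((hend i j hi hj).resolve_left (hI _)).2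
  have hle : sparseOddOpt (2 * p + 1) ≤ G.comap e := by
    intro i j hij
    rw [sparseOddOpt_adj p hp] at hij
    obtain ⟨hne, h | ⟨h, h'⟩ | ⟨h, h'⟩⟩ := hij
    · rcases lt_or_gt_of_ne hne with hlt | hlt
      · exact (hpair' j i (by omega) (by omega)).symm
      · exact hpair' i j (by omega) (by omega)
    · exact hend' i j h h'
    · exact (hend' j i h h').symm
  have hcard : (G.comap e).edgeFinset.card = p + 1 :=
    (SimpleGraph.Iso.card_edgeFinset_eq (SimpleGraph.Iso.comap e G)).trans hE
  have heq : sparseOddOpt (2 * p + 1) = G.comap e := by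
    rw [← SimpleGraph.edgeFinset_inj]
    apply Finset.eq_of_subset_of_card_le (SimpleGraph.edgeFinset_mono hle)
    rw [hcard, card_edgeFinset_sparseOddOpt p hp]
  rw [heq]
  exact ⟨(SimpleGraph.Iso.comap e G).symm⟩

theorem IsDomSet.mem_of_degree_eq_zero {V : Type*} [Fintype V] {G : SimpleGraph V} {S : Finset V}
    (hS : IsDomSet G S) {v : V} (hv : G.degree v = 0) : v ∈ S := by
  obtain h | ⟨u, -, hu⟩ := hS v
  · exact h
  · exact absurd hv ((G.degree_pos_iff_exists_adj v).2 ⟨u, hu.symm⟩).ne'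

theorem exists_isDomSet_map_sparseOddOpt (p : ℕ) (hp : 1 ≤ p) (G : SimpleGraph (Fin (2 * p + 1)))
    (hE : G.edgeFinset.card = p + 1) (hI : ∃ v, G.degree v = 0) :
    ∃ e : Fin (2 * p + 1) ≃ Fin (2 * p + 1), ∀ S : Finset (Fin (2 * p + 1)),
      IsDomSet G S → IsDomSet (sparseOddOpt (2 * p + 1)) (S.map e.toEmbedding) := by
  obtain ⟨e, hpair, hend⟩ := exists_enumeration p hp (by simp) hE
  refine ⟨e.symm, fun S hS => ?_⟩
  have hcover : ∀ i j : Fin (2 * p + 1), (i : ℕ) % 2 = 1 → (j : ℕ) + 1 = i →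
      e i ∈ S ∨ e j ∈ S := by
    intro i j hi hij
    obtain h | ⟨h, h1⟩ := hpair i j hi hij
    · exact Or.inl (hS.mem_of_degree_eq_zero h)
    · obtain hj | ⟨u, hu, huj⟩ := hS (e j)
      · exact Or.inr hj
      · rw [← eq_of_adj_of_degree_eq_one h1 huj.symm h.symm]
        exact Or.inl hu
  have hcenter : ∀ i : Fin (2 * p + 1), (i : ℕ) + 1 = 2 * p → e i ∈ S := by
    intro i hi
    obtain h | ⟨h, -⟩ := hend i ⟨2 * p, by omega⟩ hi rfl
    · exact hS.mem_of_degree_eq_zero h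
    · obtain ⟨v, hv⟩ := hI
      exact absurd hv (h v)
  have hmem : ∀ i, i ∈ S.map e.symm.toEmbedding ↔ e i ∈ S := by simp [Finset.mem_map_equiv]
  intro v
  simp only [hmem, sparseOddOpt_adj p hp]
  by_cases hodd : (v : ℕ) % 2 = 1
  · refine (hcover v ⟨v - 1, by omega⟩ hodd (by simp; omega)).imp_right fun h =>
      ⟨_, h, ?_⟩
    simp only
    omega
  · by_cases hlast : (v : ℕ) = 2 * p
    · refine Or.inr ⟨⟨2 * p - 1, by omega⟩, hcenter _ (by simp; omega), ?_⟩
      simp only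
      omega
    · refine (hcover ⟨v + 1, by omega⟩ v (by simp; omega) rfl).symm.imp_right fun h =>
        ⟨_, h, ?_⟩
      simp only
      omega

theorem IsDomSet.map_iso {V W : Type*} {G : SimpleGraph V} {H : SimpleGraph W} (f : G ≃g H)
    {S : Finset V} (hS : IsDomSet G S) : IsDomSet H (S.map f.toEquiv.toEmbedding) := by
  intro w
  obtain ⟨v, rfl⟩ := f.surjective w
  refine (hS v).imp (fun h => ?_) fun ⟨u, hu, huv⟩ => ⟨f u, ?_, f.map_adj_iff.2 huv⟩
  · exact Finset.mem_map_of_mem f.toEquiv.toEmbedding h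
  · exact Finset.mem_map_of_mem f.toEquiv.toEmbedding hu

section DomPoly

variable {V W : Type*} [Fintype V] [Fintype W] {G : SimpleGraph V} {H : SimpleGraph W}

theorem domCount_le_of_map (e : V ≃ W)
    (he : ∀ S : Finset V, IsDomSet G S → IsDomSet H (S.map e.toEmbedding)) (i : ℕ) :
    domCount G i ≤ domCount H i := by
  apply Finset.card_le_card_of_injOn (fun S => S.map e.toEmbedding)
  · intro S hS
    have hS' := (Finset.mem_filter.1 hS).2
    simpa using ⟨he S hS'.1, hS'.2⟩
  · exact (Finset.map_injective _).injOn

theorem domCount_lt_of_map (e : V ≃ W)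
    (he : ∀ S : Finset V, IsDomSet G S → IsDomSet H (S.map e.toEmbedding))
    {T : Finset V} (hT : IsDomSet H (T.map e.toEmbedding)) (hT' : ¬ IsDomSet G T) :
    domCount G T.card < domCount H T.card := by
  rw [domCount, ← Finset.card_map (Finset.mapEmbedding e.toEmbedding).toEmbedding]
  apply Finset.card_lt_card
  rw [Finset.ssubset_iff_of_subset]
  · refine ⟨T.map e.toEmbedding, by simpa using hT, fun h => ?_⟩
    obtain ⟨S, hS, hST⟩ := Finset.mem_map.1 h
    obtain rfl : S = T := Finset.map_injective e.toEmbedding hST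
    exact hT' (Finset.mem_filter.1 hS).2.1
  · intro R hR
    obtain ⟨S, hS, rfl⟩ := Finset.mem_map.1 hR
    have hS' := (Finset.mem_filter.1 hS).2
    simpa using ⟨he S hS'.1, hS'.2⟩

theorem domPoly_le_of_map (e : V ≃ W)
    (he : ∀ S : Finset V, IsDomSet G S → IsDomSet H (S.map e.toEmbedding)) {x : ℝ} (hx : 0 ≤ x) :
    domPoly G x ≤ domPoly H x := by
  rw [domPoly, domPoly, Fintype.card_congr e]
  refine Finset.sum_le_sum fun i _ => ?_
  have := domCount_le_of_map e he i
  gcongr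

theorem domPoly_one_lt_of_map (e : V ≃ W)
    (he : ∀ S : Finset V, IsDomSet G S → IsDomSet H (S.map e.toEmbedding))
    {T : Finset V} (hne : T.Nonempty) (hT : IsDomSet H (T.map e.toEmbedding))
    (hT' : ¬ IsDomSet G T) : domPoly G 1 < domPoly H 1 := by
  rw [domPoly, domPoly, Fintype.card_congr e]
  simp only [one_pow, mul_one]
  refine Finset.sum_lt_sum (fun i _ => by exact_mod_cast domCount_le_of_map e he i)
    ⟨T.card, Finset.mem_Icc.2 ⟨hne.card_pos, ?_⟩,
      by exact_mod_cast domCount_lt_of_map e he hT hT'⟩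
  rw [← Fintype.card_congr e]
  exact T.card_le_univ

end DomPoly

theorem isDomSet_sparseOddOpt_compl_singleton (p : ℕ) (hp : 1 ≤ p) (u : Fin (2 * p + 1)) :
    IsDomSet (sparseOddOpt (2 * p + 1)) {u}ᶜ := by
  intro v
  simp only [Finset.mem_compl, Finset.mem_singleton, Fin.ext_iff, sparseOddOpt_adj p hp]
  by_cases hvu : (v : ℕ) = u
  · right
    by_cases hodd : (v : ℕ) % 2 = 1
    · refine ⟨⟨v - 1, by omega⟩, ?_⟩
      simp only
      omega
    · by_cases hlast : (v : ℕ) = 2 * p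
      · refine ⟨⟨2 * p - 1, by omega⟩, ?_⟩
        simp only
        omega
      · refine ⟨⟨v + 1, by omega⟩, ?_⟩
        simp only
        omega
  · exact Or.inl hvu

theorem domPoly_one_lt_sparseOddOpt (p : ℕ) (hp : 1 ≤ p) (G : SimpleGraph (Fin (2 * p + 1)))
    (hE : G.edgeFinset.card = p + 1) (hI : ∃ v, G.degree v = 0) :
    domPoly G 1 < domPoly (sparseOddOpt (2 * p + 1)) 1 := by
  obtain ⟨e, he⟩ := exists_isDomSet_map_sparseOddOpt p hp G hE hI
  obtain ⟨u, hu⟩ := hI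
  refine domPoly_one_lt_of_map e he (T := {u}ᶜ) ?_ ?_ fun h => ?_
  · rw [← Finset.card_pos, Finset.card_compl]
    simp
    omega
  · convert isDomSet_sparseOddOpt_compl_singleton p hp (e u) using 1
    ext v
    simp [Finset.mem_map_equiv, Equiv.symm_apply_eq]
  · simpa using h.mem_of_degree_eq_zero hu

theorem stmt_4 (n m : ℕ) (hn : 3 ≤ n) (hodd : Odd n) (hm : m = (n + 1) / 2) :
    (sparseOddOpt n).edgeFinset.card = m ∧
    (∀ G : SimpleGraph (Fin n), G.edgeFinset.card = m →
      ∀ x : ℝ, 0 ≤ x → domPoly G x ≤ domPoly (sparseOddOpt n) x) ∧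
    (∀ H : SimpleGraph (Fin n), H.edgeFinset.card = m →
      (∀ G : SimpleGraph (Fin n), G.edgeFinset.card = m →
        ∀ x : ℝ, 0 ≤ x → domPoly G x ≤ domPoly H x) →
      Nonempty (H ≃g sparseOddOpt n)) := by
  obtain ⟨p, rfl⟩ := hodd
  have hp : 1 ≤ p := by omega
  obtain rfl : m = p + 1 := by omega
  have hcard := card_edgeFinset_sparseOddOpt p hp
  refine ⟨hcard, fun G hG x hx => ?_, fun H hH hopt => ?_⟩
  · by_cases hI : ∃ v, G.degree v = 0
    · obtain ⟨e, he⟩ := exists_isDomSet_map_sparseOddOpt p hp G hG hI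
      exact domPoly_le_of_map e he hx
    · obtain ⟨f⟩ := nonempty_iso_sparseOddOpt p hp G hG (by simpa using hI)
      exact domPoly_le_of_map f.toEquiv (fun S hS => hS.map_iso f) hx
  · apply nonempty_iso_sparseOddOpt p hp H hH
    intro v hv
    exact (domPoly_one_lt_sparseOddOpt p hp H hH ⟨v, hv⟩).not_ge (hopt _ hcard 1 zero_le_one)
end

section
/- Fix m ≥ 1 and let n = 2m + r with r ≥ 0. Then the graph mK₂ ∪ rK₁ (the disjoint union of m copies of K₂ and r isolated vertices) is optimal among all graphs on n vertices and m edges, and every optimal graph on n vertices and m edges is isomorphic to mK₂ ∪ rK₁. -/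
open scoped Classical

/-- The darts of a graph with `m` edges, enumerated so that reversal flips the Boolean. -/
theorem exists_dart_equiv {n m : ℕ} (G : SimpleGraph (Fin n)) (hG : G.edgeFinset.card = m) :
    ∃ e : Fin m × Bool ≃ G.Dart, ∀ k b, e (k, !b) = (e (k, b)).symm := by
  have hcard : Fintype.card G.edgeSet = m := by
    rw [← hG, SimpleGraph.edgeFinset_card]
  let φ : Fin m ≃ G.edgeSet := (Fintype.equivFinOfCardEq hcard).symm
  have hex : ∀ s : G.edgeSet, ∃ d : G.Dart, d.edge = s := by
    rintro ⟨s, hs⟩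
    induction s using Sym2.ind with
    | _ a b => exact ⟨⟨(a, b), hs⟩, rfl⟩
  choose g hg using hex
  let F : Fin m × Bool → G.Dart := fun p => if p.2 then (g (φ p.1)).symm else g (φ p.1)
  have hF : ∀ p, (F p).edge = φ p.1 := by
    rintro ⟨k, _ | _⟩
    · exact hg _
    · exact (SimpleGraph.Dart.edge_symm _).trans (hg _)
  have hflip : ∀ k b, F (k, !b) = (F (k, b)).symm := by
    rintro k (_ | _)
    · rfl
    · exact (SimpleGraph.Dart.symm_symm _).symm
  refine ⟨Equiv.ofBijective F ⟨?_, fun d => ?_⟩, hflip⟩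
  · rintro ⟨k, b⟩ ⟨l, c⟩ h
    have hkl : k = l := by
      apply φ.injective
      apply Subtype.ext
      rw [← hF (k, b), ← hF (l, c), h]
    subst hkl
    by_contra hne
    have hc : c = !b := (Bool.eq_or_eq_not c b).resolve_left fun hcb => hne (hcb ▸ rfl)
    rw [hc, hflip] at h
    exact (SimpleGraph.Dart.symm_ne _) h.symm
  · have hd : d.edge = (F (φ.symm ⟨d.edge, d.edge_mem⟩, false)).edge := by simp [hF]
    rcases (SimpleGraph.dart_edge_eq_iff _ _).1 hd with h | h
    · exact ⟨_, h.symm⟩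
    · exact ⟨(_, true), by rw [h, ← hflip]; rfl⟩

/-- The vertices of `mK2rK1 n m` that are not isolated. -/
def matchedVertex {n m : ℕ} (h : 2 * m ≤ n) : Fin m × Bool ↪ Fin n where
  toFun p := ⟨2 * p.1 + p.2.toNat, by have := p.1.2; have := p.2.toNat_le; omega⟩
  inj' := by
    rintro ⟨k, b⟩ ⟨l, c⟩ h
    simp only [Fin.mk.injEq] at h
    cases b <;> cases c <;> simp only [Bool.toNat_true, Bool.toNat_false] at h <;>
      simp [Fin.ext_iff] <;> omega

theorem val_matchedVertex {n m : ℕ} (h : 2 * m ≤ n) (k : Fin m) (b : Bool) :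
    (matchedVertex h (k, b) : ℕ) = 2 * k + b.toNat := rfl

theorem mK2rK1_adj_iff {n m : ℕ} (h : 2 * m ≤ n) (i j : Fin n) :
    (mK2rK1 n m).Adj i j ↔
      ∃ k b, i = matchedVertex h (k, b) ∧ j = matchedVertex h (k, !b) := by
  simp only [mK2rK1, SimpleGraph.fromRel_adj, val_matchedVertex, Fin.ext_iff, ne_eq]
  constructor
  · intro hij
    refine ⟨⟨i / 2, by omega⟩, decide ((i : ℕ) % 2 = 1), ?_⟩
    rcases Nat.mod_two_eq_zero_or_one i with hi | hi <;> simp [hi] <;> omega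
  · rintro ⟨k, b, hi, hj⟩
    have := k.2
    cases b <;> simp at hi hj <;> omega

theorem mK2rK1_card_edgeFinset {n m : ℕ} (h : 2 * m ≤ n) :
    (mK2rK1 n m).edgeFinset.card = m := by
  let F : Fin m × Bool → (mK2rK1 n m).Dart := fun p =>
    ⟨(matchedVertex h p, matchedVertex h (p.1, !p.2)),
      (mK2rK1_adj_iff h _ _).2 ⟨p.1, p.2, rfl, rfl⟩⟩
  have hF : Function.Bijective F := by
    constructor
    · intro p q hpq
      exact (matchedVertex h).injective (congrArg (fun d => d.fst) hpq)
    · rintro ⟨⟨i, j⟩, hij⟩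
      obtain ⟨k, b, rfl, rfl⟩ := (mK2rK1_adj_iff h i j).1 hij
      exact ⟨(k, b), rfl⟩
  have h1 := Fintype.card_of_bijective hF
  have h2 := (mK2rK1 n m).dart_card_eq_twice_card_edges
  simp only [Fintype.card_prod, Fintype.card_fin, Fintype.card_bool] at h1
  have h3 : 2 * (mK2rK1 n m).edgeFinset.card = m * 2 := by
    rw [h1, ← h2]
  omega

theorem isDomSet_compl_matched {n m : ℕ} (h : 2 * m ≤ n) (D : Finset (Fin m × Bool))
    (hD : ∀ k b, (k, b) ∈ D → (k, !b) ∉ D) :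
    IsDomSet (mK2rK1 n m) (D.map (matchedVertex h))ᶜ := by
  intro v
  by_cases hv : v ∈ D.map (matchedVertex h)
  · obtain ⟨⟨k, b⟩, hkb, rfl⟩ := Finset.mem_map.1 hv
    refine Or.inr ⟨matchedVertex h (k, !b), ?_, ?_⟩
    · rw [Finset.mem_compl, Finset.mem_map']
      exact hD k b hkb
    · exact ((mK2rK1_adj_iff h _ _).2 ⟨k, b, rfl, rfl⟩).symm
  · exact Or.inl (Finset.mem_compl.2 hv)

/-- Each vertex outside a dominating set chooses a dart into it, and no dart is chosen together
with its reversal. -/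
theorem IsDomSet.exists_darts {n m : ℕ} {G : SimpleGraph (Fin n)} (e : Fin m × Bool ≃ G.Dart)
    (he : ∀ k b, e (k, !b) = (e (k, b)).symm) {S : Finset (Fin n)} (hS : IsDomSet G S) :
    ∃ D : Finset (Fin m × Bool), (∀ k b, (k, b) ∈ D → (k, !b) ∉ D) ∧ D.card = Sᶜ.card ∧
      D.image (fun p => (e p).fst) = Sᶜ := by
  have hex : ∀ v : {v // v ∈ Sᶜ}, ∃ p, (e p).fst = v ∧ (e p).snd ∈ S := by
    rintro ⟨v, hv⟩
    obtain ⟨u, hu, huv⟩ := (hS v).resolve_left (Finset.mem_compl.1 hv)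
    exact ⟨e.symm ⟨(v, u), huv.symm⟩, by simp, by simpa using hu⟩
  choose f hf hfS using hex
  have hinj : Function.Injective f := fun v w hvw => Subtype.ext <| by rw [← hf, ← hf, hvw]
  refine ⟨Sᶜ.attach.image f, fun k b hkb hkb' => ?_, ?_, ?_⟩
  · obtain ⟨v, -, hv⟩ := Finset.mem_image.1 hkb
    obtain ⟨w, -, hw⟩ := Finset.mem_image.1 hkb'
    have h1 := hf w
    have h2 := hfS v
    rw [hw, he] at h1
    rw [hv, show (e (k, b)).snd = w from h1] at h2
    exact Finset.mem_compl.1 w.2 h2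
  · rw [Finset.card_image_of_injective _ hinj, Finset.card_attach]
  · rw [Finset.image_image]
    ext v
    simp [hf]

theorem domCount_le_domCount_mK2rK1 {n m : ℕ} (h : 2 * m ≤ n) (G : SimpleGraph (Fin n))
    (hG : G.edgeFinset.card = m) (i : ℕ) : domCount G i ≤ domCount (mK2rK1 n m) i := by
  obtain ⟨e, he⟩ := exists_dart_equiv G hG
  choose! D hD hcard himage using
    fun (S : Finset (Fin n)) (hS : IsDomSet G S) => hS.exists_darts e he
  refine Finset.card_le_card_of_injOn (fun S => ((D S).map (matchedVertex h))ᶜ) ?_ ?_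
  · intro S hS
    simp only [Finset.coe_filter, Finset.mem_univ, true_and, Set.mem_ofPred_eq] at hS ⊢
    refine ⟨isDomSet_compl_matched h _ (hD S hS.1), ?_⟩
    have h1 := S.card_le_univ
    rw [Finset.card_compl, Finset.card_map, hcard S hS.1, Finset.card_compl]
    omega
  · intro S hS T hT hST
    simp only [Finset.coe_filter, Finset.mem_univ, true_and, Set.mem_ofPred_eq] at hS hT hST
    have hDD : D S = D T := Finset.map_injective _ (compl_injective hST)
    rw [← compl_inj_iff, ← himage S hS.1, ← himage T hT.1, hDD]

theorem domPoly_le_domPoly_mK2rK1 {n m : ℕ} (h : 2 * m ≤ n) (G : SimpleGraph (Fin n))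
    (hG : G.edgeFinset.card = m) {x : ℝ} (hx : 0 ≤ x) :
    domPoly G x ≤ domPoly (mK2rK1 n m) x := by
  refine Finset.sum_le_sum fun i _ => ?_
  gcongr
  exact domCount_le_domCount_mK2rK1 h G hG i

theorem two_mul_le_domCount_mK2rK1 {n m : ℕ} (h : 2 * m ≤ n) :
    2 * m ≤ domCount (mK2rK1 n m) (n - 1) := by
  have hinj : Function.Injective fun p : Fin m × Bool =>
      ((({p} : Finset (Fin m × Bool)).map (matchedVertex h))ᶜ : Finset (Fin n)) :=
    fun p q hpq => Finset.singleton_injective (Finset.map_injective _ (compl_injective hpq))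
  have hle := Finset.card_le_card_of_injOn (s := (Finset.univ : Finset (Fin m × Bool)))
    (t := Finset.univ.filter fun S => IsDomSet (mK2rK1 n m) S ∧ S.card = n - 1)
    _ (fun p _ => ?_) hinj.injOn
  · simpa [domCount, mul_comm] using hle
  · simp only [Finset.coe_filter, Finset.mem_univ, true_and, Set.mem_ofPred_eq]
    refine ⟨isDomSet_compl_matched h _ fun k b hb hb' => ?_, ?_⟩
    · rw [Finset.mem_singleton] at hb hb'
      simpa using hb'.trans hb.symm
    · simp [Finset.card_compl]

theorem domCount_pred_le_card_image_fst {n : ℕ} (hn : n ≠ 0) (G : SimpleGraph (Fin n)) :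
    domCount G (n - 1) ≤ (Finset.univ.image fun d : G.Dart => d.fst).card := by
  have hsub : (Finset.univ.filter fun S => IsDomSet G S ∧ S.card = n - 1) ⊆
      (Finset.univ.image fun d : G.Dart => d.fst).image fun v => ({v} : Finset (Fin n))ᶜ := by
    intro S hS
    obtain ⟨hdom, hcard⟩ := (Finset.mem_filter.1 hS).2
    have hc : Sᶜ.card = 1 := by
      rw [Finset.card_compl, hcard, Fintype.card_fin]
      omega
    obtain ⟨v, hv⟩ := Finset.card_eq_one.1 hc
    have hvS : v ∉ S := Finset.mem_compl.1 (hv ▸ Finset.mem_singleton_self v)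
    obtain ⟨u, -, huv⟩ := (hdom v).resolve_left hvS
    refine Finset.mem_image.2 ⟨v, Finset.mem_image.2 ⟨⟨(v, u), huv.symm⟩, by simp, rfl⟩, ?_⟩
    rw [← hv, compl_compl]
  exact (Finset.card_le_card hsub).trans Finset.card_image_le

/-- A graph with `m` edges, no two of which share a vertex, is `mK₂ ∪ rK₁`. -/
theorem nonempty_iso_mK2rK1 {n m : ℕ} (h : 2 * m ≤ n) (H : SimpleGraph (Fin n))
    (hH : H.edgeFinset.card = m) (hinj : Function.Injective fun d : H.Dart => d.fst) :
    Nonempty (H ≃g mK2rK1 n m) := by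
  obtain ⟨e, he⟩ := exists_dart_equiv H hH
  let f : Fin m × Bool → Fin n := fun p => (e p).fst
  have hf : Function.Injective f := hinj.comp e.injective
  let σ : Equiv.Perm (Fin n) := Equiv.extendSubtype
    ((Equiv.ofInjective _ (matchedVertex h).injective).symm.trans (Equiv.ofInjective f hf))
  have hσ : ∀ p, σ (matchedVertex h p) = f p := by
    intro p
    rw [Equiv.extendSubtype_apply_of_mem _ _ ⟨p, rfl⟩]
    simp
  have hle : (mK2rK1 n m).map σ.toEmbedding ≤ H := by
    intro i j hij
    obtain ⟨i, j, hadj, rfl, rfl⟩ := (SimpleGraph.map_adj _ _ _ _).1 hij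
    obtain ⟨k, b, rfl, rfl⟩ := (mK2rK1_adj_iff h i j).1 hadj
    simp only [Equiv.coe_toEmbedding, hσ, f, he]
    exact (e (k, b)).adj
  have hcard : ((mK2rK1 n m).map σ.toEmbedding).edgeFinset.card = H.edgeFinset.card := by
    rw [hH]
    exact (SimpleGraph.Iso.map σ _).symm.card_edgeFinset_eq.trans (mK2rK1_card_edgeFinset h)
  have heq : (mK2rK1 n m).map σ.toEmbedding = H :=
    SimpleGraph.edgeFinset_inj.1 <|
      Finset.eq_of_subset_of_card_le (SimpleGraph.edgeFinset_mono hle) hcard.ge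
  exact ⟨heq ▸ (SimpleGraph.Iso.map σ _).symm⟩

theorem stmt_5 (m r n : ℕ) (hm : 1 ≤ m) (hn : n = 2 * m + r) :
    (mK2rK1 n m).edgeFinset.card = m ∧
    (∀ G : SimpleGraph (Fin n), G.edgeFinset.card = m →
      ∀ x : ℝ, 0 ≤ x → domPoly G x ≤ domPoly (mK2rK1 n m) x) ∧
    (∀ H : SimpleGraph (Fin n), H.edgeFinset.card = m →
      (∀ G : SimpleGraph (Fin n), G.edgeFinset.card = m →
        ∀ x : ℝ, 0 ≤ x → domPoly G x ≤ domPoly H x) →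
      Nonempty (H ≃g mK2rK1 n m)) := by
  have h : 2 * m ≤ n := by omega
  refine ⟨mK2rK1_card_edgeFinset h, fun G hG x hx => domPoly_le_domPoly_mK2rK1 h G hG hx,
    fun H hH hopt => nonempty_iso_mK2rK1 h H hH ?_⟩
  have hsum : domPoly H 1 = domPoly (mK2rK1 n m) 1 :=
    le_antisymm (domPoly_le_domPoly_mK2rK1 h H hH zero_le_one)
      (hopt _ (mK2rK1_card_edgeFinset h) 1 zero_le_one)
  simp only [domPoly, one_pow, mul_one] at hsum
  have hcoeff := (Finset.sum_eq_sum_iff_of_le fun i _ =>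
    Nat.cast_le.2 (domCount_le_domCount_mK2rK1 h H hH i)).1 hsum (n - 1)
    (Finset.mem_Icc.2 (by rw [Fintype.card_fin]; omega))
  have h1 : 2 * m ≤ (Finset.univ.image fun d : H.Dart => d.fst).card :=
    (two_mul_le_domCount_mK2rK1 h).trans <|
      (Nat.cast_injective hcoeff).ge.trans (domCount_pred_le_card_image_fst (by omega) H)
  have h2 : Fintype.card H.Dart = 2 * m := by
    rw [← hH]
    exact H.dart_card_eq_twice_card_edges
  refine Set.injOn_univ.1 ?_
  rw [← Finset.coe_univ, ← Finset.card_image_iff]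
  refine le_antisymm Finset.card_image_le ?_
  rwa [Finset.card_univ, h2]
end

section
/- Let G be a finite simple graph on n vertices with minimum degree δ(G). Then d(G, n − δ(G) − 1) = C(n, δ(G)+1) − |{N[v] : v a vertex of G with deg(v) = δ(G)}|, where the subtracted term is the number of distinct closed neighbourhoods of vertices of minimum degree. -/
open scoped Classical

/-- The collection of distinct closed neighbourhoods `N[v]` of vertices `v`
of minimum degree. -/
noncomputable def minClosedNbhds {V : Type*} [Fintype V] (G : SimpleGraph V) :
    Finset (Finset V) :=
  (Finset.univ.filter (fun v => G.degree v = G.minDegree)).image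
    (fun v => insert v (G.neighborFinset v))

theorem mem_minClosedNbhds {V : Type*} [Fintype V] (G : SimpleGraph V) (T : Finset V) :
    T ∈ minClosedNbhds G ↔
      ∃ v, G.degree v = G.minDegree ∧ insert v (G.neighborFinset v) = T := by
  simp [minClosedNbhds]

theorem card_insert_neighborFinset {V : Type*} [Fintype V] (G : SimpleGraph V) (v : V) :
    (insert v (G.neighborFinset v)).card = G.degree v + 1 := by
  rw [Finset.card_insert_of_notMem (by simp), SimpleGraph.card_neighborFinset_eq_degree]

theorem not_isDomSet_compl_iff {V : Type*} [Fintype V] (G : SimpleGraph V) (T : Finset V) :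
    ¬ IsDomSet G Tᶜ ↔ ∃ v, insert v (G.neighborFinset v) ⊆ T := by
  simp only [IsDomSet, not_forall, not_or, not_exists, not_and, Finset.mem_compl, not_not]
  refine exists_congr fun v => ?_
  rw [Finset.insert_subset_iff, Finset.subset_iff]
  refine and_congr_right fun _ => forall_congr' fun u => ?_
  rw [SimpleGraph.mem_neighborFinset, G.adj_comm v u]
  tauto

/-- A set of `δ(G) + 1` vertices fails to have a dominating complement exactly when it is the
closed neighbourhood of a vertex of minimum degree. -/
theorem isDomSet_compl_iff_notMem_minClosedNbhds {V : Type*} [Fintype V] (G : SimpleGraph V)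
    {T : Finset V} (hT : T.card = G.minDegree + 1) :
    IsDomSet G Tᶜ ↔ T ∉ minClosedNbhds G := by
  rw [← not_iff_not, not_isDomSet_compl_iff, not_not, mem_minClosedNbhds]
  constructor
  · rintro ⟨v, hv⟩
    have hc := Finset.card_le_card hv
    rw [card_insert_neighborFinset, hT] at hc
    have hd : G.degree v = G.minDegree := by
      have := G.minDegree_le_degree v
      omega
    exact ⟨v, hd, Finset.eq_of_subset_of_card_le hv (by
      rw [card_insert_neighborFinset, hT, hd])⟩
  · rintro ⟨v, -, rfl⟩
    exact ⟨v, subset_rfl⟩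

theorem minClosedNbhds_subset {V : Type*} [Fintype V] (G : SimpleGraph V) :
    minClosedNbhds G ⊆ Finset.univ.powersetCard (G.minDegree + 1) := by
  intro T hT
  obtain ⟨v, hv, rfl⟩ := (mem_minClosedNbhds G T).1 hT
  rw [Finset.mem_powersetCard_univ, card_insert_neighborFinset, hv]

theorem stmt_7 {V : Type*} [Fintype V] [Nonempty V] (G : SimpleGraph V) :
    domCount G (Fintype.card V - G.minDegree - 1) =
      (Fintype.card V).choose (G.minDegree + 1) - (minClosedNbhds G).card := by
  have hlt : G.minDegree < Fintype.card V := G.minDegree_lt_card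
  rw [← Finset.card_univ, ← Finset.card_powersetCard, Finset.card_univ,
    ← Finset.card_sdiff_of_subset (minClosedNbhds_subset G), domCount]
  refine Finset.card_nbij' compl compl ?_ ?_ (fun _ _ => compl_compl _) (fun _ _ => compl_compl _)
  · intro S hS
    simp only [Finset.coe_filter, Finset.mem_univ, true_and, Set.mem_ofPred_eq] at hS
    have hc : Sᶜ.card = G.minDegree + 1 := by
      rw [Finset.card_compl, hS.2]
      omega
    rw [Finset.mem_coe, Finset.mem_sdiff, Finset.mem_powersetCard_univ,
      ← isDomSet_compl_iff_notMem_minClosedNbhds G hc, compl_compl]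
    exact ⟨hc, hS.1⟩
  · intro T hT
    rw [Finset.mem_coe, Finset.mem_sdiff, Finset.mem_powersetCard_univ] at hT
    simp only [Finset.coe_filter, Finset.mem_univ, true_and, Set.mem_ofPred_eq]
    refine ⟨(isDomSet_compl_iff_notMem_minClosedNbhds G hT.1).2 hT.2, ?_⟩
    rw [Finset.card_compl, hT.1]
    omega
end

section
/- Let n ≥ 4 and let m satisfy ⌈n/2⌉ < m ≤ n − 1. Then there is no optimal graph on n vertices and m edges; that is, there is no graph H on n vertices and m edges such that D(H,x) ≥ D(G,x) for all graphs G on n vertices and m edges and all x ≥ 0. -/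
open scoped Classical

open Finset

/-- If `b` is at most `a` above index `k` and strictly smaller at `k`, then the polynomial with
coefficients `b` is smaller than the one with coefficients `a` at some positive point. -/
lemma exists_sum_lt_of_top (s : Finset ℕ) (a b : ℕ → ℕ) (k : ℕ) (hk : k + 1 ∈ s)
    (hab : ∀ i ∈ s, k + 1 < i → b i ≤ a i) (hlt : b (k + 1) < a (k + 1)) :
    ∃ x : ℝ, 0 ≤ x ∧ ∑ i ∈ s, (b i : ℝ) * x ^ i < ∑ i ∈ s, (a i : ℝ) * x ^ i := by
  set B : ℝ := ∑ i ∈ s, (b i : ℝ) with hB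
  have hB0 : 0 ≤ B := by positivity
  refine ⟨1 + B, by positivity, ?_⟩
  set x := 1 + B with hx
  have hx1 : 1 ≤ x := by linarith
  have hpos : 0 < x ^ k := by positivity
  have key : ∀ i ∈ s, (b i : ℝ) * x ^ i ≤
      (a i : ℝ) * x ^ i + (b i : ℝ) * x ^ k - (if i = k + 1 then x ^ (k + 1) else 0) := by
    intro i hi
    have hxi : 0 < x ^ i := by positivity
    have hbk : 0 ≤ (b i : ℝ) * x ^ k := by positivity
    have hai : 0 ≤ (a i : ℝ) * x ^ i := by positivity
    rcases lt_trichotomy i (k + 1) with h | h | h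
    · have : x ^ i ≤ x ^ k := pow_le_pow_right₀ hx1 (by omega)
      have := mul_le_mul_of_nonneg_left this (Nat.cast_nonneg (α := ℝ) (b i))
      rw [if_neg h.ne]; linarith
    · subst h
      have : (b (k + 1) : ℝ) + 1 ≤ a (k + 1) := by exact_mod_cast hlt
      have := mul_le_mul_of_nonneg_right this hxi.le
      rw [if_pos rfl]; linarith
    · have : (b i : ℝ) ≤ a i := by exact_mod_cast hab i hi h
      have := mul_le_mul_of_nonneg_right this hxi.le
      rw [if_neg h.ne']; linarith
  have hsum := sum_le_sum key
  rw [sum_sub_distrib, sum_add_distrib, ← sum_mul, ← hB, sum_ite_eq' s (k + 1), if_pos hk] at hsum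
  have : x ^ (k + 1) = x ^ k + B * x ^ k := by rw [pow_succ]; ring
  linarith

/-- If `b` is at most `a` below index `k` and strictly smaller at `k`, then the polynomial with
coefficients `b` is smaller than the one with coefficients `a` at some positive point. -/
lemma exists_sum_lt_of_bot (s : Finset ℕ) (a b : ℕ → ℕ) (k : ℕ) (hk : k ∈ s)
    (hab : ∀ i ∈ s, i < k → b i ≤ a i) (hlt : b k < a k) :
    ∃ x : ℝ, 0 ≤ x ∧ ∑ i ∈ s, (b i : ℝ) * x ^ i < ∑ i ∈ s, (a i : ℝ) * x ^ i := by
  set B : ℝ := ∑ i ∈ s, (b i : ℝ) with hB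
  have hB0 : 0 ≤ B := by positivity
  refine ⟨(1 + B)⁻¹, by positivity, ?_⟩
  set x := (1 + B)⁻¹ with hx
  have hx0 : 0 < x := by positivity
  have hx1 : x ≤ 1 := inv_le_one_of_one_le₀ (by linarith)
  have hBx : x + B * x = 1 := by rw [hx]; field_simp
  have hpos : 0 < x ^ (k + 1) := by positivity
  have key : ∀ i ∈ s, (b i : ℝ) * x ^ i ≤
      (a i : ℝ) * x ^ i + (b i : ℝ) * x ^ (k + 1) - (if i = k then x ^ k else 0) := by
    intro i hi
    have hxi : 0 < x ^ i := by positivity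
    have hbk : 0 ≤ (b i : ℝ) * x ^ (k + 1) := by positivity
    have hai : 0 ≤ (a i : ℝ) * x ^ i := by positivity
    rcases lt_trichotomy i k with h | h | h
    · have : (b i : ℝ) ≤ a i := by exact_mod_cast hab i hi h
      have := mul_le_mul_of_nonneg_right this hxi.le
      rw [if_neg h.ne]; linarith
    · subst h
      have : (b i : ℝ) + 1 ≤ a i := by exact_mod_cast hlt
      have := mul_le_mul_of_nonneg_right this hxi.le
      rw [if_pos rfl]; linarith
    · have : x ^ i ≤ x ^ (k + 1) := pow_le_pow_of_le_one hx0.le hx1 (by omega)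
      have := mul_le_mul_of_nonneg_left this (Nat.cast_nonneg (α := ℝ) (b i))
      rw [if_neg h.ne']; linarith
  have hsum := sum_le_sum key
  rw [sum_sub_distrib, sum_add_distrib, ← sum_mul, ← hB, sum_ite_eq' s k, if_pos hk] at hsum
  have : x ^ k = x ^ (k + 1) + B * x ^ (k + 1) := by
    rw [pow_succ]; linear_combination -(x ^ k) * hBx
  linarith

section Counting

variable {V : Type*} [Fintype V]

/-- The subsets of size `i` that do not dominate `G`. -/
noncomputable def nonDomSets (G : SimpleGraph V) (i : ℕ) : Finset (Finset V) :=
  (powersetCard i univ).filter fun S => ¬ IsDomSet G S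

lemma domCount_add_card_nonDomSets (G : SimpleGraph V) (i : ℕ) :
    domCount G i + #(nonDomSets G i) = (Fintype.card V).choose i := by
  have h : domCount G i = #((powersetCard i univ).filter fun S : Finset V => IsDomSet G S) := by
    unfold domCount
    congr 1
    ext S
    simp [mem_powersetCard, and_comm]
  rw [h, nonDomSets, card_filter_add_card_filter_not, card_powersetCard, card_univ]

lemma mem_nonDomSets {G : SimpleGraph V} {i : ℕ} {S : Finset V} :
    S ∈ nonDomSets G i ↔ #S = i ∧ ∃ v ∉ S, ∀ u, G.Adj u v → u ∉ S := by
  rw [nonDomSets, mem_filter, mem_powersetCard_univ, IsDomSet]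
  push Not
  exact and_congr_right fun _ => exists_congr fun v => and_congr_right fun _ =>
    forall_congr' fun u => imp_not_comm

lemma IsDomSet.domCount_pos {G : SimpleGraph V} {S : Finset V} (hS : IsDomSet G S) :
    0 < domCount G #S :=
  card_pos.2 ⟨S, by simp [hS]⟩

lemma exists_isDomSet_of_domCount_pos {G : SimpleGraph V} {i : ℕ} (h : 0 < domCount G i) :
    ∃ S, IsDomSet G S ∧ #S = i := by
  obtain ⟨S, hS⟩ := card_pos.1 h
  exact ⟨S, by simpa using hS⟩

/-- The complement of an edge, as a set of vertices. -/
noncomputable def edgeCompl (e : Sym2 V) : Finset V := univ.filter fun v => v ∉ e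

lemma mem_edgeCompl {e : Sym2 V} {v : V} : v ∈ edgeCompl e ↔ v ∉ e := by
  simp [edgeCompl]

lemma edgeCompl_injective : Function.Injective (edgeCompl (V := V)) := by
  intro e f h
  refine Sym2.ext fun v => ?_
  rw [← not_iff_not, ← mem_edgeCompl, ← mem_edgeCompl, h]

lemma card_edgeCompl {u v : V} (h : u ≠ v) : #(edgeCompl s(u, v)) = Fintype.card V - 2 := by
  have : edgeCompl s(u, v) = ({u, v} : Finset V)ᶜ := by
    ext w; simp [mem_edgeCompl]
  rw [this, card_compl, card_pair h]

/-- A graph dominated by as many vertices as a star forest has components is a star forest, so the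
complement of each edge fails to dominate. -/
lemma card_edgeFinset_le_card_nonDomSets (G : SimpleGraph V) [Fintype G.edgeSet] {S : Finset V}
    (hS : IsDomSet G S) (hcard : #G.edgeFinset + #S ≤ Fintype.card V) :
    #G.edgeFinset ≤ #(nonDomSets G (Fintype.card V - 2)) := by
  have hex : ∀ v, ∃ u, v ∉ S → u ∈ S ∧ G.Adj v u := by
    intro v
    rcases hS v with h | ⟨u, hu, huv⟩
    · exact ⟨v, fun h' => absurd h h'⟩
    · exact ⟨u, fun _ => ⟨hu, huv.symm⟩⟩
  choose f hf using hex
  have hmaps : ∀ v ∈ Sᶜ, s(v, f v) ∈ G.edgeFinset := fun v hv => by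
    simpa using (hf v (mem_compl.1 hv)).2
  have hinj : Set.InjOn (fun v => s(v, f v)) (Sᶜ : Finset V) := by
    intro v hv w hw h
    have hv' := mem_compl.1 (mem_coe.1 hv)
    have hw' := mem_compl.1 (mem_coe.1 hw)
    rcases Sym2.eq_iff.1 h with ⟨h, _⟩ | ⟨h, _⟩
    · exact h
    · exact absurd (h ▸ (hf w hw').1) hv'
  have himage : Sᶜ.image (fun v => s(v, f v)) = G.edgeFinset := by
    refine eq_of_subset_of_card_le (image_subset_iff.2 hmaps) ?_
    rw [card_image_of_injOn hinj, card_compl]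
    omega
  rw [← card_image_of_injective G.edgeFinset edgeCompl_injective]
  refine card_le_card (image_subset_iff.2 fun e he => ?_)
  obtain ⟨v, hv, rfl⟩ := mem_image.1 (himage ▸ he)
  have hv' := mem_compl.1 hv
  refine mem_nonDomSets.2 ⟨card_edgeCompl (hf v hv').2.ne, v, by simp [mem_edgeCompl], ?_⟩
  intro u huv
  have hmem : s(v, u) ∈ Sᶜ.image (fun v => s(v, f v)) := by
    rw [himage]; simpa using huv.symm
  obtain ⟨w, hw, h⟩ := mem_image.1 hmem
  have hw' := mem_compl.1 hw
  rcases Sym2.eq_iff.1 h with ⟨rfl, rfl⟩ | ⟨_, h⟩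
  · simp [mem_edgeCompl]
  · exact absurd (h ▸ (hf w hw').1) hv'

/-- In a graph without isolated vertices, a non-dominating set missing two vertices is the
complement of an edge with an endpoint of degree one. -/
lemma card_nonDomSets_lt_card_edgeFinset (G : SimpleGraph V) [Fintype G.edgeSet]
    (hG : ∀ v, ∃ u, G.Adj u v) {a b a' b' : V} (hab : G.Adj a b) (haa' : G.Adj a' a)
    (hbb' : G.Adj b' b) (ha' : a' ≠ b) (hb' : b' ≠ a) :
    #(nonDomSets G (Fintype.card V - 2)) < #G.edgeFinset := by
  have hmem : s(a, b) ∈ G.edgeFinset := by simpa using hab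
  refine lt_of_le_of_lt ?_ (card_erase_lt_of_mem hmem)
  refine le_trans (card_le_card ?_) (card_image_le (f := edgeCompl))
  intro T hT
  obtain ⟨hcard, v, hv, hnbr⟩ := mem_nonDomSets.1 hT
  obtain ⟨u, huv⟩ := hG v
  have hT' : T = edgeCompl s(u, v) := by
    refine eq_of_subset_of_card_le (fun w hw => ?_) ?_
    · rw [mem_edgeCompl, Sym2.mem_iff]
      rintro (rfl | rfl)
      · exact hnbr _ huv hw
      · exact hv hw
    · rw [card_edgeCompl huv.ne, hcard]
  have hleaf : ∀ w, G.Adj w v → w = u := by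
    intro w hw
    have := hnbr w hw
    rw [hT', mem_edgeCompl, not_not, Sym2.mem_iff] at this
    exact this.resolve_right hw.ne
  refine mem_image.2 ⟨s(u, v), mem_erase.2 ⟨fun h => ?_, by simpa using huv⟩, hT'.symm⟩
  rcases Sym2.eq_iff.1 h with ⟨rfl, rfl⟩ | ⟨rfl, rfl⟩
  · exact hb' (hleaf _ hbb')
  · exact ha' (hleaf _ haa')

lemma nonDomSets_eq_empty (G : SimpleGraph V) (hG : ∀ v, ∃ u, G.Adj u v) {i : ℕ}
    (hi : Fintype.card V ≤ i + 1) : nonDomSets G i = ∅ := by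
  refine eq_empty_of_forall_notMem fun T hT => ?_
  obtain ⟨hcard, v, hv, hnbr⟩ := mem_nonDomSets.1 hT
  obtain ⟨u, huv⟩ := hG v
  have hsub : ({u, v} : Finset V) ⊆ Tᶜ := by
    intro w hw
    rcases mem_insert.1 hw with rfl | hw
    · exact mem_compl.2 (hnbr _ huv)
    · exact mem_compl.2 (mem_singleton.1 hw ▸ hv)
  have := card_le_card hsub
  rw [card_pair huv.ne, card_compl] at this
  omega

end Counting

/-- The forest on `Fin n` whose roots are the vertices below `c` and in which every other vertex
`j` is joined to its parent `p j`. -/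
def parentForest {n : ℕ} (c : ℕ) (p : Fin n → Fin n) : SimpleGraph (Fin n) :=
  SimpleGraph.fromRel fun u v => c ≤ u.val ∧ p u = v

lemma parentForest_adj {n c : ℕ} {p : Fin n → Fin n} (hp : ∀ j : Fin n, c ≤ j.val → p j < j)
    {j : Fin n} (hj : c ≤ j.val) : (parentForest c p).Adj (p j) j := by
  rw [parentForest, SimpleGraph.fromRel_adj]
  exact ⟨(hp j hj).ne, Or.inr ⟨hj, rfl⟩⟩

lemma card_edgeFinset_parentForest {n c : ℕ} {p : Fin n → Fin n}
    (hp : ∀ j : Fin n, c ≤ j.val → p j < j) [Fintype (parentForest c p).edgeSet] :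
    #(parentForest c p).edgeFinset = n - c := by
  have himage : (parentForest c p).edgeFinset =
      (univ.filter fun j : Fin n => c ≤ j.val).image fun j => s(p j, j) := by
    ext e
    induction e with
    | _ u v =>
      simp only [SimpleGraph.mem_edgeFinset, SimpleGraph.mem_edgeSet, mem_image, mem_filter,
        mem_univ, true_and]
      constructor
      · rw [parentForest, SimpleGraph.fromRel_adj]
        rintro ⟨_, ⟨h, rfl⟩ | ⟨h, rfl⟩⟩
        · exact ⟨u, h, Sym2.eq_swap⟩
        · exact ⟨v, h, rfl⟩
      · rintro ⟨j, hj, h⟩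
        rw [← SimpleGraph.mem_edgeSet, ← h]
        exact parentForest_adj hp hj
  rw [himage, card_image_of_injOn]
  · have : (univ.filter fun j : Fin n => c ≤ j.val).map Fin.valEmbedding = Finset.Ico c n := by
      ext k
      simp only [mem_map, mem_filter, mem_univ, true_and, Fin.valEmbedding_apply, Finset.mem_Ico]
      exact ⟨by rintro ⟨j, hj, rfl⟩; exact ⟨hj, j.2⟩, fun h => ⟨⟨k, h.2⟩, h.1, rfl⟩⟩
    rw [← card_map Fin.valEmbedding, this, Nat.card_Ico]
  · intro j hj k hk h
    have hj' := hp j (by simpa using hj)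
    have hk' := hp k (by simpa using hk)
    rcases Sym2.eq_iff.1 h with ⟨_, h⟩ | ⟨h₁, h₂⟩
    · exact h
    · rw [h₁] at hj'
      rw [← h₂] at hk'
      exact absurd hj' hk'.asymm

lemma exists_graph_isDomSet (n c : ℕ) (hc : 1 ≤ c) (hcn : c ≤ n) :
    ∃ G : SimpleGraph (Fin n), #G.edgeFinset = n - c ∧ ∃ S, IsDomSet G S ∧ #S = c := by
  have hp : ∀ j : Fin n, c ≤ j.val → (⟨0, by omega⟩ : Fin n) < j := fun j hj => by
    rw [Fin.lt_def]; simp only; omega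
  refine ⟨parentForest c fun _ => ⟨0, by omega⟩, card_edgeFinset_parentForest hp,
    univ.map (Fin.castLEEmb hcn), fun v => ?_, by simp⟩
  rcases lt_or_ge v.val c with h | h
  · exact Or.inl (mem_map.2 ⟨⟨v, h⟩, mem_univ _, rfl⟩)
  · exact Or.inr ⟨_, mem_map.2 ⟨⟨0, hc⟩, mem_univ _, rfl⟩, parentForest_adj hp h⟩

lemma exists_graph_card_nonDomSets_lt (n c : ℕ) (hc : 1 ≤ c) (hcn : 2 * c + 2 ≤ n) :
    ∃ G : SimpleGraph (Fin n), #G.edgeFinset = n - c ∧ (∀ v, ∃ u, G.Adj u v) ∧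
      #(nonDomSets G (n - 2)) < n - c := by
  let p : Fin n → Fin n := fun j =>
    if j.val < 2 * c then ⟨j.val - c, by omega⟩ else
      if j.val = n - 1 then ⟨c, by omega⟩ else ⟨0, by omega⟩
  have hp : ∀ j : Fin n, c ≤ j.val → p j < j := by
    intro j hj
    rw [Fin.lt_def]
    simp only [p]
    split_ifs <;> simp only <;> omega
  have hadj : ∀ i j : Fin n, c ≤ j.val → p j = i → (parentForest c p).Adj i j := by
    rintro _ j hj rfl
    exact parentForest_adj hp hj
  have hroot : ∀ (i : ℕ) (hi : i < c),
      (parentForest c p).Adj ⟨i, by omega⟩ ⟨c + i, by omega⟩ := by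
    intro i hi
    refine hadj _ _ (by simp) ?_
    simp only [p]
    rw [if_pos (by omega), Fin.mk.injEq]
    omega
  have hisol : ∀ v, ∃ u, (parentForest c p).Adj u v := by
    intro v
    rcases lt_or_ge v.val c with h | h
    · exact ⟨_, (hroot v h).symm⟩
    · exact ⟨_, parentForest_adj hp h⟩
  have hcard := card_edgeFinset_parentForest hp
  refine ⟨parentForest c p, hcard, hisol, ?_⟩
  have h₁ : (parentForest c p).Adj ⟨0, by omega⟩ ⟨2 * c, by omega⟩ := by
    refine hadj _ _ (by simp only; omega) ?_
    simp only [p]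
    rw [if_neg (by omega), if_neg (by omega)]
  have h₂ : (parentForest c p).Adj ⟨c, by omega⟩ ⟨n - 1, by omega⟩ := by
    refine hadj _ _ (by simp only; omega) ?_
    simp only [p]
    rw [if_neg (by omega), if_pos trivial]
  have := card_nonDomSets_lt_card_edgeFinset _ hisol (hroot 0 hc) h₁.symm h₂.symm
    (by rw [Ne, Fin.mk.injEq]; omega) (by rw [Ne, Fin.mk.injEq]; omega)
  rwa [Fintype.card_fin, hcard] at this

theorem stmt_8 (n m : ℕ) (hn : 4 ≤ n) (hm1 : (n + 1) / 2 < m) (hm2 : m ≤ n - 1) :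
    ¬ ∃ H : SimpleGraph (Fin n), H.edgeFinset.card = m ∧
      ∀ G : SimpleGraph (Fin n), G.edgeFinset.card = m →
        ∀ x : ℝ, 0 ≤ x → domPoly G x ≤ domPoly H x := by
  rintro ⟨H, hH, hopt⟩
  have hnm : n - (n - m) = m := by omega
  have hle : ∃ S, IsDomSet H S ∧ #S ≤ n - m := by
    obtain ⟨G, hG, S, hS, hSc⟩ := exists_graph_isDomSet n (n - m) (by omega) (by omega)
    by_contra! hno
    have hzero : ∀ i ≤ n - m, domCount H i = 0 := by
      intro i hi
      by_contra h
      obtain ⟨T, hT, rfl⟩ := exists_isDomSet_of_domCount_pos (Nat.pos_of_ne_zero h)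
      exact absurd (hno T hT) (by omega)
    obtain ⟨x, hx, hlt⟩ := exists_sum_lt_of_bot (Finset.Icc 1 n) (domCount G) (domCount H) (n - m)
      (Finset.mem_Icc.2 (by omega)) (fun i _ hi => by simp [hzero i hi.le])
      (by rw [hzero _ le_rfl, ← hSc]; exact hS.domCount_pos)
    have := hopt G (hG.trans hnm) x hx
    simp only [domPoly, Fintype.card_fin] at this
    exact this.not_gt hlt
  obtain ⟨S, hS, hSc⟩ := hle
  obtain ⟨G, hG, hisol, hGlt⟩ :=
    exists_graph_card_nonDomSets_lt n (n - m) (by omega) (by omega)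
  have hHge := card_edgeFinset_le_card_nonDomSets H hS (by rw [Fintype.card_fin]; omega)
  rw [Fintype.card_fin] at hHge
  have hcount := fun (K : SimpleGraph (Fin n)) i => domCount_add_card_nonDomSets K i
  have hk : n - 3 + 1 = n - 2 := by omega
  obtain ⟨x, hx, hlt⟩ := exists_sum_lt_of_top (Finset.Icc 1 n) (domCount G) (domCount H) (n - 3)
    (Finset.mem_Icc.2 (by omega))
    (fun i _ hi => by
      have h := hcount G i
      rw [nonDomSets_eq_empty G hisol (by rw [Fintype.card_fin]; omega), card_empty] at h
      have := hcount H i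
      omega)
    (by
      rw [hk]
      have := hcount G (n - 2)
      have := hcount H (n - 2)
      omega)
  have := hopt G (hG.trans hnm) x hx
  simp only [domPoly, Fintype.card_fin] at this
  exact this.not_gt hlt
end

section
/- Let G be a finite simple graph on n vertices and let r ≥ 0. Then the domination polynomial of the join K_r ∨ G satisfies D(K_r ∨ G, x) = ((1+x)^r − 1)(1+x)^n + D(G,x) for all real x. -/
open scoped Classical

/-- The join `G ∨ H` of two graphs: their disjoint union together with all edges
between vertices of `G` and vertices of `H`. -/
def joinGraph {α β : Type*} (G : SimpleGraph α) (H : SimpleGraph β) :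
    SimpleGraph (α ⊕ β) :=
  SimpleGraph.fromRel (fun a b =>
    (∃ u v, a = Sum.inl u ∧ b = Sum.inl v ∧ G.Adj u v) ∨
    (∃ u v, a = Sum.inr u ∧ b = Sum.inr v ∧ H.Adj u v) ∨
    (a.isLeft ∧ b.isRight))

theorem domPoly_eq_sum {V : Type*} [Fintype V] (G : SimpleGraph V) (x : ℝ) :
    domPoly G x = ∑ S : Finset V, if IsDomSet G S ∧ S.Nonempty then x ^ S.card else 0 := by
  unfold domPoly domCount
  rw [← Finset.sum_filter, ← Finset.sum_fiberwise_of_maps_to (g := Finset.card)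
    (t := Finset.Icc 1 (Fintype.card V))]
  · refine Finset.sum_congr rfl fun i hi => ?_
    rw [Finset.sum_congr rfl (g := fun _ => x ^ i), Finset.sum_const, nsmul_eq_mul,
      Finset.filter_filter]
    · congr 3
      ext S
      simp only [Finset.mem_filter, Finset.mem_univ, true_and]
      rw [← Finset.card_pos]
      have := (Finset.mem_Icc.mp hi).1
      constructor
      · rintro ⟨h, rfl⟩
        exact ⟨⟨h, this⟩, rfl⟩
      · rintro ⟨⟨h, _⟩, hc⟩
        exact ⟨h, hc⟩
    · intro S hS
      rw [(Finset.mem_filter.mp hS).2]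
  · intro S hS
    exact Finset.mem_Icc.mpr
      ⟨Finset.card_pos.mpr (Finset.mem_filter.mp hS).2.2, Finset.card_le_univ S⟩

theorem joinGraph_adj_inl_inl {α β : Type*} (G : SimpleGraph α) (H : SimpleGraph β) (a b : α) :
    (joinGraph G H).Adj (Sum.inl a) (Sum.inl b) ↔ G.Adj a b := by
  simp only [joinGraph, SimpleGraph.fromRel_adj]
  simpa [G.adj_comm b a] using fun h : G.Adj a b => h.ne

theorem joinGraph_adj_inr_inr {α β : Type*} (G : SimpleGraph α) (H : SimpleGraph β) (a b : β) :
    (joinGraph G H).Adj (Sum.inr a) (Sum.inr b) ↔ H.Adj a b := by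
  simp only [joinGraph, SimpleGraph.fromRel_adj]
  simpa [H.adj_comm b a] using fun h : H.Adj a b => h.ne

theorem joinGraph_adj_inl_inr {α β : Type*} (G : SimpleGraph α) (H : SimpleGraph β)
    (a : α) (b : β) : (joinGraph G H).Adj (Sum.inl a) (Sum.inr b) := by
  simp [joinGraph, SimpleGraph.fromRel_adj]

/-- The nonempty dominating sets of `K ∨ G` with `K` complete are those meeting `K`, together
with the nonempty dominating sets of `G`. -/
theorem isDomSet_join_top_iff {α V : Type*} (G : SimpleGraph V) (A : Finset α) (B : Finset V) :
    (IsDomSet (joinGraph (⊤ : SimpleGraph α) G) (A.disjSum B) ∧ (A.disjSum B).Nonempty) ↔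
      A.Nonempty ∨ (IsDomSet G B ∧ B.Nonempty) := by
  rcases A.eq_empty_or_nonempty with rfl | ⟨a, ha⟩
  · simp only [IsDomSet, Finset.Nonempty, Sum.forall, Sum.exists, Finset.inl_mem_disjSum,
      Finset.inr_mem_disjSum, joinGraph_adj_inr_inr, Finset.notMem_empty, false_and,
      exists_false, false_or]
    exact ⟨fun h => ⟨h.1.2, h.2⟩, fun h => ⟨⟨fun c => h.2.imp fun b hb =>
      ⟨hb, (joinGraph_adj_inl_inr _ _ c b).symm⟩, h.1⟩, h.2⟩⟩
  · refine iff_of_true ⟨?_, Sum.inl a, Finset.inl_mem_disjSum.mpr ha⟩ (Or.inl ⟨a, ha⟩)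
    rintro (c | v)
    · by_cases hc : a = c
      · exact Or.inl (hc ▸ Finset.inl_mem_disjSum.mpr ha)
      · exact Or.inr ⟨Sum.inl a, Finset.inl_mem_disjSum.mpr ha,
          (joinGraph_adj_inl_inl _ _ a c).mpr hc⟩
    · exact Or.inr ⟨Sum.inl a, Finset.inl_mem_disjSum.mpr ha, joinGraph_adj_inl_inr _ _ a v⟩

theorem sum_pow_card_finset (α : Type*) [Fintype α] (x : ℝ) :
    ∑ S : Finset α, x ^ S.card = (1 + x) ^ Fintype.card α := by
  simpa [add_comm] using Fintype.sum_pow_mul_eq_add_pow α x 1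

theorem sum_finset_sum {α β : Type*} [Fintype α] [Fintype β] (f : Finset (α ⊕ β) → ℝ) :
    ∑ S, f S = ∑ A : Finset α, ∑ B : Finset β, f (A.disjSum B) := by
  rw [← Fintype.sum_prod_type' (f := fun A B => f (Finset.disjSum A B))]
  exact (Equiv.sum_comp Finset.sumEquiv.toEquiv.symm f).symm

theorem stmt_10 {V : Type*} [Fintype V] (G : SimpleGraph V) (r : ℕ) :
    ∀ x : ℝ,
      domPoly (joinGraph (⊤ : SimpleGraph (Fin r)) G) x =
        ((1 + x) ^ r - 1) * (1 + x) ^ (Fintype.card V) + domPoly G x := by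
  intro x
  have hcard : ∑ A ∈ Finset.univ.erase (∅ : Finset (Fin r)), x ^ A.card = (1 + x) ^ r - 1 := by
    have h := sum_pow_card_finset (Fin r) x
    rw [← Finset.add_sum_erase _ _ (Finset.mem_univ ∅), Fintype.card_fin] at h
    simp only [Finset.card_empty, pow_zero] at h
    linarith
  rw [domPoly_eq_sum, domPoly_eq_sum, sum_finset_sum, ← Finset.add_sum_erase _ _ (Finset.mem_univ ∅), add_comm]
  simp only [isDomSet_join_top_iff, Finset.card_disjSum]
  congr 1
  · rw [← hcard, ← sum_pow_card_finset V, Finset.sum_mul]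
    refine Finset.sum_congr rfl fun A hA => ?_
    have hA' := Finset.nonempty_iff_ne_empty.mpr (Finset.ne_of_mem_erase hA)
    simp [hA', pow_add, Finset.mul_sum]
  · simp
end

section
/- Let G be a graph on n vertices and m ≥ n − 1 edges which is optimal among all graphs on n vertices and m edges. Then there exist r with 0 ≤ r ≤ n and a graph H on n − r vertices with at most n − r − 2 edges such that G is isomorphic to the join K_r ∨ H and H is optimal among all graphs with the same number of vertices and edges as H. -/
open scoped Classical

namespace SimpleGraph

variable {V W : Type*}

lemma joinGraph_adj_inl {α β : Type*} (G : SimpleGraph α) (H : SimpleGraph β) (a b : α) :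
    (joinGraph G H).Adj (Sum.inl a) (Sum.inl b) ↔ G.Adj a b := by
  simp only [joinGraph, fromRel_adj]
  constructor
  · rintro ⟨-, h⟩
    simpa [G.adj_comm b a] using h
  · intro h
    simpa [h] using h.ne

lemma joinGraph_adj_inr {α β : Type*} (G : SimpleGraph α) (H : SimpleGraph β) (a b : β) :
    (joinGraph G H).Adj (Sum.inr a) (Sum.inr b) ↔ H.Adj a b := by
  simp only [joinGraph, fromRel_adj]
  constructor
  · rintro ⟨-, h⟩
    simpa [H.adj_comm b a] using h
  · intro h
    simpa [h] using h.ne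

lemma joinGraph_adj_inl_inr {α β : Type*} (G : SimpleGraph α) (H : SimpleGraph β)
    (a : α) (b : β) : (joinGraph G H).Adj (Sum.inl a) (Sum.inr b) := by
  simp [joinGraph]

lemma joinGraph_adj_inr_inl {α β : Type*} (G : SimpleGraph α) (H : SimpleGraph β)
    (a : α) (b : β) : (joinGraph G H).Adj (Sum.inr b) (Sum.inl a) :=
  (joinGraph_adj_inl_inr G H a b).symm

/-- The cone over `G`: the vertex `none` is joined to every vertex of `G`. -/
def cone (G : SimpleGraph V) : SimpleGraph (Option V) where
  Adj
    | none, none => False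
    | some a, some b => G.Adj a b
    | _, _ => True
  symm := ⟨by
    rintro (_ | a) (_ | b) h
    exacts [h, trivial, trivial, G.adj_symm h]⟩
  loopless := ⟨by
    rintro (_ | a) h
    exacts [h, G.irrefl h]⟩

@[simp] lemma cone_adj_none_none (G : SimpleGraph V) : ¬ (cone G).Adj none none := id

@[simp] lemma cone_adj_none_some (G : SimpleGraph V) (a : V) : (cone G).Adj none (some a) :=
  trivial

@[simp] lemma cone_adj_some_none (G : SimpleGraph V) (a : V) : (cone G).Adj (some a) none :=
  trivial

@[simp] lemma cone_adj_some_some (G : SimpleGraph V) (a b : V) :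
    (cone G).Adj (some a) (some b) ↔ G.Adj a b := Iff.rfl

/-- Isomorphic graphs have isomorphic cones. -/
def Iso.cone {G : SimpleGraph V} {H : SimpleGraph W} (e : G ≃g H) :
    SimpleGraph.cone G ≃g SimpleGraph.cone H where
  toEquiv := Equiv.optionCongr e.toEquiv
  map_rel_iff' := by
    rintro (_ | a) (_ | b) <;> simp [e.map_adj_iff]

/-- A graph with a universal vertex is the cone over the rest of the graph. -/
def isoConeOfUniversal {k : ℕ} (G : SimpleGraph (Fin (k + 1))) (v : Fin (k + 1))
    (hv : ∀ w, w ≠ v → G.Adj v w) : cone (G.comap v.succAbove) ≃g G where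
  toEquiv := (finSuccEquiv' v).symm
  map_rel_iff' := by
    have h (a : Fin k) := hv _ (Fin.succAbove_ne v a)
    rintro (_ | a) (_ | b) <;> simp [h, G.adj_comm _ v]

/-- The cone over `K_r ∨ H` is `K_{r+1} ∨ H`. -/
def coneJoinIso (r : ℕ) (H : SimpleGraph W) :
    joinGraph (⊤ : SimpleGraph (Fin (r + 1))) H ≃g
      cone (joinGraph (⊤ : SimpleGraph (Fin r)) H) where
  toFun := Sum.elim (fun i => Fin.cases none (fun j => some (Sum.inl j)) i)
    (fun w => some (Sum.inr w))
  invFun o := o.elim (Sum.inl 0) (Sum.map Fin.succ id)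
  left_inv := by
    rintro (i | w)
    · induction i using Fin.cases <;> simp
    · simp
  right_inv := by
    rintro (_ | i | w) <;> simp
  map_rel_iff' := by
    rintro (i | w) (j | u)
    · induction i using Fin.cases <;> induction j using Fin.cases <;>
        simp [joinGraph_adj_inl, Fin.succ_ne_zero, (Fin.succ_ne_zero _).symm]
    · induction i using Fin.cases <;> simp [joinGraph_adj_inl_inr]
    · induction j using Fin.cases <;> simp [joinGraph_adj_inr_inl]
    · simp [joinGraph_adj_inr]

lemma card_edgeFinset_cone [Fintype V] (G : SimpleGraph V) :
    (cone G).edgeFinset.card = G.edgeFinset.card + Fintype.card V := by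
  have h₁ := (cone G).sum_degrees_eq_twice_card_edges
  have h₂ := G.sum_degrees_eq_twice_card_edges
  have hnone : (cone G).degree none = Fintype.card V := by
    rw [← card_neighborFinset_eq_degree, ← Finset.card_univ,
      ← Finset.card_map (Function.Embedding.some (α := V))]
    congr 1
    ext (_ | a) <;> simp
  have hsome (a : V) : (cone G).degree (some a) = G.degree a + 1 := by
    rw [← card_neighborFinset_eq_degree, ← card_neighborFinset_eq_degree,
      ← Finset.card_insertNone]
    congr 1
    ext (_ | b) <;> simp
  rw [Fintype.sum_option, hnone] at h₁
  simp only [hsome, Finset.sum_add_distrib, Finset.sum_const, smul_eq_mul, mul_one,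
    Finset.card_univ] at h₁
  omega

lemma exists_card_edgeFinset_eq [Fintype V] {m : ℕ} (hm : m ≤ (Fintype.card V).choose 2) :
    ∃ G : SimpleGraph V, G.edgeFinset.card = m := by
  rw [← card_edgeFinset_top_eq_card_choose_two] at hm
  obtain ⟨s, hs, rfl⟩ := Finset.exists_subset_card_eq hm
  refine ⟨fromEdgeSet s, congrArg Finset.card ?_⟩
  ext e
  simp only [mem_edgeFinset, edgeSet_fromEdgeSet, Set.mem_sdiff, Finset.mem_coe]
  refine ⟨fun h => h.1, fun h => ⟨h, ?_⟩⟩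
  have := hs h
  rw [mem_edgeFinset] at this
  exact not_isDiag_of_mem_edgeSet _ this

lemma domPoly_eq_sum [Fintype V] (G : SimpleGraph V) (x : ℝ) :
    domPoly G x =
      ∑ S with IsDomSet G S ∧ S.Nonempty, x ^ S.card := by
  have hmaps : ∀ S ∈ Finset.univ.filter (fun S : Finset V => IsDomSet G S ∧ S.Nonempty),
      S.card ∈ Finset.Icc 1 (Fintype.card V) := by
    intro S hS
    rw [Finset.mem_filter] at hS
    exact Finset.mem_Icc.2 ⟨hS.2.2.card_pos, Finset.card_le_univ S⟩
  rw [← Finset.sum_fiberwise_of_maps_to hmaps, domPoly]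
  refine Finset.sum_congr rfl fun i hi => ?_
  rw [Finset.sum_congr rfl (g := fun _ => x ^ i)
    (fun S hS => by rw [(Finset.mem_filter.1 hS).2]), Finset.sum_const, nsmul_eq_mul, domCount]
  congr 3
  ext S
  simp only [Finset.mem_filter, Finset.mem_univ, true_and]
  constructor
  · rintro ⟨h, rfl⟩
    exact ⟨⟨h, Finset.card_pos.1 (Finset.mem_Icc.1 hi).1⟩, rfl⟩
  · rintro ⟨⟨h, -⟩, rfl⟩
    exact ⟨h, rfl⟩

lemma Iso.isDomSet_map_iff {G : SimpleGraph V} {H : SimpleGraph W} (e : G ≃g H) (S : Finset V) :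
    IsDomSet H (S.map e.toEquiv.toEmbedding) ↔ IsDomSet G S := by
  unfold IsDomSet
  rw [← e.toEquiv.forall_congr_right]
  refine forall_congr' fun v => or_congr (Finset.mem_map' _) ?_
  simp only [Finset.mem_map, exists_exists_and_eq_and]
  exact exists_congr fun u => and_congr_right fun _ => e.map_adj_iff

lemma Iso.domPoly_eq [Fintype V] [Fintype W] {G : SimpleGraph V} {H : SimpleGraph W}
    (e : G ≃g H) (x : ℝ) : domPoly G x = domPoly H x := by
  rw [domPoly_eq_sum, domPoly_eq_sum]
  refine Finset.sum_equiv e.toEquiv.finsetCongr (fun S => ?_) (fun S _ => ?_)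
  · simp [e.isDomSet_map_iff]
  · simp

lemma isDomSet_cone_of_none_mem (G : SimpleGraph V) {S : Finset (Option V)} (hS : none ∈ S) :
    IsDomSet (cone G) S := by
  rintro (_ | a)
  · exact Or.inl hS
  · exact Or.inr ⟨none, hS, trivial⟩

lemma isDomSet_cone_map_some_iff (G : SimpleGraph V) {S : Finset V} (hS : S.Nonempty) :
    IsDomSet (cone G) (S.map Function.Embedding.some) ↔ IsDomSet G S := by
  unfold IsDomSet
  obtain ⟨a, ha⟩ := hS
  rw [Option.forall]
  simpa using fun _ => ⟨a, ha⟩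

lemma domPoly_cone [Fintype V] (G : SimpleGraph V) (x : ℝ) :
    domPoly (cone G) x =
      ∑ S : Finset (Option V) with none ∈ S, x ^ S.card + domPoly G x := by
  rw [domPoly_eq_sum, domPoly_eq_sum,
    ← Finset.sum_filter_add_sum_filter_not _ (fun S : Finset (Option V) => none ∈ S)]
  congr 1
  · refine Finset.sum_congr ?_ fun _ _ => rfl
    ext S
    simp only [Finset.mem_filter, Finset.mem_univ, true_and]
    exact ⟨fun h => h.2, fun h => ⟨⟨isDomSet_cone_of_none_mem G h, ⟨_, h⟩⟩, h⟩⟩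
  · symm
    refine Finset.sum_bij (fun S _ => S.map Function.Embedding.some) ?_ ?_ ?_ ?_
    · intro S hS
      simp only [Finset.mem_filter, Finset.mem_univ, true_and] at hS ⊢
      exact ⟨⟨(isDomSet_cone_map_some_iff G hS.2).2 hS.1, hS.2.map⟩, by simp⟩
    · intro S _ T _ h
      exact Finset.map_injective _ h
    · intro T hT
      simp only [Finset.mem_filter, Finset.mem_univ, true_and] at hT
      obtain ⟨⟨hdom, hne⟩, hnone⟩ := hT
      have hT : T.eraseNone.map Function.Embedding.some = T := by
        rw [Finset.map_some_eraseNone, Finset.erase_eq_of_notMem hnone]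
      have hne' : T.eraseNone.Nonempty := by
        rwa [← hT, Finset.map_nonempty] at hne
      refine ⟨T.eraseNone, ?_, hT⟩
      simp only [Finset.mem_filter, Finset.mem_univ, true_and]
      exact ⟨(isDomSet_cone_map_some_iff G hne').1 (hT.symm ▸ hdom), hne'⟩
    · simp

lemma le_domPoly_cone [Fintype V] (G : SimpleGraph V) {x : ℝ} (hx : 0 ≤ x) :
    x ≤ domPoly (cone G) x := by
  rw [domPoly_eq_sum]
  have h := Finset.single_le_sum (f := fun S : Finset (Option V) => x ^ S.card)
    (s := Finset.univ.filter fun S => IsDomSet (cone G) S ∧ S.Nonempty)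
    (fun S _ => pow_nonneg hx _) (a := {none})
    (by simpa using isDomSet_cone_of_none_mem G (Finset.mem_singleton_self _))
  simpa using h

/-- Without a universal vertex, every nonempty dominating set has at least two elements. -/
lemma domPoly_le_of_no_universal [Fintype V] (G : SimpleGraph V)
    (hG : ∀ v, ∃ w, w ≠ v ∧ ¬ G.Adj v w) {x : ℝ} (hx : 0 ≤ x) (hx1 : x ≤ 1) :
    domPoly G x ≤ Fintype.card (Finset V) * x ^ 2 := by
  rw [domPoly_eq_sum, ← nsmul_eq_mul]
  refine (Finset.sum_le_card_nsmul _ _ (x ^ 2) fun S hS => ?_).trans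
    (nsmul_le_nsmul_left (by positivity) (Finset.card_le_univ _))
  simp only [Finset.mem_filter, Finset.mem_univ, true_and] at hS
  refine pow_le_pow_of_le_one hx hx1 ?_
  by_contra! h
  have hpos := hS.2.card_pos
  obtain ⟨v, rfl⟩ := Finset.card_eq_one.1 (by omega : S.card = 1)
  obtain ⟨w, hwv, hadj⟩ := hG v
  have := hS.1 w
  simp_all

/-- `G` is optimal among the graphs with the same vertices and the same number of edges. -/
def IsDomOptimal [Fintype V] (G : SimpleGraph V) : Prop :=
  ∀ G' : SimpleGraph V, G'.edgeFinset.card = G.edgeFinset.card →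
    ∀ x : ℝ, 0 ≤ x → domPoly G' x ≤ domPoly G x

lemma IsDomOptimal.of_iso [Fintype V] [Fintype W] {G : SimpleGraph V} {H : SimpleGraph W}
    (hG : IsDomOptimal G) (e : G ≃g H) : IsDomOptimal H := by
  intro H' hH' x hx
  let e' : H'.comap e.toEquiv ≃g H' := Iso.comap e.toEquiv H'
  rw [← e'.domPoly_eq, ← e.domPoly_eq]
  exact hG _ (e'.card_edgeFinset_eq.trans (hH'.trans e.card_edgeFinset_eq.symm)) x hx

lemma IsDomOptimal.of_cone [Fintype V] {G : SimpleGraph V} (hG : IsDomOptimal (cone G)) :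
    IsDomOptimal G := by
  intro G' hG' x hx
  have h := hG (cone G') (by simp only [card_edgeFinset_cone, hG']) x hx
  simpa only [domPoly_cone, add_le_add_iff_left] using h

lemma IsDomOptimal.exists_universal {k : ℕ} {G : SimpleGraph (Fin (k + 1))}
    (hG : IsDomOptimal G) (hk : k ≤ G.edgeFinset.card) :
    ∃ v, ∀ w, w ≠ v → G.Adj v w := by
  by_contra! hno
  have hle := G.card_edgeFinset_le_card_choose_two
  rw [Fintype.card_fin, Nat.choose_succ_succ' k 1, Nat.choose_one_right] at hle
  obtain ⟨G₁, hG₁⟩ := exists_card_edgeFinset_eq (V := Fin k)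
    (m := G.edgeFinset.card - k) (by rw [Fintype.card_fin, show 2 = 1 + 1 from rfl]; omega)
  obtain ⟨G₂, ⟨e⟩⟩ : ∃ G₂ : SimpleGraph (Fin (k + 1)), Nonempty (cone G₁ ≃g G₂) :=
    ⟨_, ⟨Iso.map (finSuccEquiv k).symm (cone G₁)⟩⟩
  have hcard : G₂.edgeFinset.card = G.edgeFinset.card := by
    rw [← e.card_edgeFinset_eq, card_edgeFinset_cone, hG₁, Fintype.card_fin]
    omega
  set N : ℝ := (Fintype.card (Finset (Fin (k + 1))) : ℝ)
  have hN : 0 ≤ N := Nat.cast_nonneg _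
  have hx : 0 < 1 / (N + 1) := by positivity
  have hx1 : 1 / (N + 1) ≤ 1 := by
    rw [div_le_one (by positivity)]
    linarith
  have h := (le_domPoly_cone G₁ hx.le).trans
    ((e.domPoly_eq _).le.trans ((hG _ hcard _ hx.le).trans
      (domPoly_le_of_no_universal G hno hx.le hx1)))
  have hmul : 1 / (N + 1) * (N + 1) = 1 := by field_simp
  nlinarith

lemma IsDomOptimal.exists_iso_join (n : ℕ) (G : SimpleGraph (Fin n)) (hG : IsDomOptimal G) :
    ∃ r s : ℕ, r + s = n ∧ ∃ H : SimpleGraph (Fin s), H.edgeFinset.card ≤ s - 2 ∧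
      Nonempty (G ≃g joinGraph (⊤ : SimpleGraph (Fin r)) H) ∧ IsDomOptimal H := by
  induction n with
  | zero =>
    refine ⟨0, 0, rfl, G, ?_, ⟨⟨Equiv.equivOfIsEmpty _ _, fun {a} => a.elim0⟩⟩, hG⟩
    simpa using G.card_edgeFinset_le_card_choose_two
  | succ k ih =>
    by_cases hk : G.edgeFinset.card ≤ k + 1 - 2
    · refine ⟨0, k + 1, zero_add _, G, hk,
        ⟨⟨(Equiv.emptySum (Fin 0) _).symm, ?_⟩⟩, hG⟩
      simp [joinGraph_adj_inr]
    · obtain ⟨v, hv⟩ := hG.exists_universal (by omega)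
      let e := isoConeOfUniversal G v hv
      obtain ⟨r, s, rfl, H, hH, ⟨f⟩, hopt⟩ := ih _ (hG.of_iso e.symm).of_cone
      exact ⟨r + 1, s, by omega, H, hH,
        ⟨(e.symm.trans f.cone).trans (coneJoinIso r H).symm⟩, hopt⟩

end SimpleGraph

theorem stmt_11 (n m : ℕ) (hm : n - 1 ≤ m)
    (G : SimpleGraph (Fin n)) (hG : G.edgeFinset.card = m)
    (hopt : ∀ G' : SimpleGraph (Fin n), G'.edgeFinset.card = m →
      ∀ x : ℝ, 0 ≤ x → domPoly G' x ≤ domPoly G x) :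
    ∃ (r : ℕ) (_ : r ≤ n) (H : SimpleGraph (Fin (n - r))),
      H.edgeFinset.card ≤ n - r - 2 ∧
      Nonempty (G ≃g joinGraph (⊤ : SimpleGraph (Fin r)) H) ∧
      (∀ H' : SimpleGraph (Fin (n - r)), H'.edgeFinset.card = H.edgeFinset.card →
        ∀ x : ℝ, 0 ≤ x → domPoly H' x ≤ domPoly H x) := by
  subst hG
  obtain ⟨r, s, hrs, H, hH, e, hHopt⟩ := SimpleGraph.IsDomOptimal.exists_iso_join n G hopt
  obtain rfl : s = n - r := by omega
  exact ⟨r, by omega, H, hH, e, hHopt⟩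
end

section
/- Let n ≥ 6 and let m satisfy n − 1 ≤ m < C(n,2) − 6. Then there is no optimal graph on n vertices and m edges; that is, there is no graph H on n vertices and m edges such that D(H,x) ≥ D(G,x) for all graphs G on n vertices and m edges and all x ≥ 0. -/
open scoped Classical

section Coefficients

lemma exists_sum_pos_of_leading {n j : ℕ} {c : ℕ → ℝ} (hj : j ∈ Finset.Icc 1 n) (hc : 1 ≤ c j)
    (hnonneg : ∀ i ∈ Finset.Icc 1 n, j < i → 0 ≤ c i) :
    ∃ x : ℝ, 0 ≤ x ∧ 0 < ∑ i ∈ Finset.Icc 1 n, c i * x ^ i := by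
  set M := ∑ i ∈ Finset.Icc 1 n, |c i| with hM
  have hM0 : 0 ≤ M := Finset.sum_nonneg fun _ _ => abs_nonneg _
  set x := 1 + M with hx
  have hx1 : 1 ≤ x := by linarith
  have hj1 : 1 ≤ j := (Finset.mem_Icc.1 hj).1
  have hterm : ∀ i ∈ Finset.Icc 1 n,
      (if i = j then x ^ j else 0) - |c i| * x ^ (j - 1) ≤ c i * x ^ i := by
    intro i hi
    have hp : 0 ≤ |c i| * x ^ (j - 1) := by positivity
    have hq : 0 < x ^ i := by positivity
    rcases lt_trichotomy i j with h | rfl | h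
    · rw [if_neg h.ne]
      have h1 : x ^ i ≤ x ^ (j - 1) := pow_le_pow_right₀ hx1 (by omega)
      have h2 := mul_le_mul_of_nonneg_left h1 (abs_nonneg (c i))
      have h3 := mul_le_mul_of_nonneg_right (neg_abs_le (c i)) hq.le
      linarith
    · rw [if_pos rfl]
      nlinarith
    · rw [if_neg h.ne']
      have := mul_nonneg (hnonneg i hi h) hq.le
      linarith
  refine ⟨x, by linarith, lt_of_lt_of_le ?_ (Finset.sum_le_sum hterm)⟩
  rw [Finset.sum_sub_distrib, Finset.sum_ite_eq', if_pos hj, ← Finset.sum_mul, ← hM,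
    ← Nat.sub_add_cancel hj1, pow_succ, Nat.add_sub_cancel]
  have : 0 < x ^ (j - 1) := by positivity
  nlinarith

lemma exists_sum_pos_of_lowest {n : ℕ} {c : ℕ → ℝ} (hn : 1 ≤ n) (hc : 1 ≤ c 1) :
    ∃ x : ℝ, 0 ≤ x ∧ 0 < ∑ i ∈ Finset.Icc 1 n, c i * x ^ i := by
  set M := ∑ i ∈ Finset.Icc 1 n, |c i| with hM
  have hM0 : 0 ≤ M := Finset.sum_nonneg fun _ _ => abs_nonneg _
  set x := 1 / (1 + M) with hx
  have hx0 : 0 < x := by positivity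
  have hx1 : x ≤ 1 := by rw [hx, div_le_one (by linarith)]; linarith
  have hxM : x * (1 + M) = 1 := by rw [hx]; field_simp
  have hterm : ∀ i ∈ Finset.Icc 1 n,
      (if i = 1 then x else 0) - |c i| * x ^ 2 ≤ c i * x ^ i := by
    intro i hi
    have hp : 0 ≤ |c i| * x ^ 2 := by positivity
    rcases eq_or_ne i 1 with rfl | h
    · rw [if_pos rfl, pow_one]
      nlinarith
    · rw [if_neg h]
      have hi1 := (Finset.mem_Icc.1 hi).1
      have h1 : x ^ i ≤ x ^ 2 := pow_le_pow_of_le_one hx0.le hx1 (by omega)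
      have h2 := mul_le_mul_of_nonneg_left h1 (abs_nonneg (c i))
      have h3 := mul_le_mul_of_nonneg_right (neg_abs_le (c i)) (pow_nonneg hx0.le i)
      linarith
  refine ⟨x, hx0.le, lt_of_lt_of_le ?_ (Finset.sum_le_sum hterm)⟩
  rw [Finset.sum_sub_distrib, Finset.sum_ite_eq', if_pos (Finset.mem_Icc.2 ⟨le_rfl, hn⟩),
    ← Finset.sum_mul, ← hM]
  nlinarith [mul_pos hx0 hx0]

lemma domPoly_sub {V : Type*} [Fintype V] (G H : SimpleGraph V) (x : ℝ) :
    domPoly G x - domPoly H x = ∑ i ∈ Finset.Icc 1 (Fintype.card V),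
      ((domCount G i : ℝ) - domCount H i) * x ^ i := by
  simp only [domPoly, sub_mul, Finset.sum_sub_distrib]

end Coefficients

section ClosedNeighborhoods

variable {V : Type*} [Fintype V] [DecidableEq V]

/-- The closed neighborhood of a vertex. -/
noncomputable def closedNbhd (G : SimpleGraph V) (v : V) : Finset V :=
  insert v (G.neighborFinset v)

lemma mem_closedNbhd {G : SimpleGraph V} {v w : V} : w ∈ closedNbhd G v ↔ w = v ∨ G.Adj v w := by
  simp [closedNbhd]

lemma self_mem_closedNbhd (G : SimpleGraph V) (v : V) : v ∈ closedNbhd G v :=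
  mem_closedNbhd.2 (Or.inl rfl)

lemma card_closedNbhd (G : SimpleGraph V) (v : V) : (closedNbhd G v).card = G.degree v + 1 := by
  rw [closedNbhd, Finset.card_insert_of_notMem (by simp), SimpleGraph.card_neighborFinset_eq_degree]

/-- The sets of cardinality `i` which are closed neighborhoods. -/
noncomputable def closedNbhdsOfCard (G : SimpleGraph V) (i : ℕ) : Finset (Finset V) :=
  (Finset.univ.filter fun v => G.degree v + 1 = i).image (closedNbhd G)

lemma closedNbhd_mem_closedNbhdsOfCard {G : SimpleGraph V} {v : V} {i : ℕ}
    (h : G.degree v + 1 = i) : closedNbhd G v ∈ closedNbhdsOfCard G i :=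
  Finset.mem_image_of_mem _ (by simpa using h)

lemma isDomSet_iff_closedNbhd (G : SimpleGraph V) (S : Finset V) :
    IsDomSet G S ↔ ∀ v, ¬ closedNbhd G v ⊆ Sᶜ := by
  refine forall_congr' fun v => ?_
  simp only [Finset.not_subset, mem_closedNbhd, Finset.mem_compl, not_not]
  constructor
  · rintro (h | ⟨u, hu, h⟩)
    exacts [⟨v, Or.inl rfl, h⟩, ⟨u, Or.inr h.symm, hu⟩]
  · rintro ⟨u, rfl | h, hu⟩
    exacts [Or.inl hu, Or.inr ⟨u, hu, h.symm⟩]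

lemma domCount_card_sub (G : SimpleGraph V) {i : ℕ} (hi : i ≤ Fintype.card V) :
    domCount G (Fintype.card V - i) = ((Finset.powersetCard i Finset.univ).filter
      fun T => ∀ v, ¬ closedNbhd G v ⊆ T).card := by
  refine Finset.card_bij' (fun S _ => Sᶜ) (fun T _ => Tᶜ) ?_ ?_ ?_ ?_
  · intro S hS
    simp only [Finset.mem_filter, Finset.mem_univ, true_and] at hS
    simp only [Finset.mem_filter, Finset.mem_powersetCard, Finset.subset_univ, true_and,
      Finset.card_compl]
    exact ⟨by omega, (isDomSet_iff_closedNbhd G S).1 hS.1⟩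
  · intro T hT
    simp only [Finset.mem_filter, Finset.mem_powersetCard, Finset.subset_univ, true_and] at hT
    simp only [Finset.mem_filter, Finset.mem_univ, true_and, Finset.card_compl, hT.1, and_true,
      isDomSet_iff_closedNbhd, compl_compl]
    exact hT.2
  · simp
  · simp

lemma domCount_add_card_closedNbhdsOfCard_le (G : SimpleGraph V) {i : ℕ}
    (hi : i ≤ Fintype.card V) :
    domCount G (Fintype.card V - i) + (closedNbhdsOfCard G i).card ≤ (Fintype.card V).choose i := by
  rw [domCount_card_sub G hi, ← Finset.card_univ, ← Finset.card_powersetCard,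
    ← Finset.card_filter_add_card_filter_not (s := Finset.powersetCard i (Finset.univ : Finset V))
      (fun T => ∀ v, ¬ closedNbhd G v ⊆ T)]
  refine Nat.add_le_add_left (Finset.card_le_card fun T hT => ?_) _
  obtain ⟨v, hv, rfl⟩ := Finset.mem_image.1 hT
  simp only [Finset.mem_filter, Finset.mem_univ, true_and] at hv
  simp only [Finset.mem_filter, Finset.mem_powersetCard, Finset.subset_univ, true_and,
    card_closedNbhd, hv]
  exact fun h => h v subset_rfl

lemma domCount_add_card_closedNbhdsOfCard (G : SimpleGraph V) {i : ℕ}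
    (hi : i ≤ Fintype.card V) (hdeg : ∀ v, i ≤ G.degree v + 1) :
    domCount G (Fintype.card V - i) + (closedNbhdsOfCard G i).card = (Fintype.card V).choose i := by
  refine (domCount_add_card_closedNbhdsOfCard_le G hi).antisymm ?_
  rw [domCount_card_sub G hi, ← Finset.card_univ, ← Finset.card_powersetCard,
    ← Finset.card_filter_add_card_filter_not (s := Finset.powersetCard i (Finset.univ : Finset V))
      (fun T => ∀ v, ¬ closedNbhd G v ⊆ T)]
  refine Nat.add_le_add_left (Finset.card_le_card fun T hT => ?_) _
  simp only [Finset.mem_filter, Finset.mem_powersetCard, Finset.subset_univ, true_and,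
    not_forall, not_not] at hT
  obtain ⟨hT, v, hv⟩ := hT
  have hcard : T.card ≤ (closedNbhd G v).card := by
    rw [hT, card_closedNbhd]; exact hdeg v
  have heq := Finset.eq_of_subset_of_card_le hv hcard
  rw [← heq, card_closedNbhd] at hT
  rw [← heq]
  exact closedNbhd_mem_closedNbhdsOfCard hT

lemma closedNbhdsOfCard_eq_empty {G : SimpleGraph V} {i : ℕ} (h : ∀ v, i < G.degree v + 1) :
    closedNbhdsOfCard G i = ∅ := by
  rw [closedNbhdsOfCard, Finset.filter_false_of_mem fun v _ => (h v).ne', Finset.image_empty]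

lemma exists_domPoly_lt_of_card_closedNbhdsOfCard_lt {G H : SimpleGraph V} {i : ℕ}
    (hi : i < Fintype.card V) (hdeg : ∀ v, i ≤ G.degree v + 1)
    (hlt : (closedNbhdsOfCard G i).card < (closedNbhdsOfCard H i).card) :
    ∃ x : ℝ, 0 ≤ x ∧ domPoly H x < domPoly G x := by
  simp_rw [← sub_pos (b := domPoly H _), domPoly_sub]
  refine exists_sum_pos_of_leading (j := Fintype.card V - i) (Finset.mem_Icc.2 (by omega)) ?_ ?_
  · have h1 := domCount_add_card_closedNbhdsOfCard G hi.le hdeg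
    have h2 := domCount_add_card_closedNbhdsOfCard_le H hi.le
    have h3 : domCount H (Fintype.card V - i) + 1 ≤ domCount G (Fintype.card V - i) := by omega
    have h4 : ((domCount H (Fintype.card V - i) + 1 : ℕ) : ℝ) ≤ domCount G (Fintype.card V - i) :=
      Nat.cast_le.2 h3
    push_cast at h4
    linarith
  · intro j hj hij
    obtain ⟨l, hl, rfl⟩ : ∃ l ≤ Fintype.card V, j = Fintype.card V - l :=
      ⟨Fintype.card V - j, by omega, by have := Finset.mem_Icc.1 hj; omega⟩
    have hli : l < i := by omega
    have h1 := domCount_add_card_closedNbhdsOfCard G hl fun v => hli.le.trans (hdeg v)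
    have h2 := domCount_add_card_closedNbhdsOfCard_le H hl
    rw [closedNbhdsOfCard_eq_empty fun v => hli.trans_le (hdeg v), Finset.card_empty] at h1
    rw [sub_nonneg, Nat.cast_le]
    omega

end ClosedNeighborhoods

section Universal

variable {V : Type*} [Fintype V]

/-- The vertices adjacent to all other vertices. -/
noncomputable def universalVertices (G : SimpleGraph V) : Finset V :=
  Finset.univ.filter fun v => ∀ u, u ≠ v → G.Adj v u

lemma mem_universalVertices {G : SimpleGraph V} {v : V} :
    v ∈ universalVertices G ↔ ∀ u, u ≠ v → G.Adj v u := by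
  simp [universalVertices]

lemma domCount_one (G : SimpleGraph V) : domCount G 1 = (universalVertices G).card := by
  rw [← Finset.card_map ⟨fun v : V => ({v} : Finset V), Finset.singleton_injective⟩, domCount]
  congr 1
  ext S
  simp only [Finset.mem_filter, Finset.mem_univ, true_and, Finset.mem_map, mem_universalVertices,
    Function.Embedding.coeFn_mk, Finset.card_eq_one]
  constructor
  · rintro ⟨hS, v, rfl⟩
    refine ⟨v, fun u hu => ?_, rfl⟩
    rcases hS u with h | ⟨w, hw, h⟩
    · exact absurd (Finset.mem_singleton.1 h) hu
    · rwa [← Finset.mem_singleton.1 hw]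
  · rintro ⟨v, hv, rfl⟩
    refine ⟨fun u => ?_, v, rfl⟩
    by_cases h : u = v
    · exact Or.inl (Finset.mem_singleton.2 h)
    · exact Or.inr ⟨v, Finset.mem_singleton_self v, hv u h⟩

lemma exists_domPoly_lt_of_card_universalVertices_lt {G H : SimpleGraph V}
    (hlt : (universalVertices H).card < (universalVertices G).card) :
    ∃ x : ℝ, 0 ≤ x ∧ domPoly H x < domPoly G x := by
  simp_rw [← sub_pos (b := domPoly H _), domPoly_sub]
  refine exists_sum_pos_of_lowest ?_ ?_
  · have := Finset.card_le_univ (universalVertices G)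
    omega
  · rw [domCount_one, domCount_one]
    have h : (((universalVertices H).card + 1 : ℕ) : ℝ) ≤ (universalVertices G).card :=
      Nat.cast_le.2 hlt
    push_cast at h
    linarith

lemma universalVertices_subset_neighborFinset {H : SimpleGraph V} {v : V}
    (hv : v ∉ universalVertices H) : universalVertices H ⊆ H.neighborFinset v := by
  intro u hu
  rw [SimpleGraph.mem_neighborFinset]
  exact (mem_universalVertices.1 hu v fun h => hv (h ▸ hu)).symm

end Universal

section Existence

variable {V : Type*} [Fintype V] [DecidableEq V]

lemma exists_le_card_edgeFinset_eq (J : SimpleGraph V) {m : ℕ} (hJ : J.edgeFinset.card ≤ m)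
    (hm : m ≤ (Fintype.card V).choose 2) :
    ∃ G : SimpleGraph V, J ≤ G ∧ G.edgeFinset.card = m := by
  obtain ⟨E, hJE, hE, hcard⟩ := Finset.exists_subsuperset_card_eq
    (SimpleGraph.edgeFinset_mono (le_top : J ≤ ⊤)) hJ
    (by rwa [SimpleGraph.card_edgeFinset_top_eq_card_choose_two])
  obtain ⟨G, hset⟩ : ∃ G : SimpleGraph V, G.edgeSet = E := by
    refine ⟨SimpleGraph.fromEdgeSet E, ?_⟩
    rw [SimpleGraph.edgeSet_fromEdgeSet]
    refine sdiff_eq_left.2 (Set.disjoint_left.2 fun e he hd => ?_)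
    have := hE he
    rw [SimpleGraph.mem_edgeFinset] at this
    exact SimpleGraph.not_isDiag_of_mem_edgeSet _ this hd
  refine ⟨G, ?_, ?_⟩
  · rw [← SimpleGraph.edgeSet_subset_edgeSet, hset]
    intro e he
    exact hJE (SimpleGraph.mem_edgeFinset.2 he)
  · rw [← hcard]
    congr 1
    ext e
    rw [SimpleGraph.mem_edgeFinset, hset, Finset.mem_coe]

lemma exists_card_le_card_universalVertices {k m : ℕ} (hk : k ≤ Fintype.card V)
    (hkm : k * (Fintype.card V - 1) + (Fintype.card V - k) * k ≤ 2 * m)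
    (hm : m ≤ (Fintype.card V).choose 2) :
    ∃ G : SimpleGraph V, G.edgeFinset.card = m ∧ k ≤ (universalVertices G).card := by
  obtain ⟨U, -, hU⟩ := Finset.exists_subset_card_eq (s := (Finset.univ : Finset V)) hk
  obtain ⟨J, hadj⟩ : ∃ J : SimpleGraph V, ∀ a b, J.Adj a b ↔ a ≠ b ∧ (a ∈ U ∨ b ∈ U) :=
    ⟨{ Adj := fun a b => a ≠ b ∧ (a ∈ U ∨ b ∈ U)
       symm := ⟨fun a b h => ⟨h.1.symm, h.2.symm⟩⟩
       loopless := ⟨fun a h => h.1 rfl⟩ }, fun _ _ => Iff.rfl⟩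
  have hJ : J.edgeFinset.card ≤ m := by
    have hsum := J.sum_degrees_eq_twice_card_edges
    rw [← Finset.sum_add_sum_compl U] at hsum
    have h1 : ∑ v ∈ U, J.degree v ≤ U.card * (Fintype.card V - 1) :=
      Finset.sum_le_card_nsmul _ _ _ fun v _ => Nat.le_sub_one_of_lt (J.degree_lt_card_verts v)
    have h2 : ∑ v ∈ Uᶜ, J.degree v ≤ Uᶜ.card * k := by
      refine Finset.sum_le_card_nsmul _ _ _ fun v hv => ?_
      rw [← SimpleGraph.card_neighborFinset_eq_degree, ← hU]
      refine Finset.card_le_card fun w hw => ?_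
      rw [SimpleGraph.mem_neighborFinset, hadj] at hw
      exact hw.2.resolve_left (Finset.mem_compl.1 hv)
    rw [Finset.card_compl, hU] at h2
    rw [hU] at h1
    omega
  obtain ⟨G, hJG, hG⟩ := exists_le_card_edgeFinset_eq J hJ hm
  refine ⟨G, hG, hU ▸ Finset.card_le_card fun v hv => mem_universalVertices.2 fun u hu => ?_⟩
  exact hJG ((hadj v u).2 ⟨hu.symm, Or.inl hv⟩)

lemma exists_sum_sq_degree_lt (G : SimpleGraph V) {u v : V}
    (h : G.degree v + 1 < G.degree u) :
    ∃ G' : SimpleGraph V, G'.edgeFinset.card = G.edgeFinset.card ∧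
      ∑ a, (G'.degree a : ℤ) ^ 2 < ∑ a, (G.degree a : ℤ) ^ 2 := by
  have huv : u ≠ v := by rintro rfl; omega
  obtain ⟨w, hwu, hwv⟩ : ∃ w ∈ G.neighborFinset u, w ∉ insert v (G.neighborFinset v) := by
    by_contra! hsub
    have h1 := Finset.card_le_card hsub
    have h2 := Finset.card_insert_le v (G.neighborFinset v)
    simp only [SimpleGraph.card_neighborFinset_eq_degree] at h1 h2
    omega
  simp only [SimpleGraph.mem_neighborFinset, Finset.mem_insert, not_or] at hwu hwv
  have hwu' := hwu.ne
  obtain ⟨hwv', hwv⟩ := hwv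
  obtain ⟨G', hadj⟩ : ∃ G' : SimpleGraph V, ∀ a b, G'.Adj a b ↔
      (G.Adj a b ∧ ¬ (a = u ∧ b = w) ∧ ¬ (a = w ∧ b = u)) ∨
        (a = v ∧ b = w) ∨ (a = w ∧ b = v) :=
    ⟨{ Adj := fun a b => (G.Adj a b ∧ ¬ (a = u ∧ b = w) ∧ ¬ (a = w ∧ b = u)) ∨
         (a = v ∧ b = w) ∨ (a = w ∧ b = v)
       symm := ⟨fun a b hab => by
         have := G.adj_comm a b
         tauto⟩
       loopless := ⟨fun a ha => by
         rcases ha with ha | ⟨rfl, hw⟩ | ⟨rfl, hw⟩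
         exacts [ha.1.ne rfl, hwv' hw.symm, hwv' hw]⟩ }, fun _ _ => Iff.rfl⟩
  have hdeg (a : V) : (G'.degree a : ℤ) =
      G.degree a + (if a = v then 1 else 0) - (if a = u then 1 else 0) := by
    simp only [← SimpleGraph.card_neighborFinset_eq_degree]
    by_cases hau : a = u
    · subst hau
      have : G'.neighborFinset a = (G.neighborFinset a).erase w := by
        ext b; simp only [SimpleGraph.mem_neighborFinset, hadj, Finset.mem_erase]; grind
      have h1 := Finset.card_erase_add_one ((G.mem_neighborFinset a w).2 hwu)
      rw [this, if_neg huv, if_pos rfl, ← h1]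
      push_cast; ring
    by_cases hav : a = v
    · subst hav
      have : G'.neighborFinset a = insert w (G.neighborFinset a) := by
        ext b; simp only [SimpleGraph.mem_neighborFinset, hadj, Finset.mem_insert]; grind
      rw [this, if_pos rfl, if_neg hau, Finset.card_insert_of_notMem (by simpa using hwv)]
      push_cast; ring
    rw [if_neg hau, if_neg hav]
    by_cases haw : a = w
    · subst haw
      have : G'.neighborFinset a = insert v ((G.neighborFinset a).erase u) := by
        ext b
        simp only [SimpleGraph.mem_neighborFinset, hadj, Finset.mem_insert, Finset.mem_erase]
        grind
      rw [this, Finset.card_insert_of_notMem (by simp [G.adj_comm a v, hwv]),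
        Finset.card_erase_add_one ((G.mem_neighborFinset a u).2 hwu.symm)]
      ring
    · have : G'.neighborFinset a = G.neighborFinset a := by
        ext b; simp only [SimpleGraph.mem_neighborFinset, hadj]; grind
      rw [this]
      ring
  refine ⟨G', ?_, ?_⟩
  · have h1 := G.sum_degrees_eq_twice_card_edges
    have h2 := G'.sum_degrees_eq_twice_card_edges
    have h3 : ∑ a, (G'.degree a : ℤ) = ∑ a, (G.degree a : ℤ) := by
      simp only [hdeg, Finset.sum_sub_distrib, Finset.sum_add_distrib, Finset.sum_ite_eq',
        Finset.mem_univ, if_true]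
      ring
    have h4 : ∑ a, G'.degree a = ∑ a, G.degree a := by exact_mod_cast h3
    omega
  · have hsq (a : V) : (G'.degree a : ℤ) ^ 2 = (G.degree a : ℤ) ^ 2 +
        (if a = v then 2 * (G.degree v : ℤ) + 1 else 0) -
        (if a = u then 2 * (G.degree u : ℤ) - 1 else 0) := by
      rw [hdeg]
      by_cases hau : a = u
      · subst hau; simp only [if_neg huv, if_true]; ring
      · by_cases hav : a = v
        · subst hav; simp only [if_neg hau, if_true]; ring
        · simp only [if_neg hau, if_neg hav]; ring
    simp only [hsq, Finset.sum_sub_distrib, Finset.sum_add_distrib, Finset.sum_ite_eq',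
        Finset.mem_univ, if_true]
    have : (G.degree v : ℤ) + 1 < G.degree u := by exact_mod_cast h
    linarith

lemma exists_nearly_regular {m : ℕ} (hm : m ≤ (Fintype.card V).choose 2) :
    ∃ G : SimpleGraph V, G.edgeFinset.card = m ∧ ∀ u v, G.degree u ≤ G.degree v + 1 := by
  obtain ⟨J, hJ⟩ : ∃ J : SimpleGraph V, J = ⊥ := ⟨⊥, rfl⟩
  obtain ⟨G₀, -, hG₀⟩ := exists_le_card_edgeFinset_eq J (m := m)
    (by rw [SimpleGraph.edgeFinset_eq_empty.2 hJ, Finset.card_empty]; exact m.zero_le) hm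
  obtain ⟨G, hG, hmin⟩ := Finset.exists_min_image
    (Finset.univ.filter fun G : SimpleGraph V => G.edgeFinset.card = m)
    (fun G => ∑ a, (G.degree a : ℤ) ^ 2) ⟨G₀, by simpa using hG₀⟩
  simp only [Finset.mem_filter, Finset.mem_univ, true_and] at hG hmin
  refine ⟨G, hG, fun u v => ?_⟩
  by_contra! h
  obtain ⟨G', hG', hlt⟩ := exists_sum_sq_degree_lt G h
  exact (hmin G' (hG'.trans hG)).not_gt hlt

lemma exists_le_degree {m q : ℕ} (hm : m ≤ (Fintype.card V).choose 2)
    (hq : Fintype.card V * q ≤ 2 * m) :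
    ∃ G : SimpleGraph V, G.edgeFinset.card = m ∧ (∀ v, q ≤ G.degree v) ∧
      (2 * m ≤ Fintype.card V * (q + 1) →
        (closedNbhdsOfCard G (q + 1)).card + 2 * m ≤ Fintype.card V * (q + 1)) := by
  obtain ⟨G, hG, hreg⟩ := exists_nearly_regular hm
  have hsum := G.sum_degrees_eq_twice_card_edges
  rw [hG] at hsum
  have hle : ∀ v, q ≤ G.degree v := by
    by_contra! ⟨v, hv⟩
    have : ∑ a, G.degree a < ∑ _a : V, q :=
      Finset.sum_lt_sum (fun a _ => by have := hreg a v; omega) ⟨v, Finset.mem_univ v, hv⟩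
    rw [Finset.sum_const, Finset.card_univ, smul_eq_mul] at this
    omega
  refine ⟨G, hG, hle, fun hq' => ?_⟩
  have hup : ∀ v, G.degree v ≤ q + 1 := by
    by_contra! ⟨v, hv⟩
    have : ∑ _a : V, (q + 1) < ∑ a, G.degree a :=
      Finset.sum_lt_sum (fun a _ => by have := hreg v a; omega) ⟨v, Finset.mem_univ v, hv⟩
    rw [Finset.sum_const, Finset.card_univ, smul_eq_mul] at this
    omega
  have hcount : (Finset.univ.filter fun v => G.degree v + 1 = q + 1).card + ∑ v, G.degree v =
      Fintype.card V * (q + 1) := by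
    rw [Finset.card_filter, ← Finset.sum_add_distrib, ← Finset.card_univ, ← smul_eq_mul,
      ← Finset.sum_const]
    refine Finset.sum_congr rfl fun v _ => ?_
    have := hle v
    have := hup v
    split_ifs <;> omega
  have := Finset.card_image_le (s := Finset.univ.filter fun v => G.degree v + 1 = q + 1)
    (f := closedNbhd G)
  rw [closedNbhdsOfCard]
  omega

end Existence

section DegreeCounting

variable {V : Type*} [Fintype V] [DecidableEq V]

/-- The number of neighbors of a non-universal vertex which are not universal themselves. -/
noncomputable def residualDegree (H : SimpleGraph V) (v : V) : ℕ :=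
  (H.neighborFinset v \ universalVertices H).card

lemma degree_of_mem_universalVertices {H : SimpleGraph V} {v : V}
    (hv : v ∈ universalVertices H) : H.degree v + 1 = Fintype.card V := by
  rw [← card_closedNbhd, ← Finset.card_univ]
  congr 1
  refine Finset.eq_univ_of_forall fun u => mem_closedNbhd.2 ?_
  by_cases h : u = v
  exacts [Or.inl h, Or.inr (mem_universalVertices.1 hv u h)]

lemma degree_eq_add_residualDegree {H : SimpleGraph V} {v : V} (hv : v ∉ universalVertices H) :
    H.degree v = (universalVertices H).card + residualDegree H v := by
  rw [residualDegree, ← SimpleGraph.card_neighborFinset_eq_degree, add_comm,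
    Finset.card_sdiff_add_card_eq_card (universalVertices_subset_neighborFinset hv)]

lemma two_mul_card_edgeFinset_add (H : SimpleGraph V) :
    2 * H.edgeFinset.card + (universalVertices H).card =
      (universalVertices H).card * Fintype.card V +
      (universalVertices H)ᶜ.card * (universalVertices H).card +
      ∑ v ∈ (universalVertices H)ᶜ, residualDegree H v := by
  rw [← H.sum_degrees_eq_twice_card_edges, ← Finset.sum_add_sum_compl (universalVertices H),
    Finset.sum_congr rfl fun v (hv : v ∈ (universalVertices H)ᶜ) =>
      degree_eq_add_residualDegree (Finset.mem_compl.1 hv),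
    Finset.sum_add_distrib, Finset.sum_const, smul_eq_mul]
  have h : ∑ v ∈ universalVertices H, (H.degree v + 1) =
      (universalVertices H).card * Fintype.card V := by
    rw [Finset.sum_congr rfl fun v hv => degree_of_mem_universalVertices hv, Finset.sum_const,
      smul_eq_mul]
  rw [Finset.sum_add_distrib, Finset.sum_const, smul_eq_mul, mul_one] at h
  omega

lemma card_le_mul_card_closedNbhdsOfCard (H : SimpleGraph V) {d : ℕ} :
    ((universalVertices H)ᶜ.filter fun v => residualDegree H v = d).card ≤
      (d + 1) * (closedNbhdsOfCard H ((universalVertices H).card + d + 1)).card := by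
  set L := (universalVertices H)ᶜ.filter fun v => residualDegree H v = d with hL
  have hmem : ∀ v ∈ L, v ∉ universalVertices H ∧ residualDegree H v = d := by
    intro v hv
    simpa [hL] using hv
  refine Finset.card_le_mul_card_image_of_maps_to (f := closedNbhd H) (fun v hv => ?_) _ ?_
  · refine closedNbhd_mem_closedNbhdsOfCard ?_
    rw [degree_eq_add_residualDegree (hmem v hv).1, (hmem v hv).2]
  · intro T hT
    rcases (L.filter fun v => closedNbhd H v = T).eq_empty_or_nonempty with h | ⟨v, hv⟩
    · rw [h]; simp
    obtain ⟨hvL, rfl⟩ := Finset.mem_filter.1 hv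
    have hsub : (L.filter fun u => closedNbhd H u = closedNbhd H v) ⊆
        insert v (H.neighborFinset v \ universalVertices H) := by
      intro u hu
      obtain ⟨huL, hu⟩ := Finset.mem_filter.1 hu
      have h := self_mem_closedNbhd H u
      rw [hu, mem_closedNbhd] at h
      simp only [Finset.mem_insert, Finset.mem_sdiff, SimpleGraph.mem_neighborFinset]
      exact h.imp_right fun h => ⟨h, (hmem u huL).1⟩
    refine (Finset.card_le_card hsub).trans ((Finset.card_insert_le _ _).trans ?_)
    rw [← (hmem v hvL).2, residualDegree]

lemma two_mul_card_compl_le {H : SimpleGraph V}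
    (hpos : ∀ v ∉ universalVertices H, 1 ≤ residualDegree H v) :
    2 * (universalVertices H)ᶜ.card ≤ ∑ v ∈ (universalVertices H)ᶜ, residualDegree H v +
      ((universalVertices H)ᶜ.filter fun v => residualDegree H v = 1).card := by
  rw [Finset.card_filter, ← Finset.sum_add_distrib, mul_comm, ← smul_eq_mul, ← Finset.sum_const]
  refine Finset.sum_le_sum fun v hv => ?_
  have := hpos v (Finset.mem_compl.1 hv)
  split_ifs <;> omega

lemma three_le_card_closedNbhdsOfCard_three {H : SimpleGraph V}
    (hU : (universalVertices H).card = 1) (hcompl : 4 ≤ (universalVertices H)ᶜ.card)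
    (hpos : ∀ v ∉ universalVertices H, 1 ≤ residualDegree H v)
    (hsum : ∑ v ∈ (universalVertices H)ᶜ, residualDegree H v = (universalVertices H)ᶜ.card + 1) :
    3 ≤ (closedNbhdsOfCard H 3).card := by
  have hL := two_mul_card_compl_le hpos
  obtain ⟨w, hw, hw2⟩ : ∃ w ∈ (universalVertices H)ᶜ, 1 < residualDegree H w := by
    by_contra! h
    have : ∑ v ∈ (universalVertices H)ᶜ, residualDegree H v ≤ _ :=
      Finset.sum_le_card_nsmul _ _ _ h
    rw [smul_eq_mul] at this
    omega
  have hw' := Finset.mem_compl.1 hw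
  have hrest := Finset.add_sum_erase _ (residualDegree H) hw
  have hone : ∀ v ∉ universalVertices H, v ≠ w → residualDegree H v = 1 := by
    by_contra! ⟨v, hv, hvw, hv1⟩
    have hlt : ∑ _v ∈ (universalVertices H)ᶜ.erase w, 1 <
        ∑ v ∈ (universalVertices H)ᶜ.erase w, residualDegree H v :=
      Finset.sum_lt_sum (fun u hu => hpos u (Finset.mem_compl.1 (Finset.mem_of_mem_erase hu)))
        ⟨v, Finset.mem_erase.2 ⟨hvw, Finset.mem_compl.2 hv⟩, by have := hpos v hv; omega⟩
    rw [Finset.sum_const, smul_eq_mul, mul_one, Finset.card_erase_of_mem hw] at hlt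
    omega
  have hw2 : residualDegree H w = 2 := by
    have hle : ∑ _v ∈ (universalVertices H)ᶜ.erase w, 1 ≤
        ∑ v ∈ (universalVertices H)ᶜ.erase w, residualDegree H v :=
      Finset.sum_le_sum fun u hu => hpos u (Finset.mem_compl.1 (Finset.mem_of_mem_erase hu))
    rw [Finset.sum_const, smul_eq_mul, mul_one, Finset.card_erase_of_mem hw] at hle
    omega
  obtain ⟨c, hc⟩ := Finset.card_eq_one.1 hU
  obtain ⟨a, b, hab, hNw⟩ := Finset.card_eq_two.1 hw2
  have hNw' (v : V) : (H.Adj w v ∧ v ∉ universalVertices H) ↔ v = a ∨ v = b := by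
    have := Finset.ext_iff.1 hNw v
    simpa using this
  obtain ⟨hwa, ha⟩ := (hNw' a).2 (Or.inl rfl)
  obtain ⟨hwb, hb⟩ := (hNw' b).2 (Or.inr rfl)
  obtain ⟨x, hx, hx'⟩ : ∃ x ∈ (universalVertices H)ᶜ, x ∉ ({w, a, b} : Finset V) := by
    by_contra! h
    have h1 := Finset.card_le_card h
    have h2 := Finset.card_le_three (a := w) (b := a) (c := b)
    omega
  simp only [Finset.mem_insert, Finset.mem_singleton, not_or] at hx'
  have hx := Finset.mem_compl.1 hx
  have hwx : ¬ H.Adj w x := fun h => ((hNw' x).1 ⟨h, hx⟩).elim hx'.2.1 hx'.2.2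
  have hmem : ∀ v ∉ universalVertices H, v ≠ w → closedNbhd H v ∈ closedNbhdsOfCard H 3 := by
    intro v hv hvw
    refine closedNbhd_mem_closedNbhdsOfCard ?_
    rw [degree_eq_add_residualDegree hv, hU, hone v hv hvw]
  have hxw : w ∉ closedNbhd H x := fun h =>
    (mem_closedNbhd.1 h).elim (fun h => hx'.1 h.symm) fun h => hwx h.symm
  have hxa : closedNbhd H a ≠ closedNbhd H x := fun h =>
    hxw (h ▸ mem_closedNbhd.2 (Or.inr hwa.symm))
  have hxb : closedNbhd H b ≠ closedNbhd H x := fun h =>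
    hxw (h ▸ mem_closedNbhd.2 (Or.inr hwb.symm))
  have habN : closedNbhd H a ≠ closedNbhd H b := by
    intro h
    have hba : b ∈ closedNbhd H a := h ▸ self_mem_closedNbhd H b
    have hab' : H.Adj a b := (mem_closedNbhd.1 hba).resolve_left hab.symm
    have hsub : ({b, w} : Finset V) ⊆ H.neighborFinset a \ universalVertices H := by
      intro v hv
      simp only [Finset.mem_insert, Finset.mem_singleton] at hv
      simp only [Finset.mem_sdiff, SimpleGraph.mem_neighborFinset]
      rcases hv with rfl | rfl
      exacts [⟨hab', hb⟩, ⟨hwa.symm, hw'⟩]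
    have h1 := Finset.card_le_card hsub
    rw [Finset.card_pair hwb.ne'] at h1
    have h2 := hone a ha hwa.ne'
    rw [residualDegree] at h2
    omega
  have hsub : ({closedNbhd H a, closedNbhd H b, closedNbhd H x} : Finset (Finset V)) ⊆
      closedNbhdsOfCard H 3 := by
    intro T hT
    simp only [Finset.mem_insert, Finset.mem_singleton] at hT
    rcases hT with rfl | rfl | rfl
    exacts [hmem a ha hwa.ne', hmem b hb hwb.ne', hmem x hx hx'.1]
  exact (Finset.card_eq_three.2 ⟨_, _, _, habN, hxa, hxb, rfl⟩).ge.trans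
    (Finset.card_le_card hsub)

lemma exists_parameters_of_maximal_card_universalVertices {n m : ℕ} {H : SimpleGraph (Fin n)}
    (hH : H.edgeFinset.card = m) (hm1 : n - 1 ≤ m) (hm2 : 2 * m + 14 ≤ n * (n - 1))
    (hm : m ≤ (Fintype.card (Fin n)).choose 2)
    (hmax : ∀ G : SimpleGraph (Fin n), G.edgeFinset.card = m →
      (universalVertices G).card ≤ (universalVertices H).card) :
    ∃ t, (universalVertices H)ᶜ.card = t + 1 ∧ n = (universalVertices H).card + t + 1 ∧
      4 ≤ t ∧ 1 ≤ (universalVertices H).card ∧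
      ∑ v ∈ (universalVertices H)ᶜ, residualDegree H v < 2 * t ∧
      2 * m = (universalVertices H).card * (universalVertices H).card +
        (universalVertices H).card * t + (universalVertices H).card * t +
        (universalVertices H).card + ∑ v ∈ (universalVertices H)ᶜ, residualDegree H v := by
  have hedges := two_mul_card_edgeFinset_add H
  have hcardU := Finset.card_add_card_compl (universalVertices H)
  set U := universalVertices H
  set k := U.card
  set r := Uᶜ.card
  set s := ∑ v ∈ Uᶜ, residualDegree H v with hs
  rw [hH, Fintype.card_fin] at hedges
  rw [Fintype.card_fin] at hcardU
  have hn : n ≠ 0 := by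
    rintro rfl
    simp at hm2
  have hr : 1 ≤ r := by
    by_contra! h
    have hr0 : r = 0 := by omega
    have hs0 : s = 0 := by
      rw [hs, Finset.card_eq_zero.1 hr0, Finset.sum_empty]
    have hkn : k = n := by omega
    rw [hr0, hs0, hkn] at hedges
    have : n * (n - 1) + n = n * n := by
      obtain ⟨l, rfl⟩ : ∃ l, n = l + 1 := ⟨n - 1, by omega⟩
      rw [Nat.add_sub_cancel]; ring
    omega
  obtain ⟨t, ht⟩ : ∃ t, r = t + 1 := ⟨r - 1, by omega⟩
  have hn1 : n - 1 = k + t := by omega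
  have hnk : n = k + t + 1 := by omega
  have hst : s < 2 * t := by
    by_contra! hle
    obtain ⟨G, hG, hGk⟩ := exists_card_le_card_universalVertices (V := Fin n) (k := k + 1) (m := m)
      (by rw [Fintype.card_fin]; omega)
      (by
        rw [Fintype.card_fin, hn1, show n - (k + 1) = t by omega]
        rw [ht, hnk] at hedges
        nlinarith) hm
    have := hmax G hG
    omega
  have hr5 : 4 ≤ t := by
    by_contra! h
    rw [hn1, hnk] at hm2
    rw [ht, hnk] at hedges
    interval_cases t <;> nlinarith
  have hk1 : 1 ≤ k := by
    by_contra! h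
    have hk0 : k = 0 := by omega
    rw [hk0] at hedges hn1
    omega
  have hsum : 2 * m = k * k + k * t + k * t + k + s := by
    rw [ht, hnk] at hedges
    nlinarith
  exact ⟨t, ht, hnk, hr5, hk1, hst, hsum⟩

end DegreeCounting

section SmallCase

/-- Witnessed by the disjoint union of a triangle and a complete graph on four vertices. -/
lemma exists_graph_seven_vertices_nine_edges :
    ∃ G : SimpleGraph (Fin 7), G.edgeFinset.card = 9 ∧ (∀ v, 2 ≤ G.degree v) ∧
      (closedNbhdsOfCard G 3).card ≤ 1 := by
  obtain ⟨G, hadj⟩ : ∃ G : SimpleGraph (Fin 7), ∀ a b, G.Adj a b ↔ a ≠ b ∧ (a < 3 ↔ b < 3) :=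
    ⟨{ Adj := fun a b => a ≠ b ∧ (a < 3 ↔ b < 3)
       symm := ⟨fun a b h => ⟨h.1.symm, h.2.symm⟩⟩
       loopless := ⟨fun a h => h.1 rfl⟩ }, fun _ _ => Iff.rfl⟩
  have hdeg (a : Fin 7) : G.degree a = if a < 3 then 2 else 3 := by
    have : G.neighborFinset a = Finset.univ.filter fun b => a ≠ b ∧ (a < 3 ↔ b < 3) := by
      ext b; simp [hadj]
    rw [← SimpleGraph.card_neighborFinset_eq_degree, this]
    clear this
    revert a
    decide
  refine ⟨G, ?_, fun v => ?_, ?_⟩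
  · have h := G.sum_degrees_eq_twice_card_edges
    have h2 : ∑ a : Fin 7, (if a < 3 then 2 else 3) = 18 := by decide
    simp only [hdeg, h2] at h
    omega
  · rw [hdeg]; split_ifs <;> omega
  · refine Finset.card_le_one.2 fun S hS T hT => ?_
    obtain ⟨v, hv, rfl⟩ := Finset.mem_image.1 hS
    obtain ⟨w, hw, rfl⟩ := Finset.mem_image.1 hT
    have key (u : Fin 7) (hu : G.degree u + 1 = 3) : u < 3 := by
      by_contra h
      rw [hdeg, if_neg h] at hu
      omega
    have hv := key v (Finset.mem_filter.1 hv).2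
    have hw := key w (Finset.mem_filter.1 hw).2
    ext b
    simp only [mem_closedNbhd, hadj]
    grind

end SmallCase

lemma add_add_one_le_mul {a b : ℕ} (ha : 2 ≤ a) (hb : 4 ≤ b) : a + b + 1 ≤ a * b := by
  nlinarith

lemma two_mul_add_add_one_le_mul {a b : ℕ} (ha : 3 ≤ a) (hb : 4 ≤ b) :
    2 * a + b + 1 ≤ a * b := by
  nlinarith

theorem stmt_12 (n m : ℕ) (hn : 6 ≤ n) (hm1 : n - 1 ≤ m) (hm2 : m < n.choose 2 - 6) :
    ¬ ∃ H : SimpleGraph (Fin n), H.edgeFinset.card = m ∧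
      ∀ G : SimpleGraph (Fin n), G.edgeFinset.card = m →
        ∀ x : ℝ, 0 ≤ x → domPoly G x ≤ domPoly H x := by
  rintro ⟨H, hH, hopt⟩
  have hchoose : 2 * m + 14 ≤ n * (n - 1) := by
    have := Nat.div_mul_le_self (n * (n - 1)) 2
    rw [← Nat.choose_two_right] at this
    omega
  have hm : m ≤ (Fintype.card (Fin n)).choose 2 := by
    rw [Fintype.card_fin]; omega
  have huniv (G : SimpleGraph (Fin n)) (hG : G.edgeFinset.card = m) :
      (universalVertices G).card ≤ (universalVertices H).card := by
    by_contra! hlt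
    obtain ⟨x, hx, h⟩ := exists_domPoly_lt_of_card_universalVertices_lt hlt
    exact (hopt G hG x hx).not_gt h
  have hnbhd (G : SimpleGraph (Fin n)) (hG : G.edgeFinset.card = m) (i : ℕ) (hi : i < n)
      (hdeg : ∀ v, i ≤ G.degree v + 1) :
      (closedNbhdsOfCard H i).card ≤ (closedNbhdsOfCard G i).card := by
    by_contra! hlt
    obtain ⟨x, hx, h⟩ := exists_domPoly_lt_of_card_closedNbhdsOfCard_lt
      (by rwa [Fintype.card_fin]) hdeg hlt
    exact (hopt G hG x hx).not_gt h
  obtain ⟨t, ht, hnk, hr5, hk1, hst, hsum⟩ :=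
    exists_parameters_of_maximal_card_universalVertices hH hm1 hchoose hm huniv
  have hfiber := fun d => card_le_mul_card_closedNbhdsOfCard H (d := d)
  have hpendant := two_mul_card_compl_le (H := H)
  have hthree := three_le_card_closedNbhdsOfCard_three (H := H)
  have hdegree := fun v => degree_eq_add_residualDegree (H := H) (v := v)
  set U := universalVertices H
  set k := U.card
  set r := Uᶜ.card with hr
  set s := ∑ v ∈ Uᶜ, residualDegree H v with hs
  clear_value k r s
  by_cases hzero : ∃ v ∉ U, residualDegree H v = 0
  · obtain ⟨v, hvU, hv⟩ := hzero
    have hvH := closedNbhd_mem_closedNbhdsOfCard (G := H) (v := v) (i := k + 1)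
      (by rw [hdegree v hvU, hv])
    by_cases hq : n * (k + 1) ≤ 2 * m
    · obtain ⟨G, hG, hdeg, -⟩ := exists_le_degree hm (q := k + 1) (by rwa [Fintype.card_fin])
      have h := hnbhd G hG (k + 1) (by omega) fun v => (hdeg v).trans (Nat.le_succ _)
      rw [closedNbhdsOfCard_eq_empty fun v => Nat.lt_succ_of_le (hdeg v), Finset.card_empty] at h
      exact (Finset.card_pos.2 ⟨_, hvH⟩).not_ge h
    · have hk : k = 1 := by
        by_contra hne
        have hk2 : 2 ≤ k := by omega
        apply hq
        have h1 := add_add_one_le_mul hk2 hr5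
        have h2 : n * (k + 1) = k * k + k * t + 2 * k + t + 1 := by rw [hnk]; ring
        omega
      rw [hk] at hsum hq hnk hfiber
      have hs0 : s = 0 := by omega
      obtain ⟨G, hG, hdeg, hcount⟩ := exists_le_degree hm (q := 1) (by rw [Fintype.card_fin]; omega)
      have h1 := hnbhd G hG 2 (by omega) fun v => Nat.succ_le_succ (hdeg v)
      have h2 := hcount (by rw [Fintype.card_fin]; omega)
      rw [Fintype.card_fin] at h2
      have h3 := hfiber 0
      rw [Finset.filter_true_of_mem fun u hu => Finset.sum_eq_zero_iff.1 (hs ▸ hs0) u hu] at h3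
      norm_num at h2 h3
      omega
  · push Not at hzero
    have hpos : ∀ v ∉ U, 1 ≤ residualDegree H v := fun v hv => Nat.one_le_iff_ne_zero.2 (hzero v hv)
    have hpend := hpendant hpos
    have hrs : r ≤ s := by
      have := Finset.card_nsmul_le_sum Uᶜ (residualDegree H) 1
        fun v hv => hpos v (Finset.mem_compl.1 hv)
      rwa [smul_eq_mul, mul_one, ← hr, ← hs] at this
    have hB := hfiber 1
    by_cases hq : n * (k + 2) ≤ 2 * m
    · obtain ⟨G, hG, hdeg, -⟩ := exists_le_degree hm (q := k + 2) (by rwa [Fintype.card_fin])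
      have h := hnbhd G hG (k + 2) (by omega) fun v => (hdeg v).trans (Nat.le_succ _)
      rw [closedNbhdsOfCard_eq_empty fun v => Nat.lt_succ_of_le (hdeg v), Finset.card_empty] at h
      have : k + 1 + 1 = k + 2 := rfl
      rw [this] at hB
      omega
    · have hk : k = 1 := by
        by_contra hne
        apply hq
        have h2 : n * (k + 2) = k * k + k * t + 3 * k + 2 * t + 2 := by rw [hnk]; ring
        rcases (show k = 2 ∨ 3 ≤ k by omega) with hk | hk
        · rw [hk] at hsum h2 ⊢
          omega
        · have h1 := two_mul_add_add_one_le_mul hk hr5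
          omega
      have hthree' := hthree hk (by omega) hpos
      rw [hk] at hsum hq hnk hB
      norm_num at hB hq
      obtain ⟨G, hG, hdeg, hcount⟩ := exists_le_degree hm (q := 2) (by rw [Fintype.card_fin]; omega)
      have h1 := hnbhd G hG 3 (by omega) fun v => Nat.succ_le_succ (hdeg v)
      have h2 := hcount (by rw [Fintype.card_fin]; omega)
      rw [Fintype.card_fin] at h2
      norm_num at h2
      by_cases hn7 : n = 7 ∧ m = 9
      · obtain ⟨rfl, rfl⟩ := hn7
        obtain ⟨K, hK, hKdeg, hKcard⟩ := exists_graph_seven_vertices_nine_edges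
        have := hnbhd K hK 3 (by omega) fun v => Nat.succ_le_succ (hKdeg v)
        omega
      · by_cases hsr : s = r + 1
        · have := hthree' hsr
          omega
        · omega
end

section
/- Let n ≥ 7 and let m = C(n,2) − k for some k with 2 ≤ k ≤ n/2. Then there is no least-optimal graph on n vertices and m edges; that is, there is no graph H on n vertices and m edges such that D(H,x) ≤ D(G,x) for all graphs G on n vertices and m edges and all x ≥ 0. -/
open scoped Classical

theorem domCount_one_s17 {V : Type*} [Fintype V] (G : SimpleGraph V) :
    domCount G 1 = (Finset.univ.filter fun v : V => ∀ u, u ≠ v → G.Adj v u).card := by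
  unfold domCount
  symm
  apply Finset.card_bij (fun v _ => ({v} : Finset V))
  · intro v hv
    simp only [Finset.mem_filter, Finset.mem_univ, true_and] at hv
    simp only [Finset.mem_filter, Finset.mem_univ, true_and, Finset.card_singleton, and_true]
    intro u
    by_cases h : u = v
    · simp [h]
    · exact Or.inr ⟨v, by simp, hv u h⟩
  · intro a _ b _ h
    simpa using h
  · intro S hS
    simp only [Finset.mem_filter, Finset.mem_univ, true_and] at hS
    obtain ⟨v, rfl⟩ := Finset.card_eq_one.1 hS.2
    refine ⟨v, ?_, rfl⟩
    simp only [Finset.mem_filter, Finset.mem_univ, true_and]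
    intro u hu
    simpa [hu] using hS.1 u

theorem domCount_le_choose {V : Type*} [Fintype V] (G : SimpleGraph V) (i : ℕ) :
    domCount G i ≤ (Fintype.card V).choose i := by
  rw [← Finset.card_univ, ← Finset.card_powersetCard]
  apply Finset.card_le_card
  intro S hS
  simp only [Finset.mem_filter, Finset.mem_univ, true_and] at hS
  simp [Finset.mem_powersetCard, hS.2]

theorem domCount_eq_choose {V : Type*} [Fintype V] (G : SimpleGraph V) (i : ℕ)
    (h : ∀ S : Finset V, S.card = i → IsDomSet G S) :
    domCount G i = (Fintype.card V).choose i := by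
  rw [← Finset.card_univ, ← Finset.card_powersetCard]
  unfold domCount
  congr 1
  ext S
  simp only [Finset.mem_filter, Finset.mem_univ, true_and, Finset.mem_powersetCard,
    Finset.subset_univ]
  exact ⟨fun hS => hS.2, fun hS => ⟨h S hS, hS⟩⟩

theorem domCount_lt_choose {V : Type*} [Fintype V] (G : SimpleGraph V) (S : Finset V)
    (h : ¬ IsDomSet G S) : domCount G S.card < (Fintype.card V).choose S.card := by
  rw [← Finset.card_univ, ← Finset.card_powersetCard]
  apply Finset.card_lt_card
  refine ⟨fun T hT => ?_, fun hs => ?_⟩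
  · simp only [Finset.mem_filter, Finset.mem_univ, true_and] at hT
    simp [Finset.mem_powersetCard, hT.2]
  · have := hs (Finset.mem_powersetCard.2 ⟨Finset.subset_univ S, rfl⟩)
    simp only [Finset.mem_filter] at this
    exact h this.2.1

/-- If one polynomial without constant term is bounded by another on `[0, ∞)`, then so are their
linear coefficients. -/
theorem coeff_one_le_of_sum_le {n : ℕ} (hn : 1 ≤ n) (a b : ℕ → ℝ)
    (h : ∀ x : ℝ, 0 ≤ x →
      ∑ i ∈ Finset.Icc 1 n, a i * x ^ i ≤ ∑ i ∈ Finset.Icc 1 n, b i * x ^ i) :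
    a 1 ≤ b 1 := by
  have key (c : ℕ → ℝ) :
      Filter.Tendsto (fun x : ℝ => ∑ i ∈ Finset.Icc 1 n, c i * x ^ (i - 1))
        (nhdsWithin 0 (Set.Ioi 0)) (nhds (c 1)) := by
    have hc : Continuous fun x : ℝ => ∑ i ∈ Finset.Icc 1 n, c i * x ^ (i - 1) := by fun_prop
    have h0 : ∑ i ∈ Finset.Icc 1 n, c i * (0 : ℝ) ^ (i - 1) = c 1 := by
      rw [Finset.sum_eq_single_of_mem 1 (by simp [hn])]
      · simp
      · intro i hi hi1
        have := (Finset.mem_Icc.1 hi).1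
        rw [zero_pow (by omega), mul_zero]
    simpa only [h0] using (hc.tendsto 0).mono_left nhdsWithin_le_nhds
  refine le_of_tendsto_of_tendsto (key a) (key b) ?_
  filter_upwards [self_mem_nhdsWithin] with x hx
  have hx : 0 < x := hx
  have e (c : ℕ → ℝ) : ∑ i ∈ Finset.Icc 1 n, c i * x ^ i =
      x * ∑ i ∈ Finset.Icc 1 n, c i * x ^ (i - 1) := by
    rw [Finset.mul_sum]
    refine Finset.sum_congr rfl fun i hi => ?_
    obtain ⟨j, rfl⟩ := Nat.exists_eq_add_of_le (Finset.mem_Icc.1 hi).1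
    rw [Nat.add_sub_cancel_left]
    ring
  have := h x hx.le
  rw [e, e] at this
  exact le_of_mul_le_mul_left this hx

/-- The graph obtained from the complete graph by deleting a finite set of edges. -/
theorem exists_graph_of_deleted_edges {V : Type*} [Fintype V] (T : Finset (Sym2 V))
    (hT : ∀ e ∈ T, ¬ e.IsDiag) :
    ∃ G : SimpleGraph V, G.edgeFinset.card = (Fintype.card V).choose 2 - T.card ∧
      ∀ u v, s(u, v) ∈ T → ¬ G.Adj u v := by
  refine ⟨(⊤ : SimpleGraph V).deleteEdges T, ?_, ?_⟩
  · have hsub : T ⊆ (⊤ : SimpleGraph V).edgeFinset := by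
      intro e he
      have := hT e he
      simpa using this
    rw [← SimpleGraph.card_edgeFinset_top_eq_card_choose_two, ← Finset.card_sdiff_of_subset hsub]
    congr 1
    ext e
    simp
  · intro u v h
    simp [SimpleGraph.deleteEdges_adj, h]

theorem exists_matching_complement {n k : ℕ} (hk : 2 * k ≤ n) :
    ∃ G : SimpleGraph (Fin n), G.edgeFinset.card = n.choose 2 - k ∧
      domCount G 1 ≤ n - 2 * k := by
  let f : Fin k → Sym2 (Fin n) := fun i =>
    s(⟨2 * i, by omega⟩, ⟨2 * i + 1, by omega⟩)
  have hf : Function.Injective f := by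
    intro i j hij
    simp only [f, Sym2.eq_iff, Fin.mk.injEq] at hij
    ext
    omega
  obtain ⟨G, hG, hadj⟩ := exists_graph_of_deleted_edges (Finset.univ.image f) (by
    intro e he
    obtain ⟨i, -, rfl⟩ := Finset.mem_image.1 he
    simp [f])
  rw [Finset.card_image_of_injective _ hf, Finset.card_univ, Fintype.card_fin,
    Fintype.card_fin] at hG
  refine ⟨G, hG, ?_⟩
  have hpair (i : Fin k) : ¬ G.Adj ⟨2 * i, by omega⟩ ⟨2 * i + 1, by omega⟩ :=
    hadj _ _ (Finset.mem_image_of_mem f (Finset.mem_univ i))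
  rw [domCount_one_s17]
  calc _ ≤ ((Finset.Ico (2 * k) n)).card := by
        apply Finset.card_le_card_of_injOn (fun v : Fin n => (v : ℕ))
        · intro v hv
          simp only [Finset.coe_filter, Finset.mem_univ, true_and, Set.mem_ofPred_eq] at hv
          simp only [Finset.coe_Ico, Set.mem_Ico, v.2, and_true]
          by_contra! hlt
          have hp := hpair ⟨v / 2, by omega⟩
          rcases Nat.mod_two_eq_zero_or_one v with h | h
          · have hv' : v = ⟨2 * (v / 2), by omega⟩ := Fin.ext (by simp only []; omega)
            apply hp
            convert hv ⟨2 * (v / 2) + 1, by omega⟩ (by rw [Ne, Fin.ext_iff]; simp only []; omega)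
            exact congrArg Fin.val hv'.symm
          · have hv' : v = ⟨2 * (v / 2) + 1, by omega⟩ := Fin.ext (by simp only []; omega)
            apply hp
            apply SimpleGraph.Adj.symm
            convert hv ⟨2 * (v / 2), by omega⟩ (by rw [Ne, Fin.ext_iff]; simp only []; omega)
            exact congrArg Fin.val hv'.symm
        · exact fun a _ b _ h => Fin.ext h
    _ = n - 2 * k := Nat.card_Ico _ _

theorem exists_complement_with_path {n k : ℕ} (hn : 3 ≤ n) (hk : 2 ≤ k) (hkn : k ≤ n.choose 2) :
    ∃ G : SimpleGraph (Fin n), G.edgeFinset.card = n.choose 2 - k ∧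
      domCount G 2 < n.choose 2 := by
  let a : Fin n := ⟨0, by omega⟩
  let b : Fin n := ⟨1, by omega⟩
  let c : Fin n := ⟨2, by omega⟩
  have hab : a ≠ b := by simp [a, b]
  have hac : a ≠ c := by simp [a, c]
  have hbc : b ≠ c := by simp [b, c]
  obtain ⟨T, hT1, hT2, hT3⟩ := Finset.exists_subsuperset_card_eq
    (s := {s(b, a), s(c, a)}) (t := (⊤ : SimpleGraph (Fin n)).edgeFinset) (n := k)
    (by
      intro e he
      simp only [Finset.mem_insert, Finset.mem_singleton] at he
      rcases he with rfl | rfl <;> simp [hab.symm, hac.symm])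
    (Finset.card_le_two.trans hk)
    (by rwa [SimpleGraph.card_edgeFinset_top_eq_card_choose_two, Fintype.card_fin])
  obtain ⟨G, hG, hadj⟩ := exists_graph_of_deleted_edges T (fun e he =>
    SimpleGraph.not_isDiag_of_mem_edgeFinset (hT2 he))
  rw [Fintype.card_fin, hT3] at hG
  refine ⟨G, hG, ?_⟩
  have := domCount_lt_choose G {b, c} (by
    intro h
    have hba := hadj b a (hT1 (by simp))
    have hca := hadj c a (hT1 (by simp))
    simpa [hab, hac, hba, hca] using h a)
  simpa [Finset.card_pair hbc] using this

/-- A graph missing `k` edges with at least `2k` non-universal vertices has every vertex missing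
at most one edge. -/
theorem degree_compl_le_one {n k : ℕ} (H : SimpleGraph (Fin n)) (hk : k ≤ n.choose 2)
    (hcard : H.edgeFinset.card = n.choose 2 - k) (hkn : 2 * k ≤ n)
    (hdom : domCount H 1 ≤ n - 2 * k) (v : Fin n) : Hᶜ.degree v ≤ 1 := by
  have hsum : ∑ v, Hᶜ.degree v = 2 * k := by
    have h1 : ∑ v, (H.degree v + Hᶜ.degree v) = n * (n - 1) := by
      rw [Finset.sum_congr rfl (g := fun _ => n - 1)]
      · simp
      · intro u _
        have := H.degree_lt_card_verts u
        rw [SimpleGraph.degree_compl]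
        simp only [Fintype.card_fin] at this ⊢
        omega
    rw [Finset.sum_add_distrib, SimpleGraph.sum_degrees_eq_twice_card_edges, hcard] at h1
    have h2 : n.choose 2 * 2 = n * (n - 1) := by
      rw [Nat.choose_two_right]
      exact Nat.div_mul_cancel (Nat.even_mul_pred_self n).two_dvd
    omega
  have hpos : 2 * k ≤ (Finset.univ.filter fun u => 0 < Hᶜ.degree u).card := by
    have h := Finset.card_filter_add_card_filter_not (s := (Finset.univ : Finset (Fin n)))
      (fun u => 0 < Hᶜ.degree u)
    have hle : (Finset.univ.filter fun u => ¬ 0 < Hᶜ.degree u).card ≤ domCount H 1 := by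
      rw [domCount_one_s17]
      apply Finset.card_le_card
      intro u
      simp only [Finset.mem_filter, Finset.mem_univ, true_and]
      intro hu w hw
      by_contra hn
      apply hu
      rw [SimpleGraph.degree_pos_iff_exists_adj]
      exact ⟨w, by rw [SimpleGraph.compl_adj]; exact ⟨hw.symm, hn⟩⟩
    rw [Finset.card_univ, Fintype.card_fin] at h
    omega
  by_contra! hv
  have hlt : ∑ u, (if 0 < Hᶜ.degree u then 1 else 0) < ∑ u, Hᶜ.degree u := by
    apply Finset.sum_lt_sum
    · intro u _
      split_ifs <;> omega
    · exact ⟨v, Finset.mem_univ v, by split_ifs <;> omega⟩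
  rw [← Finset.card_filter] at hlt
  omega

theorem isDomSet_of_degree_compl_le_one {V : Type*} [Fintype V] (H : SimpleGraph V)
    (h : ∀ v, Hᶜ.degree v ≤ 1) (S : Finset V) (hS : 2 ≤ S.card) : IsDomSet H S := by
  intro v
  by_contra! hv
  have : S ⊆ Hᶜ.neighborFinset v := by
    intro u hu
    rw [SimpleGraph.mem_neighborFinset, SimpleGraph.compl_adj]
    exact ⟨fun e => hv.1 (e ▸ hu), fun e => hv.2 u hu e.symm⟩
  have := Finset.card_le_card this
  rw [SimpleGraph.card_neighborFinset_eq_degree] at this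
  have := h v
  omega

theorem stmt_17 (n m k : ℕ) (hn : 7 ≤ n) (hk1 : 2 ≤ k) (hk2 : 2 * k ≤ n)
    (hm : m = n.choose 2 - k) :
    ¬ ∃ H : SimpleGraph (Fin n), H.edgeFinset.card = m ∧
      ∀ G : SimpleGraph (Fin n), G.edgeFinset.card = m →
        ∀ x : ℝ, 0 ≤ x → domPoly H x ≤ domPoly G x := by
  rintro ⟨H, hH, hopt⟩
  subst hm
  have hkn : k ≤ n.choose 2 := by
    have : n.choose 1 ≤ n.choose 2 := Nat.choose_le_succ_of_lt_half_left (by omega)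
    rw [Nat.choose_one_right] at this
    omega
  obtain ⟨M, hM, hM1⟩ := exists_matching_complement hk2
  obtain ⟨G, hG, hG2⟩ := exists_complement_with_path (by omega) hk1 hkn
  have hle : (domCount H 1 : ℝ) ≤ domCount M 1 := by
    refine coeff_one_le_of_sum_le (n := n) (by omega) (fun i => (domCount H i : ℝ))
      (fun i => (domCount M i : ℝ)) fun x hx => ?_
    simpa [domPoly] using hopt M hM x hx
  have hH1 : domCount H 1 ≤ n - 2 * k := le_trans (by exact_mod_cast hle) hM1
  have hdeg := degree_compl_le_one H hkn hH hk2 hH1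
  have hHi (i : ℕ) (hi : 2 ≤ i) : domCount H i = n.choose i := by
    simpa using domCount_eq_choose H i fun S hS =>
      isDomSet_of_degree_compl_le_one H (fun v => by convert hdeg v) S (hS ▸ hi)
  have hGi (i : ℕ) : domCount G i ≤ n.choose i := by simpa using domCount_le_choose G i
  have hx : (0 : ℝ) ≤ n + 1 := by positivity
  have hlt := hopt G hG (n + 1) hx
  have hsub : ({1, 2} : Finset ℕ) ⊆ Finset.Icc 1 n := by
    intro i hi
    simp only [Finset.mem_insert, Finset.mem_singleton] at hi
    rw [Finset.mem_Icc]
    omega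
  have hdiff : ∑ i ∈ Finset.Icc 1 n,
      ((domCount H i : ℝ) - domCount G i) * (n + 1 : ℝ) ^ i ≤ 0 := by
    simp only [sub_mul, Finset.sum_sub_distrib]
    simpa [domPoly] using hlt
  rw [← Finset.sum_sdiff hsub, Finset.sum_pair (by norm_num)] at hdiff
  have hrest : 0 ≤ ∑ i ∈ Finset.Icc 1 n \ {1, 2},
      ((domCount H i : ℝ) - domCount G i) * (n + 1 : ℝ) ^ i := by
    refine Finset.sum_nonneg fun i hi => mul_nonneg ?_ (by positivity)
    simp only [Finset.mem_sdiff, Finset.mem_Icc, Finset.mem_insert, Finset.mem_singleton] at hi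
    rw [hHi i (by omega), sub_nonneg]
    exact_mod_cast hGi i
  have h1 : (-n : ℝ) ≤ (domCount H 1 : ℝ) - domCount G 1 := by
    have : (domCount G 1 : ℝ) ≤ n := by exact_mod_cast (hGi 1).trans_eq (Nat.choose_one_right n)
    have : (0 : ℝ) ≤ domCount H 1 := by positivity
    linarith
  have h2 : (1 : ℝ) ≤ (domCount H 2 : ℝ) - domCount G 2 := by
    rw [hHi 2 le_rfl, le_sub_iff_add_le']
    exact_mod_cast hG2
  have h1' := mul_le_mul_of_nonneg_right h1 hx
  have h2' := mul_le_mul_of_nonneg_right h2 (pow_nonneg hx 2)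
  rw [pow_one] at hdiff
  nlinarith
end

section
/- Let n and k be positive integers with 2k ≤ n, and let H_k be the graph obtained from the complete graph K_n by removing the edges of a matching of size k. Then D(H_k, x) = (1+x)^n − 1 − 2kx for all real x. -/
open scoped Classical

theorem domPoly_eq_sum_pow_card {V : Type*} [Fintype V] [Nonempty V] (G : SimpleGraph V) (x : ℝ) :
    domPoly G x = ∑ S : Finset V with IsDomSet G S, x ^ S.card := by
  have hmaps : ∀ S ∈ Finset.univ.filter (fun S : Finset V => IsDomSet G S),
      S.card ∈ Finset.Icc 1 (Fintype.card V) := by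
    intro S hS
    rw [Finset.mem_filter] at hS
    refine Finset.mem_Icc.2 ⟨Finset.card_pos.2 ?_, Finset.card_le_univ S⟩
    rcases hS.2 (Classical.arbitrary V) with h | ⟨u, hu, -⟩
    exacts [⟨_, h⟩, ⟨u, hu⟩]
  rw [← Finset.sum_fiberwise_of_maps_to hmaps, domPoly]
  refine Finset.sum_congr rfl fun i _ => ?_
  rw [Finset.sum_congr rfl (g := fun _ => x ^ i)
    fun S hS => by rw [(Finset.mem_filter.1 hS).2], Finset.sum_const, nsmul_eq_mul,
    Finset.filter_filter, domCount]

/-- In a complete graph with a matching removed, the only sets that are not dominating are the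
empty set and the singletons of matched vertices. -/
theorem not_isDomSet_top_deleteEdges_iff {V : Type*} [Nonempty V] {M : Set (Sym2 V)}
    (hM : M ⊆ (⊤ : SimpleGraph V).edgeSet)
    (hdisj : M.Pairwise (fun e f => ∀ v : V, ¬(v ∈ e ∧ v ∈ f))) (S : Finset V) :
    ¬ IsDomSet ((⊤ : SimpleGraph V).deleteEdges M) S ↔
      S = ∅ ∨ ∃ u, (∃ e ∈ M, u ∈ e) ∧ S = {u} := by
  constructor
  · intro h
    simp only [IsDomSet, SimpleGraph.deleteEdges_adj, SimpleGraph.top_adj] at h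
    push Not at h
    obtain ⟨v, hv, h⟩ := h
    have hvM : ∀ u ∈ S, s(u, v) ∈ M := fun u hu => h u hu fun huv => hv (huv ▸ hu)
    refine S.eq_empty_or_nonempty.imp_right ?_
    rintro ⟨u, hu⟩
    refine ⟨u, ⟨_, hvM u hu, Sym2.mem_mk_left u v⟩, ?_⟩
    refine Finset.eq_singleton_iff_unique_mem.2 ⟨hu, fun w hw => ?_⟩
    by_contra hwu
    exact hdisj (hvM w hw) (hvM u hu) (fun he => hwu (Sym2.congr_left.1 he)) v
      ⟨Sym2.mem_mk_right w v, Sym2.mem_mk_right u v⟩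
  · rintro (rfl | ⟨u, ⟨e, he, hue⟩, rfl⟩) h
    · simpa using h (Classical.arbitrary V)
    · obtain ⟨v, rfl⟩ := hue
      have huv : u ≠ v := by simpa using hM he
      rcases h v with hv | ⟨w, hw, hadj⟩
      · exact huv (Finset.mem_singleton.1 hv).symm
      · rw [Finset.mem_singleton.1 hw, SimpleGraph.deleteEdges_adj] at hadj
        exact hadj.2 he

/-- A matching with `k` edges covers `2 * k` vertices. -/
theorem card_biUnion_toFinset_of_matching {V : Type*} [DecidableEq V] {M : Finset (Sym2 V)}
    (hM : ↑M ⊆ (⊤ : SimpleGraph V).edgeSet)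
    (hdisj : (M : Set (Sym2 V)).Pairwise (fun e f => ∀ v : V, ¬(v ∈ e ∧ v ∈ f))) :
    (M.biUnion Sym2.toFinset).card = 2 * M.card := by
  rw [Finset.card_biUnion, Finset.sum_const_nat (m := 2), mul_comm]
  · intro e he
    have hdiag := hM he
    exact Sym2.card_toFinset_of_not_isDiag e (SimpleGraph.not_isDiag_of_mem_edgeSet _ hdiag)
  · intro e he f hf hne
    refine Finset.disjoint_left.2 fun v hve hvf => hdisj he hf hne v ?_
    exact ⟨Sym2.mem_toFinset.1 hve, Sym2.mem_toFinset.1 hvf⟩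

theorem stmt_18 (n k : ℕ) (hn : 0 < n) (hk : 0 < k) (hkn : 2 * k ≤ n)
    (M : Finset (Sym2 (Fin n)))
    (hM : ↑M ⊆ (⊤ : SimpleGraph (Fin n)).edgeSet)
    (hcard : M.card = k)
    (hdisj : (M : Set (Sym2 (Fin n))).Pairwise
      (fun e f => ∀ v : Fin n, ¬(v ∈ e ∧ v ∈ f))) :
    ∀ x : ℝ,
      domPoly ((⊤ : SimpleGraph (Fin n)).deleteEdges ↑M) x =
        (1 + x) ^ n - 1 - 2 * k * x := by
  intro x
  have : Nonempty (Fin n) := ⟨⟨0, hn⟩⟩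
  set G := (⊤ : SimpleGraph (Fin n)).deleteEdges ↑M with hG
  set C := M.biUnion Sym2.toFinset with hC
  have hnot : (Finset.univ.filter fun S : Finset (Fin n) => ¬ IsDomSet G S) =
      insert ∅ (C.image fun u => {u}) := by
    ext S
    rw [Finset.mem_filter, hG, not_isDomSet_top_deleteEdges_iff hM hdisj]
    simp [hC, eq_comm (a := S)]
  have hsum : ∑ S : Finset (Fin n) with ¬ IsDomSet G S, x ^ S.card = 1 + 2 * k * x := by
    rw [hnot, Finset.sum_insert (by simp), Finset.sum_image (by simp)]
    simp [hC, card_biUnion_toFinset_of_matching hM hdisj, hcard]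
  have hall : ∑ S : Finset (Fin n), x ^ S.card = (1 + x) ^ n := by
    simpa [add_comm] using Fintype.sum_pow_mul_eq_add_pow (Fin n) x 1
  have hsplit := Finset.sum_filter_add_sum_filter_not Finset.univ
    (fun S : Finset (Fin n) => IsDomSet G S) (fun S => x ^ S.card)
  rw [domPoly_eq_sum_pow_card]
  linarith
end
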